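/- Let I be a compact interval of ℝ and let f: I → I be an interval map of class C^3 with non-flat critical points that is topologically exact. Then for every Hölder continuous potential φ: I → ℝ the following three properties are equivalent: (1) φ is hyperbolic for f; (2) the measure-theoretic entropy of every equilibrium state of f for the potential φ is strictly positive; (3) the Lyapunov exponent of every equilibrium state of f for the potential φ is strictly positive. -/

import Mathlib

open MeasureTheory Filter Set Metric

noncomputable section

/-- Shannon entropy of the law of a finitely-valued map `p` under the measure `μ`. -/
def partitionEntropy {X ι : Type*} [MeasurableSpace X] [Fintype ι]
    (μ : Measure X) (p : X → ι) : ℝ :=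
  ∑ i, Real.negMulLog (μ (p ⁻¹' {i})).toReal

/-- Kolmogorov–Sinai (measure-theoretic) entropy of `f` with respect to `μ`:
the supremum over finite measurable partitions (coded by maps into `Fin k`) of the
limit (here: infimum, by subadditivity) of the normalized entropies of the joins. -/
def ksEntropy {X : Type*} [MeasurableSpace X] (μ : Measure X) (f : X → X) : ℝ :=
  ⨆ k : ℕ, ⨆ p : { p : X → Fin k // Measurable p },
    ⨅ n : ℕ, partitionEntropy μ (fun x (i : Fin (n + 1)) => p.1 (f^[(i : ℕ)] x)) / (n + 1)

/-- `μ` is an `f`-invariant Borel probability measure giving full mass to `I`. -/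
def InvariantProb (f : ℝ → ℝ) (I : Set ℝ) (μ : Measure ℝ) : Prop :=
  IsProbabilityMeasure μ ∧ μ I = 1 ∧ ∀ A : Set ℝ, MeasurableSet A → μ (f ⁻¹' A) = μ A

/-- Topological pressure of `f : I → I` for the potential `φ`, defined via the
variational principle. -/
def pressure (f : ℝ → ℝ) (I : Set ℝ) (φ : ℝ → ℝ) : ℝ :=
  sSup { r : ℝ | ∃ μ : Measure ℝ, InvariantProb f I μ ∧ r = ksEntropy μ f + ∫ x, φ x ∂μ }

/-- An equilibrium state of `f` for the potential `φ`. -/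
def IsEquilibriumState (f : ℝ → ℝ) (I : Set ℝ) (φ : ℝ → ℝ) (μ : Measure ℝ) : Prop :=
  InvariantProb f I μ ∧ ksEntropy μ f + ∫ x, φ x ∂μ = pressure f I φ

/-- `φ` is Hölder continuous on `I`. -/
def HolderOn (φ : ℝ → ℝ) (I : Set ℝ) : Prop :=
  ∃ C α : ℝ, 0 < α ∧ α ≤ 1 ∧ 0 ≤ C ∧ ∀ x ∈ I, ∀ y ∈ I, |φ x - φ y| ≤ C * |x - y| ^ α

/-- `φ` is hyperbolic for `f`: for some `n ≥ 1`, `sup_I (1/n) Sₙ(φ) < P(f, φ)`. -/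
def HyperbolicPotential (f : ℝ → ℝ) (I : Set ℝ) (φ : ℝ → ℝ) : Prop :=
  ∃ n : ℕ, 1 ≤ n ∧ sSup ((fun x => birkhoffSum f φ n x / n) '' I) < pressure f I φ

/-- `g` is a `C³` diffeomorphism of `ℝ`. -/
def IsC3Diffeo (g : ℝ → ℝ) : Prop :=
  ContDiff ℝ 3 g ∧ Function.Bijective g ∧ ∀ x, deriv g x ≠ 0

/-- `f` is an interval map of class `C³` with non-flat critical points on `I = [a, b]`. -/
structure IsC3NonflatIntervalMap (f : ℝ → ℝ) (a b : ℝ) : Prop where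
  lt : a < b
  mapsTo : MapsTo f (Icc a b) (Icc a b)
  diff : ∀ x ∈ Icc a b, DifferentiableAt ℝ f x
  critFinite : {x | x ∈ Icc a b ∧ deriv f x = 0}.Finite
  smooth : ContDiffOn ℝ 3 f ((Icc a b) \ {x | deriv f x = 0})
  nonflat : ∀ c ∈ Icc a b, deriv f c = 0 →
    ∃ ℓ : ℝ, 1 < ℓ ∧ ∃ φ ψ : ℝ → ℝ, IsC3Diffeo φ ∧ IsC3Diffeo ψ ∧
      φ c = 0 ∧ ψ (f c) = 0 ∧
      ∀ᶠ x in nhdsWithin c (Icc a b), |ψ (f x)| = |φ x| ^ ℓ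

/-- `f : I → I` is topologically exact. -/
def TopExact (f : ℝ → ℝ) (I : Set ℝ) : Prop :=
  ∀ U : Set ℝ, IsOpen U → (U ∩ I).Nonempty → ∃ n : ℕ, 1 ≤ n ∧ f^[n] '' (U ∩ I) = I

set_option linter.unusedSectionVars false

namespace HypPot

/-! ### Entropy of finite partitions -/

section PartitionEntropy

variable {X ι κ : Type*} [MeasurableSpace X] [Fintype ι] [Fintype κ]
  [MeasurableSpace ι] [MeasurableSingletonClass ι] [MeasurableSpace κ] [MeasurableSingletonClass κ]
  {μ : Measure X}

lemma integral_comp_eq_sum [IsFiniteMeasure μ] {s : X → ι} (hs : Measurable s) (h : ι → ℝ) :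
    ∫ x, h (s x) ∂μ = ∑ i, μ.real (s ⁻¹' {i}) * h i := by
  rw [← integral_map (f := h) hs.aemeasurable (Measurable.of_discrete).aestronglyMeasurable,
    integral_fintype .of_finite]
  refine Finset.sum_congr rfl fun i _ => ?_
  rw [map_measureReal_apply hs (measurableSet_singleton i), smul_eq_mul]

lemma integrable_comp [IsFiniteMeasure μ] {s : X → ι} (hs : Measurable s) (h : ι → ℝ) :
    Integrable (fun x => h (s x)) μ :=
  (Integrable.of_finite (μ := μ.map s) (f := h)).comp_measurable hs

lemma sum_real_preimage [IsProbabilityMeasure μ] {s : X → ι} (hs : Measurable s) :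
    ∑ i, μ.real (s ⁻¹' {i}) = 1 := by
  have := integral_comp_eq_sum (μ := μ) hs (fun _ => (1 : ℝ))
  simpa using this.symm

lemma partitionEntropy_nonneg [IsProbabilityMeasure μ] (s : X → ι) :
    0 ≤ partitionEntropy μ s :=
  Finset.sum_nonneg fun _ _ => Real.negMulLog_nonneg measureReal_nonneg measureReal_le_one

lemma partitionEntropy_le_integral [IsProbabilityMeasure μ] {s : X → ι} (hs : Measurable s)
    {q : ι → ℝ} (hq : ∑ i, q i ≤ 1) (hq0 : ∀ i, 0 ≤ q i)
    (hpos : ∀ i, 0 < μ.real (s ⁻¹' {i}) → 0 < q i) :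
    partitionEntropy μ s ≤ ∫ x, -Real.log (q (s x)) ∂μ := by
  rw [integral_comp_eq_sum hs (fun i => -Real.log (q i))]
  have key : ∀ i, Real.negMulLog (μ.real (s ⁻¹' {i})) ≤
      μ.real (s ⁻¹' {i}) * -Real.log (q i) + (q i - μ.real (s ⁻¹' {i})) := by
    intro i
    rcases (measureReal_nonneg (μ := μ) (s := s ⁻¹' {i})).eq_or_lt with h | h
    · rw [← h]; simpa using hq0 i
    · have h2 := hpos i h
      set P := μ.real (s ⁻¹' {i})
      have h3 := Real.log_le_sub_one_of_pos (div_pos h2 h)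
      rw [Real.log_div h2.ne' h.ne'] at h3
      have h4 := mul_le_mul_of_nonneg_left h3 h.le
      rw [mul_sub P (q i / P), mul_div_cancel₀ _ h.ne'] at h4
      rw [Real.negMulLog]
      linarith
  have := Finset.sum_le_sum fun i (_ : i ∈ Finset.univ) => key i
  rw [Finset.sum_add_distrib, Finset.sum_sub_distrib, sum_real_preimage hs] at this
  exact this.trans (by linarith)

lemma negMulLog_add_le {x y : ℝ} (hx : 0 ≤ x) (hy : 0 ≤ y) :
    Real.negMulLog (x + y) ≤ Real.negMulLog x + Real.negMulLog y := by
  rcases hx.eq_or_lt with rfl | hx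
  · simp
  rcases hy.eq_or_lt with rfl | hy
  · simp
  have h1 := Real.log_le_log hx (by linarith : x ≤ x + y)
  have h2 := Real.log_le_log hy (by linarith : y ≤ x + y)
  simp only [Real.negMulLog]
  nlinarith

lemma negMulLog_sum_le {α : Type*} (t : Finset α) {a : α → ℝ} (ha : ∀ i, 0 ≤ a i) :
    Real.negMulLog (∑ i ∈ t, a i) ≤ ∑ i ∈ t, Real.negMulLog (a i) := by
  classical
  induction t using Finset.induction_on with
  | empty => simp
  | insert i t hi ih =>
    rw [Finset.sum_insert hi, Finset.sum_insert hi]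
    exact (negMulLog_add_le (ha i) (Finset.sum_nonneg fun i _ => ha i)).trans (by linarith)

lemma partitionEntropy_comp_le [IsProbabilityMeasure μ] {s : X → ι} (hs : Measurable s)
    (h : ι → κ) : partitionEntropy μ (fun x => h (s x)) ≤ partitionEntropy μ s := by
  classical
  have key : ∀ j, μ.real ((fun x => h (s x)) ⁻¹' {j}) =
      ∑ i with h i = j, μ.real (s ⁻¹' {i}) := by
    intro j
    rw [← measureReal_biUnion_finset]
    · congr 1
      ext x; simp
    · intro i _ i' _ hii
      exact Disjoint.preimage _ (by simpa using hii)
    · intro i _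
      exact hs (measurableSet_singleton i)
  calc ∑ j, Real.negMulLog (μ.real ((fun x => h (s x)) ⁻¹' {j}))
      ≤ ∑ j, ∑ i with h i = j, Real.negMulLog (μ.real (s ⁻¹' {i})) := by
        refine Finset.sum_le_sum fun j _ => ?_
        rw [key]
        exact negMulLog_sum_le _ fun i => measureReal_nonneg
    _ = _ := Finset.sum_fiberwise _ _ _

lemma partitionEntropy_prodMk_le [IsProbabilityMeasure μ] {s : X → ι} {t : X → κ}
    (hs : Measurable s) (ht : Measurable t) :
    partitionEntropy μ (fun x => (s x, t x)) ≤ partitionEntropy μ s + partitionEntropy μ t := by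
  have hst : Measurable (fun x => (s x, t x)) := hs.prodMk ht
  refine (partitionEntropy_le_integral hst
    (q := fun ij => μ.real (s ⁻¹' {ij.1}) * μ.real (t ⁻¹' {ij.2})) ?_ ?_ ?_).trans ?_
  · rw [Fintype.sum_prod_type]
    simp_rw [← Finset.mul_sum, sum_real_preimage ht, mul_one, sum_real_preimage hs, le_refl]
  · intro i; positivity
  · intro i hi
    refine mul_pos (hi.trans_le ?_) (hi.trans_le ?_)
    · exact measureReal_mono (fun x hx => by simp at hx ⊢; rw [← hx])
    · exact measureReal_mono (fun x hx => by simp at hx ⊢; rw [← hx])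
  · have e1 : partitionEntropy μ s = ∫ x, -Real.log (μ.real (s ⁻¹' {s x})) ∂μ := by
      rw [integral_comp_eq_sum hs (fun i => -Real.log (μ.real (s ⁻¹' {i})))]
      exact Finset.sum_congr rfl fun i _ => by
        simp only [Real.negMulLog, Measure.real]; ring
    have e2 : partitionEntropy μ t = ∫ x, -Real.log (μ.real (t ⁻¹' {t x})) ∂μ := by
      rw [integral_comp_eq_sum ht (fun i => -Real.log (μ.real (t ⁻¹' {i})))]
      exact Finset.sum_congr rfl fun i _ => by
        simp only [Real.negMulLog, Measure.real]; ring
    rw [e1, e2, ← integral_add (integrable_comp hs (fun i => -Real.log (μ.real (s ⁻¹' {i}))))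
      (integrable_comp ht (fun i => -Real.log (μ.real (t ⁻¹' {i}))))]
    have e3 : ∫ x, -Real.log (μ.real (s ⁻¹' {s x}) * μ.real (t ⁻¹' {t x})) ∂μ =
        ∑ i : ι × κ, μ.real ((fun x => (s x, t x)) ⁻¹' {i}) *
          -Real.log (μ.real (s ⁻¹' {i.1}) * μ.real (t ⁻¹' {i.2})) :=
      integral_comp_eq_sum hst
        (fun i => -Real.log (μ.real (s ⁻¹' {i.1}) * μ.real (t ⁻¹' {i.2})))
    have e4 : ∫ x, (-Real.log (μ.real (s ⁻¹' {s x})) + -Real.log (μ.real (t ⁻¹' {t x}))) ∂μ =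
        ∑ i : ι × κ, μ.real ((fun x => (s x, t x)) ⁻¹' {i}) *
          (-Real.log (μ.real (s ⁻¹' {i.1})) + -Real.log (μ.real (t ⁻¹' {i.2}))) :=
      integral_comp_eq_sum hst
        (fun i => -Real.log (μ.real (s ⁻¹' {i.1})) + -Real.log (μ.real (t ⁻¹' {i.2})))
    rw [e3, e4]
    refine Finset.sum_le_sum fun i _ => ?_
    rcases (measureReal_nonneg (μ := μ)
      (s := (fun x => (s x, t x)) ⁻¹' {i})).eq_or_lt with h | h
    · rw [← h]; simp
    · rw [Real.log_mul, neg_add]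
      · exact (h.trans_le (measureReal_mono (fun x hx => by simp at hx ⊢; rw [← hx]))).ne'
      · exact (h.trans_le (measureReal_mono (fun x hx => by simp at hx ⊢; rw [← hx]))).ne'

lemma neg_log_le_partitionEntropy [IsProbabilityMeasure μ] {s : X → ι} (hs : Measurable s) {c : ℝ}
    (hc : ∀ i, μ.real (s ⁻¹' {i}) ≤ c) : -Real.log c ≤ partitionEntropy μ s := by
  have : -Real.log c = ∑ i, μ.real (s ⁻¹' {i}) * -Real.log c := by
    rw [← Finset.sum_mul, sum_real_preimage hs, one_mul]
  rw [this]
  refine Finset.sum_le_sum fun i _ => ?_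
  rcases (measureReal_nonneg (μ := μ) (s := s ⁻¹' {i})).eq_or_lt with h | h
  · simp only [Measure.real] at h ⊢
    rw [← h]; simp
  · have h2 := Real.log_le_log h (hc i)
    have := mul_le_mul_of_nonneg_left (neg_le_neg h2) h.le
    simp only [Measure.real, Real.negMulLog] at this ⊢
    linarith

lemma partitionEntropy_convex_le {ν ν' : Measure X} [IsProbabilityMeasure ν]
    [IsProbabilityMeasure ν'] {s : X → ι} (hs : Measurable s) {θ : ℝ} (h0 : 0 ≤ θ) (h1 : θ ≤ 1)
    (hμ : ∀ A, MeasurableSet A → μ.real A = θ * ν.real A + (1 - θ) * ν'.real A) :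
    partitionEntropy μ s ≤ θ * partitionEntropy ν s + (1 - θ) * partitionEntropy ν' s +
      (Real.negMulLog θ + Real.negMulLog (1 - θ)) := by
  have h2 : 0 ≤ 1 - θ := by linarith
  have key : ∀ i, Real.negMulLog (μ.real (s ⁻¹' {i})) ≤
      θ * Real.negMulLog (ν.real (s ⁻¹' {i})) + (1 - θ) * Real.negMulLog (ν'.real (s ⁻¹' {i})) +
      (ν.real (s ⁻¹' {i}) * Real.negMulLog θ +
        ν'.real (s ⁻¹' {i}) * Real.negMulLog (1 - θ)) := by
    intro i
    rw [hμ _ (hs (measurableSet_singleton i))]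
    refine (negMulLog_add_le (by positivity) (by positivity)).trans (le_of_eq ?_)
    rw [Real.negMulLog_mul, Real.negMulLog_mul]; ring
  have := Finset.sum_le_sum fun i (_ : i ∈ Finset.univ) => key i
  refine this.trans (le_of_eq ?_)
  rw [Finset.sum_add_distrib, Finset.sum_add_distrib, Finset.sum_add_distrib, ← Finset.mul_sum,
    ← Finset.mul_sum, ← Finset.sum_mul, ← Finset.sum_mul, sum_real_preimage hs,
    sum_real_preimage hs, one_mul, one_mul]
  rfl

end PartitionEntropy

/-! ### Itineraries and the entropy of a finite partition along an orbit -/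

section Rate

variable {X ι : Type*} [MeasurableSpace X] [Fintype ι]
  [MeasurableSpace ι] [MeasurableSingletonClass ι] {μ : Measure X} {F : X → X} {p : X → ι}

/-- The `p`-itinerary of length `n` along the orbits of `F`. -/
def itin (F : X → X) (p : X → ι) (n : ℕ) (x : X) (i : Fin n) : ι := p (F^[(i : ℕ)] x)

lemma measurable_itin (hF : Measurable F) (hp : Measurable p) (n : ℕ) :
    Measurable (itin F p n) :=
  measurable_pi_lambda _ fun i => hp.comp (hF.iterate i)

/-- The entropy of the partition `p` under `F`. -/
def entropyRate (μ : Measure X) (F : X → X) (p : X → ι) : ℝ :=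
  ⨅ n : ℕ, partitionEntropy μ (itin F p (n + 1)) / (n + 1)

lemma partitionEntropy_comp_preserving (hF : MeasurePreserving F μ μ) {s : X → ι}
    (hs : Measurable s) : partitionEntropy μ (fun x => s (F x)) = partitionEntropy μ s := by
  refine Finset.sum_congr rfl fun i _ => ?_
  rw [← hF.measure_preimage (hs (measurableSet_singleton i)).nullMeasurableSet]
  rfl

lemma subadditive_itin [IsProbabilityMeasure μ] (hF : MeasurePreserving F μ μ)
    (hp : Measurable p) : Subadditive fun n => partitionEntropy μ (itin F p n) := by
  intro m n
  have hm := measurable_itin hF.measurable hp m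
  have hn := measurable_itin hF.measurable hp n
  have hn' : Measurable fun x => itin F p n (F^[m] x) := hn.comp (hF.measurable.iterate m)
  have h1 := partitionEntropy_prodMk_le (μ := μ) hm hn'
  rw [partitionEntropy_comp_preserving (hF.iterate m) hn] at h1
  refine le_trans (le_trans (le_of_eq ?_) (partitionEntropy_comp_le (hm.prodMk hn')
    (fun ab : (Fin m → ι) × (Fin n → ι) => Fin.append ab.1 ab.2))) h1
  refine congrArg (partitionEntropy μ) (funext fun x => funext fun i => ?_)
  refine Fin.addCases (fun i => ?_) (fun i => ?_) i
  · simp [itin]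
  · simp [itin, ← Function.iterate_add_apply, add_comm]

lemma tendsto_entropyRate [IsProbabilityMeasure μ] (hF : MeasurePreserving F μ μ)
    (hp : Measurable p) :
    Tendsto (fun n : ℕ => partitionEntropy μ (itin F p n) / n) atTop
      (nhds (entropyRate μ F p)) := by
  have hs := subadditive_itin hF hp
  have hb : BddBelow (range fun n : ℕ => partitionEntropy μ (itin F p n) / n) :=
    ⟨0, by rintro _ ⟨n, rfl⟩; exact div_nonneg (partitionEntropy_nonneg _) n.cast_nonneg⟩
  have h := hs.tendsto_lim hb
  convert h using 2
  rw [Subadditive.lim, entropyRate, iInf]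
  congr 1
  ext y
  constructor
  · rintro ⟨n, rfl⟩
    exact ⟨n + 1, by simp, by simp⟩
  · rintro ⟨n, hn, rfl⟩
    obtain ⟨m, rfl⟩ : ∃ m, n = m + 1 := ⟨n - 1, by simp at hn; omega⟩
    exact ⟨m, by simp⟩

lemma entropyRate_nonneg [IsProbabilityMeasure μ] : 0 ≤ entropyRate μ F p :=
  Real.iInf_nonneg fun n => div_nonneg (partitionEntropy_nonneg _) (by positivity)

lemma tendsto_entropyRate_mul [IsProbabilityMeasure μ] (hF : MeasurePreserving F μ μ)
    (hp : Measurable p) {T : ℕ} (hT : 1 ≤ T) :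
    Tendsto (fun q : ℕ => partitionEntropy μ (itin F p (T * q)) / q) atTop
      (nhds (T * entropyRate μ F p)) := by
  have hT0 : (0 : ℝ) < T := by exact_mod_cast hT
  have h1 : Tendsto (fun q : ℕ => T * q) atTop atTop :=
    tendsto_id.const_mul_atTop' (by omega)
  have h := ((tendsto_entropyRate hF hp).comp h1).const_mul (T : ℝ)
  refine h.congr fun q => ?_
  simp only [Function.comp, Nat.cast_mul]
  rw [← mul_div_assoc, mul_div_mul_left _ _ hT0.ne']

lemma entropyRate_le_of_itin_le [IsProbabilityMeasure μ] (hF : MeasurePreserving F μ μ)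
    (hp : Measurable p) {T : ℕ} (hT : 1 ≤ T) {C D : ℝ}
    (h : ∀ q : ℕ, 1 ≤ q → partitionEntropy μ (itin F p (T * q)) ≤ C * q + D) :
    T * entropyRate μ F p ≤ C := by
  have hl : Tendsto (fun q : ℕ => C + D / q) atTop (nhds (C + 0)) :=
    tendsto_const_nhds.add (tendsto_const_div_atTop_nhds_zero_nat D)
  rw [add_zero] at hl
  refine le_of_tendsto_of_tendsto (tendsto_entropyRate_mul hF hp hT) hl
    (eventually_atTop.2 ⟨1, fun q hq => ?_⟩)
  have hq0 : (0 : ℝ) < q := by exact_mod_cast hq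
  simp only
  rw [div_le_iff₀ hq0, add_mul, div_mul_cancel₀ _ hq0.ne']
  exact h q hq

lemma le_entropyRate_of_le_itin [IsProbabilityMeasure μ] (hF : MeasurePreserving F μ μ)
    (hp : Measurable p) {T : ℕ} (hT : 1 ≤ T) {C D : ℝ}
    (h : ∀ q : ℕ, 1 ≤ q → C * q + D ≤ partitionEntropy μ (itin F p (T * q))) :
    C ≤ T * entropyRate μ F p := by
  have hl : Tendsto (fun q : ℕ => C + D / q) atTop (nhds (C + 0)) :=
    tendsto_const_nhds.add (tendsto_const_div_atTop_nhds_zero_nat D)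
  rw [add_zero] at hl
  refine le_of_tendsto_of_tendsto hl (tendsto_entropyRate_mul hF hp hT)
    (eventually_atTop.2 ⟨1, fun q hq => ?_⟩)
  have hq0 : (0 : ℝ) < q := by exact_mod_cast hq
  simp only
  rw [le_div_iff₀ hq0, add_mul, div_mul_cancel₀ _ hq0.ne']
  exact h q hq

lemma entropyRate_convex_le {ν ν' : Measure X} [IsProbabilityMeasure μ] [IsProbabilityMeasure ν]
    [IsProbabilityMeasure ν'] (hF : MeasurePreserving F μ μ) (hν : MeasurePreserving F ν ν)
    (hν' : MeasurePreserving F ν' ν') (hp : Measurable p) {θ : ℝ} (h0 : 0 ≤ θ) (h1 : θ ≤ 1)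
    (hμ : ∀ A, MeasurableSet A → μ.real A = θ * ν.real A + (1 - θ) * ν'.real A) :
    entropyRate μ F p ≤ θ * entropyRate ν F p + (1 - θ) * entropyRate ν' F p := by
  set c := Real.negMulLog θ + Real.negMulLog (1 - θ)
  have hl := (((tendsto_entropyRate hν hp).const_mul θ).add
    ((tendsto_entropyRate hν' hp).const_mul (1 - θ))).add
      (tendsto_const_div_atTop_nhds_zero_nat c)
  rw [add_zero] at hl
  refine le_of_tendsto_of_tendsto (tendsto_entropyRate hF hp) hl
    (eventually_atTop.2 ⟨1, fun q hq => ?_⟩)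
  have hq0 : (0 : ℝ) < q := by exact_mod_cast hq
  have := div_le_div_of_nonneg_right (partitionEntropy_convex_le
    (measurable_itin hF.measurable hp q) h0 h1 hμ) hq0.le
  refine this.trans (le_of_eq ?_)
  ring

end Rate

section KS

variable {X : Type*} [MeasurableSpace X] {μ : Measure X} {F : X → X}

lemma ksEntropy_eq_iSup : ksEntropy μ F =
    ⨆ k : ℕ, ⨆ p : { p : X → Fin k // Measurable p }, entropyRate μ F p.1 := rfl

lemma ksEntropy_nonneg [IsProbabilityMeasure μ] : 0 ≤ ksEntropy μ F :=
  Real.iSup_nonneg fun _ => Real.iSup_nonneg fun _ => entropyRate_nonneg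

lemma ksEntropy_le {C : ℝ} (hC : 0 ≤ C)
    (h : ∀ (k : ℕ) (p : X → Fin k), Measurable p → entropyRate μ F p ≤ C) :
    ksEntropy μ F ≤ C :=
  Real.iSup_le (fun k => Real.iSup_le (fun p => h k p.1 p.2) hC) hC

lemma le_ksEntropy {C : ℝ} (hC : 0 ≤ C)
    (h : ∀ (k : ℕ) (p : X → Fin k), Measurable p → entropyRate μ F p ≤ C)
    {k : ℕ} {p : X → Fin k} (hp : Measurable p) : entropyRate μ F p ≤ ksEntropy μ F := by
  rw [ksEntropy_eq_iSup]
  have h1 : BddAbove (range fun k : ℕ =>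
      ⨆ p : { p : X → Fin k // Measurable p }, entropyRate μ F p.1) := by
    refine ⟨C, ?_⟩
    rintro _ ⟨k, rfl⟩
    exact Real.iSup_le (fun p => h k p.1 p.2) hC
  have h2 : BddAbove (range fun p : { p : X → Fin k // Measurable p } => entropyRate μ F p.1) := by
    refine ⟨C, ?_⟩
    rintro _ ⟨p, rfl⟩
    exact h k p.1 p.2
  exact (le_ciSup h2 ⟨p, hp⟩).trans (le_ciSup h1 k)

lemma ksEntropy_congr {G : X → X} {S : Set X} (hS : μ Sᶜ = 0) (hF : MapsTo F S S)
    (hFG : EqOn F G S) : ksEntropy μ F = ksEntropy μ G := by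
  have key : ∀ x ∈ S, ∀ i : ℕ, F^[i] x = G^[i] x := by
    intro x hx i
    induction i with
    | zero => rfl
    | succ i ih =>
      rw [Function.iterate_succ_apply', Function.iterate_succ_apply', ← ih]
      exact hFG (hF.iterate i hx)
  have h2 : ∀ (ι : Type) [Fintype ι] (p : X → ι) (n : ℕ),
      partitionEntropy μ (itin F p n) = partitionEntropy μ (itin G p n) := by
    intro ι _ p n
    refine Finset.sum_congr rfl fun i _ => ?_
    congr 2
    refine measure_congr ?_
    have : ∀ᵐ x ∂μ, x ∈ S := hS
    filter_upwards [this] with x hx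
    have : itin F p n x = itin G p n x := by
      ext i; simp [itin, key x hx]
    simp only [eq_iff_iff]
    change itin F p n x = i ↔ itin G p n x = i
    rw [this]
  rw [ksEntropy_eq_iSup, ksEntropy_eq_iSup]
  simp only [entropyRate, h2]

end KS

end HypPot

namespace HypPot

/-! ### Entropy bounds from Markov chains -/

section Markov

variable {X γ : Type*} [MeasurableSpace X] [Fintype γ]
  [MeasurableSpace γ] [MeasurableSingletonClass γ] {μ : Measure X} {F : X → X}

lemma sum_markov_le {M : γ → γ → ℝ} (hM0 : ∀ i j, 0 ≤ M i j) (hM : ∀ i, ∑ j, M i j ≤ 1) (n : ℕ) :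
    ∑ w : Fin (n + 1) → γ, ∏ i : Fin n, M (w i.castSucc) (w i.succ) ≤ Fintype.card γ := by
  induction n with
  | zero => simp
  | succ n ih =>
    have h : ∑ w : Fin (n + 1 + 1) → γ, ∏ i : Fin (n + 1), M (w i.castSucc) (w i.succ) =
        ∑ cw : γ × (Fin (n + 1) → γ),
          (∏ i : Fin n, M (cw.2 i.castSucc) (cw.2 i.succ)) * M (cw.2 (Fin.last n)) cw.1 := by
      refine (Fintype.sum_equiv (Fin.snocEquiv fun _ => γ) _ _ fun cw => ?_).symm
      rw [Fin.prod_univ_castSucc]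
      congr 1
      · refine Finset.prod_congr rfl fun i _ => ?_
        simp only [Fin.snocEquiv, Equiv.coe_fn_mk, Fin.succ_castSucc, Fin.snoc_castSucc]
      · simp only [Fin.snocEquiv, Equiv.coe_fn_mk, Fin.snoc_castSucc, Fin.succ_last]
        rw [Fin.snoc_last]
    refine le_trans ?_ ih
    rw [h, Fintype.sum_prod_type_right]
    refine Finset.sum_le_sum fun w _ => ?_
    simp only
    rw [← Finset.mul_sum]
    exact mul_le_of_le_one_right (Finset.prod_nonneg fun i _ => hM0 _ _) (hM _)

lemma partitionEntropy_itin_le_markov [IsProbabilityMeasure μ] (hF : MeasurePreserving F μ μ)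
    {s : X → γ} (hs : Measurable s) {M : γ → γ → ℝ} (hM0 : ∀ i j, 0 ≤ M i j)
    (hM : ∀ i, ∑ j, M i j ≤ 1) (hpos : ∀ x, 0 < M (s x) (s (F x))) (n : ℕ) :
    partitionEntropy μ (itin F s (n + 1)) ≤
      Real.log (Fintype.card γ) + n * ∫ x, -Real.log (M (s x) (s (F x))) ∂μ := by
  have hX : Nonempty X := nonempty_of_isProbabilityMeasure μ
  have : Nonempty γ := hX.map s
  have hc : (0 : ℝ) < Fintype.card γ := by exact_mod_cast Fintype.card_pos
  have hq : ∀ x, 0 < (Fintype.card γ : ℝ)⁻¹ *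
      ∏ i : Fin n, M (itin F s (n + 1) x i.castSucc) (itin F s (n + 1) x i.succ) := by
    intro x
    refine mul_pos (inv_pos.2 hc) (Finset.prod_pos fun i _ => ?_)
    simp only [itin, Fin.val_castSucc, Fin.val_succ, Function.iterate_succ_apply']
    exact hpos _
  have hIntegr : Integrable (fun x => -Real.log (M (s x) (s (F x)))) μ :=
    integrable_comp (hs.prodMk (hs.comp hF.measurable))
      (fun ij : γ × γ => -Real.log (M ij.1 ij.2))
  refine (partitionEntropy_le_integral (measurable_itin hF.measurable hs (n + 1))
    (q := fun w => (Fintype.card γ : ℝ)⁻¹ * ∏ i : Fin n, M (w i.castSucc) (w i.succ))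
    ?_ ?_ ?_).trans ?_
  · rw [← Finset.mul_sum, inv_mul_le_iff₀ hc, mul_one]
    exact sum_markov_le hM0 hM n
  · intro w
    exact mul_nonneg (inv_nonneg.2 hc.le) (Finset.prod_nonneg fun i _ => hM0 _ _)
  · intro w hw
    have : (itin F s (n + 1) ⁻¹' {w}).Nonempty := by
      by_contra h
      rw [not_nonempty_iff_eq_empty] at h
      simp [h] at hw
    obtain ⟨x, hx⟩ := this
    have h := hq x
    rw [show itin F s (n + 1) x = w from hx] at h
    exact h
  · have e : ∀ x, -Real.log ((Fintype.card γ : ℝ)⁻¹ *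
        ∏ i : Fin n, M (itin F s (n + 1) x i.castSucc) (itin F s (n + 1) x i.succ)) =
        Real.log (Fintype.card γ) +
          ∑ i : Fin n, -Real.log (M (s (F^[i] x)) (s (F (F^[i] x)))) := by
      intro x
      have h := hq x
      have h2 := (mul_pos_iff_of_pos_left (inv_pos.2 hc)).1 h
      rw [Real.log_mul (inv_pos.2 hc).ne' h2.ne', Real.log_inv, Real.log_prod]
      · simp only [itin, Function.iterate_succ_apply', Fin.val_castSucc, Fin.val_succ,
          Finset.sum_neg_distrib]
        ring
      · intro i _
        simp only [itin, Fin.val_castSucc, Fin.val_succ, Function.iterate_succ_apply']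
        exact (hpos _).ne'
    simp_rw [e]
    have hi : ∀ i : Fin n, Integrable
        (fun x => -Real.log (M (s (F^[i] x)) (s (F (F^[i] x))))) μ := fun i =>
      (hF.iterate i).integrable_comp_of_integrable hIntegr
    rw [integral_add (integrable_const _) (integrable_finsetSum _ fun i _ => hi i),
      integral_finsetSum _ fun i _ => hi i]
    have hi2 : ∀ i : Fin n, ∫ x, -Real.log (M (s (F^[i] x)) (s (F (F^[i] x)))) ∂μ =
        ∫ x, -Real.log (M (s x) (s (F x))) ∂μ := by
      intro i
      have h := integral_map (hF.iterate i).measurable.aemeasurable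
        (f := fun x => -Real.log (M (s x) (s (F x))))
        (by rw [(hF.iterate i).map_eq]; exact hIntegr.aestronglyMeasurable)
      rw [(hF.iterate i).map_eq] at h
      exact h.symm
    simp [hi2]

variable {ι β : Type*} [Fintype ι] [MeasurableSpace ι] [MeasurableSingletonClass ι]
  [Fintype β] [MeasurableSpace β] [MeasurableSingletonClass β]

lemma entropyRate_le_of_transitions [IsProbabilityMeasure μ] (hF : MeasurePreserving F μ μ)
    {p : X → ι} (hp : Measurable p) {R : X → β} (hR : Measurable R) {k : ℕ} (hk : 1 ≤ k)
    (d : β → Fin k → ι) {N : β → ℝ} {S : β → Finset β}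
    (hN1 : ∀ r, 0 < N r) (hS : ∀ x, R (F^[k] x) ∈ S (R x)) (hSN : ∀ r, (S r).card ≤ N r) :
    k * entropyRate μ F p ≤ ∫ x, Real.log (N (R x)) ∂μ + Real.log 2 +
      μ.real {x | itin F p k x ≠ d (R x)} * Real.log (Fintype.card (Fin k → ι)) := by
  classical
  set G := F^[k] with hG
  have hGp : MeasurePreserving G μ μ := hF.iterate k
  set P : X → (Fin k → ι) := itin F p k with hP
  have hPm : Measurable P := measurable_itin hF.measurable hp k
  have hX : Nonempty X := nonempty_of_isProbabilityMeasure μ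
  have : Nonempty (Fin k → ι) := hX.map P
  have hc : (1 : ℝ) ≤ Fintype.card (Fin k → ι) := by exact_mod_cast Fintype.card_pos
  have hc0 : (0 : ℝ) < Fintype.card (Fin k → ι) := by linarith
  set t : β → (Fin k → ι) → ℝ := fun r j => (if j = d r then 1 / 2 else 0) + 1 / (2 * Fintype.card (Fin k → ι))
    with ht
  have ht0 : ∀ r j, 0 < t r j := by
    intro r j
    simp only [ht]
    have : (0 : ℝ) < 1 / (2 * Fintype.card (Fin k → ι)) := by positivity
    split_ifs <;> linarith
  have ht1 : ∀ r, ∑ j, t r j = 1 := by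
    intro r
    simp only [ht, Finset.sum_add_distrib, Finset.sum_const, Finset.card_univ, nsmul_eq_mul]
    rw [Finset.sum_ite_eq' Finset.univ (d r), if_pos (Finset.mem_univ _)]
    field_simp
    norm_num
  have hlt : ∀ r j, -Real.log (t r j) ≤
      Real.log 2 + (if j ≠ d r then Real.log (Fintype.card (Fin k → ι)) else 0) := by
    intro r j
    have hp : (0 : ℝ) < 1 / (2 * Fintype.card (Fin k → ι)) := by positivity
    by_cases h : j = d r
    · have h1 : Real.log (1 / 2) ≤ Real.log (t r j) := by
        refine Real.log_le_log (by norm_num) ?_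
        simp only [ht, h, if_true]
        linarith
      simp only [one_div, Real.log_inv] at h1
      simp [h] at h1 ⊢
      linarith
    · have h1 : t r j = 1 / (2 * Fintype.card (Fin k → ι)) := by simp [ht, h]
      rw [h1, one_div, Real.log_inv, Real.log_mul (by norm_num) hc0.ne']
      simp [h]
  set s : X → β × (Fin k → ι) := fun x => (R x, P x) with hs
  have hsm : Measurable s := hR.prodMk hPm
  set M : β × (Fin k → ι) → β × (Fin k → ι) → ℝ := fun u v =>
    (if v.1 ∈ S u.1 then (N u.1)⁻¹ else 0) * t v.1 v.2 with hMdef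
  have hM0 : ∀ i j, 0 ≤ M i j := by
    intro i j
    refine mul_nonneg ?_ (ht0 _ _).le
    split_ifs
    · exact (inv_pos.2 (hN1 _)).le
    · exact le_rfl
  have hM1 : ∀ i, ∑ j, M i j ≤ 1 := by
    intro i
    rw [Fintype.sum_prod_type]
    have h1 : ∀ r, ∑ j, M i (r, j) = if r ∈ S i.1 then (N i.1)⁻¹ else 0 := by
      intro r
      have h := congrArg (fun y => (if r ∈ S i.1 then (N i.1)⁻¹ else 0) * y) (ht1 r)
      simp only [Finset.mul_sum, mul_one] at h
      convert h using 1
    simp_rw [h1]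
    rw [Finset.sum_ite_mem, Finset.univ_inter, Finset.sum_const, nsmul_eq_mul, ← div_eq_mul_inv,
      div_le_one (hN1 _)]
    exact hSN _
  have hMx : ∀ x, M (s x) (s (G x)) = (N (R x))⁻¹ * t (R (G x)) (P (G x)) := by
    intro x
    simp only [hMdef, hs]
    rw [if_pos (hS x)]
  have hpos : ∀ x, 0 < M (s x) (s (G x)) := by
    intro x
    rw [hMx]
    exact mul_pos (inv_pos.2 (hN1 _)) (ht0 _ _)
  set I := ∫ x, -Real.log (M (s x) (s (G x))) ∂μ with hI
  have hItin : ∀ q : ℕ, 1 ≤ q → partitionEntropy μ (itin F p (k * q)) ≤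
      I * q + (Real.log (Fintype.card (β × (Fin k → ι))) - I) := by
    intro q hq
    obtain ⟨n, rfl⟩ : ∃ n, q = n + 1 := ⟨q - 1, by omega⟩
    have h1 := partitionEntropy_itin_le_markov hGp hsm hM0 hM1 hpos n
    have h2 := partitionEntropy_comp_le (μ := μ) (measurable_itin hGp.measurable hsm (n + 1))
      (fun w (i : Fin (k * (n + 1))) => (w ⟨i / k, Nat.div_lt_of_lt_mul i.2⟩).2
          ⟨i % k, Nat.mod_lt _ (by omega)⟩)
    have h3 : itin F p (k * (n + 1)) = fun x => (fun (w : Fin (n + 1) → β × (Fin k → ι))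
        (i : Fin (k * (n + 1))) => (w ⟨i / k, Nat.div_lt_of_lt_mul i.2⟩).2
          ⟨i % k, Nat.mod_lt _ (by omega)⟩) (itin G s (n + 1) x) := by
      funext x i
      simp only [itin, hs, hP, hG]
      rw [← Function.iterate_mul, ← Function.iterate_add_apply, Nat.mod_add_div]
    rw [h3]
    refine h2.trans (h1.trans (le_of_eq ?_))
    push_cast
    ring
  refine (entropyRate_le_of_itin_le hF hp hk hItin).trans ?_
  have hi1 : Integrable (fun x => Real.log (N (R x))) μ :=
    integrable_comp hR (fun r => Real.log (N r))
  have hi2 : Integrable (fun x => -Real.log (t (R x) (P x))) μ :=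
    integrable_comp hsm (fun u => -Real.log (t u.1 u.2))
  have hi3 : Integrable (fun x => -Real.log (t (R (G x)) (P (G x)))) μ :=
    hGp.integrable_comp_of_integrable hi2
  have e1 : I = ∫ x, Real.log (N (R x)) ∂μ + ∫ x, -Real.log (t (R x) (P x)) ∂μ := by
    have h := integral_map hGp.measurable.aemeasurable
        (f := fun x => -Real.log (t (R x) (P x)))
        (by rw [hGp.map_eq]; exact hi2.aestronglyMeasurable)
    rw [hGp.map_eq] at h
    rw [h, ← integral_add hi1 hi3, hI]
    refine integral_congr_ae (Eventually.of_forall fun x => ?_)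
    simp only
    rw [hMx, Real.log_mul (inv_pos.2 (hN1 _)).ne' (ht0 _ _).ne', Real.log_inv]
    ring
  have hA : MeasurableSet {x | P x ≠ d (R x)} := by
    have : {x | P x ≠ d (R x)} = s ⁻¹' {u | u.2 ≠ d u.1} := rfl
    rw [this]
    exact hsm (toFinite _).measurableSet
  have e2 : ∫ x, -Real.log (t (R x) (P x)) ∂μ ≤
      ∫ x, (Real.log 2 + {x | P x ≠ d (R x)}.indicator
        (fun _ => Real.log (Fintype.card (Fin k → ι))) x) ∂μ := by
    refine integral_mono hi2 ((integrable_const _).add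
      ((integrable_const _).indicator hA)) fun x => ?_
    refine (hlt _ _).trans (le_of_eq ?_)
    simp only [indicator, mem_ofPred_eq]
  rw [integral_add (integrable_const _) ((integrable_const _).indicator hA),
    integral_indicator_const _ hA] at e2
  simp only [integral_const, probReal_univ, one_mul, smul_eq_mul] at e2
  linarith

end Markov

end HypPot

namespace HypPot

/-! ### Ruelle's inequality -/

section Ruelle

variable {a b : ℝ} {μ : Measure ℝ} {F : ℝ → ℝ}

/-- The index of the cell of the uniform mesh of `[a, b]` into `m` cells which contains `x`. -/
def meshCell (a b : ℝ) (m : ℕ) (x : ℝ) : Fin (m + 1) :=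
  ⟨min m ⌊m * ((x - a) / (b - a))⌋₊, Nat.lt_succ_of_le (min_le_left _ _)⟩

lemma measurable_meshCell (m : ℕ) : Measurable (meshCell a b m) := by
  have h : Measurable fun x : ℝ => min m ⌊m * ((x - a) / (b - a))⌋₊ :=
    measurable_const.min (Nat.measurable_floor.comp (by fun_prop))
  refine measurable_to_countable' fun r => ?_
  have : meshCell a b m ⁻¹' {r} = (fun x : ℝ => min m ⌊m * ((x - a) / (b - a))⌋₊) ⁻¹' {(r : ℕ)} := by
    ext x
    simp [meshCell, Fin.ext_iff]
  rw [this]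
  exact h (measurableSet_singleton _)

lemma meshCell_val (hab : a < b) {m : ℕ} {x : ℝ} (hx : x ∈ Icc a b) :
    (meshCell a b m x : ℕ) = ⌊m * ((x - a) / (b - a))⌋₊ := by
  refine min_eq_right ?_
  refine Nat.floor_le_of_le ?_
  have : (x - a) / (b - a) ≤ 1 := by
    rw [div_le_one (by linarith)]
    linarith [hx.2]
  nlinarith [(Nat.cast_nonneg m : (0 : ℝ) ≤ m)]

lemma dist_le_of_meshCell_eq (hab : a < b) {m : ℕ} (hm : 1 ≤ m) {x y : ℝ} (hx : x ∈ Icc a b)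
    (hy : y ∈ Icc a b) (h : meshCell a b m x = meshCell a b m y) : |x - y| ≤ (b - a) / m := by
  have h' := congrArg (fun r : Fin (m + 1) => ((r : ℕ) : ℝ)) h
  simp only [meshCell_val hab hx, meshCell_val hab hy] at h'
  have hm0 : (0 : ℝ) < m := by exact_mod_cast hm
  have hba : 0 < b - a := by linarith
  have hx0 : 0 ≤ m * ((x - a) / (b - a)) := mul_nonneg hm0.le (div_nonneg (by linarith [hx.1]) hba.le)
  have hy0 : 0 ≤ m * ((y - a) / (b - a)) := mul_nonneg hm0.le (div_nonneg (by linarith [hy.1]) hba.le)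
  have e1 := Nat.floor_le hx0
  have e2 := Nat.floor_le hy0
  have e3 := Nat.lt_floor_add_one (m * ((x - a) / (b - a)))
  have e4 := Nat.lt_floor_add_one (m * ((y - a) / (b - a)))
  have e5 : |m * ((x - a) / (b - a)) - m * ((y - a) / (b - a))| ≤ 1 := by
    rw [abs_le]
    constructor <;> linarith
  have e6 : x - y = (b - a) / m * (m * ((x - a) / (b - a)) - m * ((y - a) / (b - a))) := by
    field_simp
    ring
  rw [e6, abs_mul, abs_of_pos (div_pos hba hm0)]
  exact mul_le_of_le_one_right (div_pos hba hm0).le e5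

lemma meshCell_projIcc (hab : a < b) (m : ℕ) (x : ℝ) :
    meshCell a b m (projIcc a b hab.le x) = meshCell a b m x := by
  have hba : 0 < b - a := by linarith
  have hm0 : (0 : ℝ) ≤ m := Nat.cast_nonneg m
  rcases le_total x a with h | h
  · rw [projIcc_of_le_left _ h]
    have : m * ((x - a) / (b - a)) ≤ 0 :=
      mul_nonpos_of_nonneg_of_nonpos hm0 (div_nonpos_of_nonpos_of_nonneg (by linarith) hba.le)
    simp [meshCell, Nat.floor_of_nonpos this]
  rcases le_total b x with h' | h'
  · rw [projIcc_of_right_le _ h']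
    have h1 : 1 ≤ (x - a) / (b - a) := by
      rw [one_le_div hba]
      linarith
    have h2 : m ≤ ⌊m * ((x - a) / (b - a))⌋₊ := by
      refine Nat.le_floor ?_
      nlinarith
    simp [meshCell, div_self hba.ne', min_eq_left h2]
  · rw [projIcc_of_mem _ ⟨h, h'⟩]

lemma exists_decoder [IsProbabilityMeasure μ] (hab : a < b) (hI : μ (Icc a b)ᶜ = 0) {W : Type*}
    [Fintype W] [MeasurableSpace W] [MeasurableSingletonClass W] {q : ℝ → W} (hq : Measurable q)
    {ε : ℝ} (hε : 0 < ε) :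
    ∀ᶠ m : ℕ in atTop, ∃ d : Fin (m + 1) → W, μ.real {x | q x ≠ d (meshCell a b m x)} ≤ ε := by
  classical
  obtain ⟨x₀⟩ := nonempty_of_isProbabilityMeasure μ
  have hW : 0 < (Fintype.card W : ℝ) := by
    have : Nonempty W := ⟨q x₀⟩
    exact_mod_cast Fintype.card_pos
  have hK : ∀ w, ∃ K ⊆ q ⁻¹' {w}, IsCompact K ∧
      μ (q ⁻¹' {w} \ K) < ENNReal.ofReal (ε / Fintype.card W) := fun w => by
    obtain ⟨K, h1, h2, h3⟩ := (hq (measurableSet_singleton w)).exists_isCompact_sdiff_lt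
      (measure_ne_top μ _) (ENNReal.ofReal_pos.2 (div_pos hε hW)).ne'
    exact ⟨K, h1, h2, h3⟩
  choose K hKq hKc hKm using hK
  have hδ : ∀ w w', w ≠ w' → ∀ᶠ δ : ℝ in nhdsWithin 0 (Ioi 0), ∀ x ∈ K w, ∀ y ∈ K w',
      δ < |x - y| := by
    intro w w' hww
    have hd : Disjoint (K w) (K w') := by
      rw [Set.disjoint_left]
      intro x hx hx'
      exact hww ((hKq w hx).symm.trans (hKq w' hx'))
    obtain ⟨δ₀, h0, h1⟩ := hd.exists_thickenings (hKc w) (hKc w').isClosed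
    filter_upwards [Ioo_mem_nhdsGT h0] with δ hδ x hx y hy
    by_contra! h
    refine Set.disjoint_left.1 h1 (Metric.mem_thickening_iff.2 ⟨x, hx, by rw [Real.dist_eq, abs_sub_comm]; exact h.trans_lt hδ.2⟩)
      (self_subset_thickening h0 _ hy)
  have hδ' : ∀ᶠ δ : ℝ in nhdsWithin 0 (Ioi 0), ∀ w w', w ≠ w' → ∀ x ∈ K w, ∀ y ∈ K w',
      δ < |x - y| := by
    refine eventually_all.2 fun w => eventually_all.2 fun w' => ?_
    by_cases h : w = w'
    · exact Eventually.of_forall fun δ h' => (h' h).elim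
    · filter_upwards [hδ w w' h] with δ h' _
      exact h'
  have hlim : Tendsto (fun m : ℕ => (b - a) / (m : ℝ)) atTop (nhdsWithin 0 (Ioi 0)) := by
    refine tendsto_nhdsWithin_iff.2 ⟨tendsto_const_div_atTop_nhds_zero_nat _, ?_⟩
    filter_upwards [eventually_ge_atTop 1] with m hm
    exact div_pos (by linarith : 0 < b - a) (by exact_mod_cast hm : (0 : ℝ) < m)
  filter_upwards [hlim.eventually hδ', eventually_ge_atTop 1] with m hm hm1
  refine ⟨fun r => if h : ∃ x, x ∈ Icc a b ∧ meshCell a b m x = r ∧ x ∈ K (q x) then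
    q h.choose else q x₀, ?_⟩
  have hsub : {x | q x ≠ (fun r => if h : ∃ x, x ∈ Icc a b ∧ meshCell a b m x = r ∧ x ∈ K (q x) then
      q h.choose else q x₀) (meshCell a b m x)} ⊆
      (Icc a b)ᶜ ∪ ⋃ w ∈ (Finset.univ : Finset W), (q ⁻¹' {w} \ K w) := by
    intro x hx
    by_contra hcon
    simp only [mem_union, mem_compl_iff, not_or, not_not, mem_iUnion, not_exists] at hcon
    obtain ⟨hxI, h2⟩ := hcon
    have hxK : x ∈ K (q x) := by
      by_contra h
      exact h2 (q x) (Finset.mem_univ _) ⟨rfl, h⟩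
    have hex : ∃ y, y ∈ Icc a b ∧ meshCell a b m y = meshCell a b m x ∧ y ∈ K (q y) :=
      ⟨x, hxI, rfl, hxK⟩
    refine hx ?_
    simp only [dif_pos hex]
    obtain ⟨h3, h4, h5⟩ := hex.choose_spec
    by_contra hne
    exact absurd (hm _ _ hne x hxK _ h5) (not_lt.2 (dist_le_of_meshCell_eq hab hm1 hxI h3 h4.symm))
  refine (measureReal_mono hsub).trans ((measureReal_union_le _ _).trans ?_)
  have e0 : μ.real (Icc a b)ᶜ = 0 := by simp [measureReal_def, hI]
  rw [e0, zero_add]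
  refine (measureReal_biUnion_finset_le _ _).trans ?_
  have : ∀ w ∈ (Finset.univ : Finset W), μ.real (q ⁻¹' {w} \ K w) ≤ ε / Fintype.card W := by
    intro w _
    exact ENNReal.toReal_le_of_le_ofReal (div_pos hε hW).le (hKm w).le
  refine (Finset.sum_le_sum this).trans (le_of_eq ?_)
  rw [Finset.sum_const, Finset.card_univ, nsmul_eq_mul]
  field_simp

lemma mul_entropyRate_le_integral_log [IsProbabilityMeasure μ] (hab : a < b)
    (hI : μ (Icc a b)ᶜ = 0) (hF : MeasurePreserving F μ μ) (hFI : MapsTo F (Icc a b) (Icc a b))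
    (hFp : ∀ x, F (projIcc a b hab.le x) = F x)
    {k : ℕ} (hk : 1 ≤ k) {J : ℝ → ℝ} (hJ : Continuous J) (hJ0 : ∀ x, 0 ≤ J x)
    (hJF : ∀ x ∈ Icc a b, ∀ y ∈ Icc a b, ∃ z ∈ uIcc x y, |F^[k] x - F^[k] y| ≤ J z * |x - y|)
    {ι : Type*} [Fintype ι] [MeasurableSpace ι] [MeasurableSingletonClass ι] {p : ℝ → ι}
    (hp : Measurable p) :
    k * entropyRate μ F p ≤ ∫ x, Real.log (J x + 3) ∂μ + Real.log 2 := by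
  classical
  set L := Real.log (Fintype.card (Fin k → ι)) with hL
  have hL0 : 0 ≤ L := Real.log_natCast_nonneg _
  refine le_of_forall_pos_le_add fun ε hε => ?_
  have hε' : 0 < ε / (L + 1) := by positivity
  have hJu : UniformContinuousOn J (Icc a b) :=
    isCompact_Icc.uniformContinuousOn_of_continuous hJ.continuousOn
  obtain ⟨δ, hδ, hδJ⟩ := Metric.uniformContinuousOn_iff.1 hJu (1 / 2) (by norm_num)
  have hlim : Tendsto (fun m : ℕ => (b - a) / (m : ℝ)) atTop (nhds 0) :=
    tendsto_const_div_atTop_nhds_zero_nat _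
  obtain ⟨m, ⟨d, hd⟩, hm1, hmδ⟩ := ((exists_decoder hab hI (measurable_itin hF.measurable hp k)
    hε').and ((eventually_ge_atTop 1).and (hlim.eventually (gt_mem_nhds hδ)))).exists
  have hFk : MapsTo F^[k] (Icc a b) (Icc a b) := hFI.iterate k
  have hm0 : (0 : ℝ) < m := by exact_mod_cast hm1
  have hba : 0 < b - a := by linarith
  have hFkp : ∀ x, F^[k] (projIcc a b hab.le x) = F^[k] x := by
    obtain ⟨l, rfl⟩ : ∃ l, k = l + 1 := ⟨k - 1, by omega⟩
    intro x
    rw [Function.iterate_succ_apply, hFp, ← Function.iterate_succ_apply]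
  set R := meshCell a b m with hR
  set S : Fin (m + 1) → Finset (Fin (m + 1)) := fun r =>
    Finset.univ.filter fun s => ∃ x ∈ Icc a b, R x = r ∧ R (F^[k] x) = s with hS
  set N : Fin (m + 1) → ℝ := fun r =>
    if h : ∃ x ∈ Icc a b, R x = r then J h.choose + 5 / 2 else 1 with hN
  have hosc : ∀ w ∈ Icc a b, ∀ x ∈ Icc a b, ∀ y ∈ Icc a b, R x = R w → R y = R w →
      ∀ z ∈ uIcc x y, |J z - J w| ≤ 1 / 2 := by
    intro w hw x hx y hy hxw hyw z hz
    have hzI : z ∈ Icc a b := (uIcc_subset_Icc hx hy) hz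
    have h1 := abs_le.1 (dist_le_of_meshCell_eq hab hm1 hx hw hxw)
    have h2 := abs_le.1 (dist_le_of_meshCell_eq hab hm1 hy hw hyw)
    have h3 : |z - w| ≤ (b - a) / m := by
      rw [mem_uIcc] at hz
      rw [abs_le]
      rcases hz with ⟨h3, h4⟩ | ⟨h3, h4⟩ <;> constructor <;> linarith [h1.1, h1.2, h2.1, h2.2]
    have h4 := hδJ z hzI w hw (by rw [Real.dist_eq]; exact h3.trans_lt hmδ)
    rw [Real.dist_eq] at h4
    exact h4.le
  have hN1 : ∀ r, 0 < N r := by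
    intro r
    simp only [hN]
    split_ifs with h
    · linarith [hJ0 h.choose]
    · norm_num
  have hSx : ∀ x, R (F^[k] x) ∈ S (R x) := by
    intro x
    simp only [hS, Finset.mem_filter, Finset.mem_univ, true_and]
    exact ⟨projIcc a b hab.le x, (projIcc a b hab.le x).2, meshCell_projIcc hab m x, by rw [hFkp]⟩
  have hdiff : ∀ r, ∀ s ∈ S r, ∀ s' ∈ S r, ((s : ℕ) : ℝ) ≤ (s' : ℕ) + (N r - 1) := by
    intro r s hs s' hs'
    simp only [hS, Finset.mem_filter, Finset.mem_univ, true_and] at hs hs'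
    obtain ⟨x, hx, hxr, rfl⟩ := hs
    obtain ⟨y, hy, hyr, rfl⟩ := hs'
    have hex : ∃ x ∈ Icc a b, R x = r := ⟨x, hx, hxr⟩
    have hNr : N r = J hex.choose + 5 / 2 := by simp only [hN, dif_pos hex]
    obtain ⟨h1, h2⟩ := hex.choose_spec
    obtain ⟨z, hz, h3⟩ := hJF x hx y hy
    have h4 := (abs_le.1 (hosc _ h1 x hx y hy (hxr.trans h2.symm) (hyr.trans h2.symm) z hz)).2
    have h5 := dist_le_of_meshCell_eq hab hm1 hx hy (hxr.trans hyr.symm)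
    have h6 : F^[k] x - F^[k] y ≤ (N r - 2) * ((b - a) / m) :=
      (le_abs_self _).trans (h3.trans (mul_le_mul (by linarith) h5 (abs_nonneg _)
        (by linarith [hJ0 hex.choose])))
    rw [hR, meshCell_val hab (hFk hx), meshCell_val hab (hFk hy)]
    have h7 := Nat.floor_le (a := m * ((F^[k] x - a) / (b - a)))
      (mul_nonneg hm0.le (div_nonneg (by linarith [(hFk hx).1]) hba.le))
    have h8 := Nat.lt_floor_add_one (m * ((F^[k] y - a) / (b - a)))
    have h9 : m * ((F^[k] x - a) / (b - a)) ≤ m * ((F^[k] y - a) / (b - a)) + (N r - 2) := by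
      have e : m * ((F^[k] x - a) / (b - a)) =
          m * ((F^[k] y - a) / (b - a)) + m / (b - a) * (F^[k] x - F^[k] y) := by
        field_simp
        ring
      rw [e]
      have := mul_le_mul_of_nonneg_left h6 (div_pos hm0 hba).le
      have e2 : m / (b - a) * ((N r - 2) * ((b - a) / m)) = N r - 2 := by field_simp
      linarith
    linarith
  have hSN : ∀ r, ((S r).card : ℝ) ≤ N r := by
    intro r
    rcases (S r).eq_empty_or_nonempty with h | h
    · rw [h]
      simpa using (hN1 r).le
    have hsub : S r ⊆ Finset.Icc ((S r).min' h) ((S r).max' h) := fun s hs =>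
      Finset.mem_Icc.2 ⟨Finset.min'_le _ _ hs, Finset.le_max' _ _ hs⟩
    have h1 := Finset.card_le_card hsub
    rw [Fin.card_Icc] at h1
    have h2 := hdiff r _ (Finset.max'_mem _ h) _ (Finset.min'_mem _ h)
    have h3 : ((S r).min' h : ℕ) ≤ ((S r).max' h : ℕ) :=
      Finset.min'_le _ _ (Finset.max'_mem _ h)
    have h4 : (((S r).card : ℕ) : ℝ) ≤ ((S r).max' h : ℕ) + 1 - ((S r).min' h : ℕ) := by
      have : (S r).card + ((S r).min' h : ℕ) ≤ ((S r).max' h : ℕ) + 1 := by omega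
      have : (((S r).card + ((S r).min' h : ℕ) : ℕ) : ℝ) ≤ (((S r).max' h : ℕ) + 1 : ℕ) := by
        exact_mod_cast this
      push_cast at this
      linarith
    linarith
  have main := entropyRate_le_of_transitions hF hp (measurable_meshCell m) hk d hN1 hSx hSN
  have hmono : ∫ x, Real.log (N (R x)) ∂μ ≤ ∫ x, Real.log (J x + 3) ∂μ := by
    have hb : ∀ᵐ x ∂μ, x ∈ Icc a b := by
      rw [ae_iff]
      exact hI
    have hcont : Continuous fun x => Real.log (J x + 3) :=
      Continuous.log (by fun_prop) fun x => by linarith [hJ0 x]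
    obtain ⟨C, hC⟩ := isCompact_Icc.exists_bound_of_continuousOn
      (s := Icc a b) hcont.continuousOn
    refine integral_mono_ae (integrable_comp (measurable_meshCell m) fun r => Real.log (N r))
      (Integrable.of_bound hcont.aestronglyMeasurable C (hb.mono hC)) (hb.mono fun x hx => ?_)
    refine Real.log_le_log (hN1 _) ?_
    have hex : ∃ y ∈ Icc a b, R y = R x := ⟨x, hx, rfl⟩
    simp only [hN, dif_pos hex]
    obtain ⟨h1, h2⟩ := hex.choose_spec
    have := (abs_le.1 (hosc x hx _ h1 x hx h2 rfl _ left_mem_uIcc)).2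
    linarith
  have hd' : μ.real {x | itin F p k x ≠ d (meshCell a b m x)} * L ≤ ε := by
    refine (mul_le_mul_of_nonneg_right hd hL0).trans ?_
    rw [div_mul_eq_mul_div, div_le_iff₀ (by positivity)]
    nlinarith
  linarith

end Ruelle

end HypPot

namespace HypPot

/-! ### Invariant measures -/

/-- `μ` is an `F`-invariant probability measure carried by `[a, b]`. -/
def IsInv (a b : ℝ) (F : ℝ → ℝ) (μ : Measure ℝ) : Prop :=
  IsProbabilityMeasure μ ∧ μ (Icc a b)ᶜ = 0 ∧ MeasurePreserving F μ μ

section KrylovBogoliubov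

variable {a b : ℝ} {F : ℝ → ℝ}

/-- The average of the first `N` push-forwards of `m` under `F`. -/
def orbitAverage (F : ℝ → ℝ) (m : Measure ℝ) (N : ℕ) : Measure ℝ :=
  ∑ i ∈ Finset.range N, ((N : ENNReal)⁻¹) • m.map F^[i]

lemma orbitAverage_apply (hF : Measurable F) (m : Measure ℝ) (N : ℕ) {A : Set ℝ}
    (hA : MeasurableSet A) :
    orbitAverage F m N A = ∑ i ∈ Finset.range N, ((N : ENNReal)⁻¹) * m (F^[i] ⁻¹' A) := by
  simp only [orbitAverage, Measure.coe_finsetSum, Finset.sum_apply, Measure.smul_apply, smul_eq_mul]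
  exact Finset.sum_congr rfl fun i _ => by rw [Measure.map_apply (hF.iterate i) hA]

lemma isProbabilityMeasure_orbitAverage (hF : Measurable F) (m : Measure ℝ)
    [IsProbabilityMeasure m] {N : ℕ} (hN : 1 ≤ N) :
    IsProbabilityMeasure (orbitAverage F m N) := by
  refine ⟨?_⟩
  rw [orbitAverage_apply hF m N MeasurableSet.univ]
  simp only [preimage_univ, measure_univ, mul_one, Finset.sum_const, Finset.card_range,
    nsmul_eq_mul]
  exact ENNReal.mul_inv_cancel (by positivity) (ENNReal.natCast_ne_top N)

lemma orbitAverage_real (hF : Measurable F) (m : Measure ℝ) [IsProbabilityMeasure m] (N : ℕ)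
    {A : Set ℝ} (hA : MeasurableSet A) :
    (orbitAverage F m N).real A = (N : ℝ)⁻¹ * ∑ i ∈ Finset.range N, m.real (F^[i] ⁻¹' A) := by
  rw [measureReal_def, orbitAverage_apply hF m N hA, ← Finset.mul_sum, ENNReal.toReal_mul,
    ENNReal.toReal_inv, ENNReal.toReal_natCast, ENNReal.toReal_sum fun i _ => measure_ne_top _ _]
  rfl

lemma integral_orbitAverage (hF : Measurable F) (m : Measure ℝ) [IsProbabilityMeasure m] {N : ℕ}
    (hN : 1 ≤ N) (h : BoundedContinuousFunction ℝ ℝ) :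
    ∫ x, h x ∂(orbitAverage F m N) = (N : ℝ)⁻¹ * ∑ i ∈ Finset.range N, ∫ x, h (F^[i] x) ∂m := by
  have hp : ∀ i, IsProbabilityMeasure (m.map F^[i]) := fun i =>
    Measure.isProbabilityMeasure_map (hF.iterate i).aemeasurable
  rw [orbitAverage, integral_finsetSum_measure, Finset.mul_sum]
  · refine Finset.sum_congr rfl fun i _ => ?_
    rw [integral_smul_measure, integral_map (hF.iterate i).aemeasurable
      h.continuous.aestronglyMeasurable]
    simp
  · intro i _
    exact (h.integrable _).smul_measure (by simp; omega)

lemma exists_isInv_limit (hF : Continuous F) (hFI : MapsTo F (Icc a b) (Icc a b))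
    {m : ℕ → Measure ℝ} (hm : ∀ n, IsProbabilityMeasure (m n)) (hmI : ∀ n, m n (Icc a b)ᶜ = 0)
    {N : ℕ → ℕ} (hN : ∀ n, 1 ≤ N n) (hNt : Tendsto N atTop atTop) :
    ∃ ν, IsInv a b F ν ∧
      (∀ (h : BoundedContinuousFunction ℝ ℝ) (c : ℝ),
        (∀ᶠ n in atTop, c * N n ≤ ∑ i ∈ Finset.range (N n), ∫ x, h (F^[i] x) ∂(m n)) →
        c ≤ ∫ x, h x ∂ν) ∧
      (∀ (C : Set ℝ), IsClosed C → ∀ c : ℝ,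
        (∀ᶠ n in atTop, c * N n ≤ ∑ i ∈ Finset.range (N n), (m n).real (F^[i] ⁻¹' C)) →
        c ≤ ν.real C) := by
  have hFm := hF.measurable
  set K : Set (ProbabilityMeasure ℝ) := {μ | ∀ _ : ℕ, μ (Icc a b)ᶜ ≤ (0 : NNReal)} with hK
  have hKc : IsCompact K := by
    have := isCompact_setOfPred_probabilityMeasure_mass_eq_compl_isCompact_le
      (E := ℝ) (u := fun _ => 0) (K := fun _ => Icc a b) tendsto_const_nhds (fun _ => isCompact_Icc)
      (Or.inl inferInstance)
    exact this
  set P : ℕ → ProbabilityMeasure ℝ := fun n =>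
    ⟨orbitAverage F (m n) (N n), isProbabilityMeasure_orbitAverage hFm (m n) (hN n)⟩ with hP
  have hPK : ∀ n, P n ∈ K := by
    intro n _
    have : orbitAverage F (m n) (N n) (Icc a b)ᶜ = 0 := by
      rw [orbitAverage_apply hFm _ _ measurableSet_Icc.compl]
      refine Finset.sum_eq_zero fun i _ => ?_
      rw [measure_mono_null (fun x hx => ?_) (hmI n), mul_zero]
      exact fun h => hx (hFI.iterate i h)
    rw [← ENNReal.coe_le_coe, ProbabilityMeasure.ennreal_coeFn_eq_coeFn_toMeasure]
    simp [hP, this]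
  set U : Ultrafilter ℕ := hyperfilter ℕ with hU
  have hUle : (U : Filter ℕ) ≤ atTop := Nat.hyperfilter_le_atTop
  obtain ⟨ν, hνK, hν⟩ := hKc.ultrafilter_le_nhds' (U.map P) (by
    rw [Ultrafilter.mem_map]
    exact Filter.univ_mem' hPK)
  have hlim : Tendsto P U (nhds ν) := hν
  have hIntegr := ProbabilityMeasure.tendsto_iff_forall_integral_tendsto.1 hlim
  have hPint : ∀ (h : BoundedContinuousFunction ℝ ℝ) n, ∫ x, h x ∂(P n : Measure ℝ) =
      (N n : ℝ)⁻¹ * ∑ i ∈ Finset.range (N n), ∫ x, h (F^[i] x) ∂(m n) := fun h n =>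
    integral_orbitAverage hFm (m n) (hN n) h
  have hN0 : ∀ n, (0 : ℝ) < N n := fun n => by exact_mod_cast hN n
  refine ⟨ν, ⟨inferInstance, ?_, hFm, ?_⟩, ?_, ?_⟩
  · have := hνK 0
    rw [← ENNReal.coe_le_coe, ProbabilityMeasure.ennreal_coeFn_eq_coeFn_toMeasure] at this
    simpa using this
  · have hpr : IsProbabilityMeasure ((ν : Measure ℝ).map F) :=
      Measure.isProbabilityMeasure_map hFm.aemeasurable
    refine ext_of_forall_integral_eq_of_IsFiniteMeasure fun h => ?_
    rw [integral_map hFm.aemeasurable h.continuous.aestronglyMeasurable]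
    set g : BoundedContinuousFunction ℝ ℝ := h.compContinuous ⟨F, hF⟩ with hg
    have h1 := (hIntegr g).sub (hIntegr h)
    have h2 : Tendsto (fun n => ∫ x, g x ∂(P n : Measure ℝ) - ∫ x, h x ∂(P n : Measure ℝ)) U
        (nhds 0) := by
      refine Tendsto.mono_left ?_ hUle
      have hz : Tendsto (fun n => 2 * ‖h‖ / (N n : ℝ)) atTop (nhds 0) :=
        (tendsto_const_div_atTop_nhds_zero_nat _).comp hNt
      refine squeeze_zero_norm (fun n => ?_) hz
      rw [hPint, hPint, ← mul_sub, ← Finset.sum_sub_distrib]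
      have hb : ∀ i, ‖∫ x, h (F^[i] x) ∂(m n)‖ ≤ ‖h‖ := by
        intro i
        have := norm_integral_le_of_norm_le_const (μ := m n) (f := fun x => h (F^[i] x)) (C := ‖h‖)
          (Eventually.of_forall fun x => h.norm_coe_le_norm _)
        simpa using this
      have : ∑ i ∈ Finset.range (N n), (∫ x, g (F^[i] x) ∂(m n) - ∫ x, h (F^[i] x) ∂(m n)) =
          ∫ x, h (F^[N n] x) ∂(m n) - ∫ x, h (F^[0] x) ∂(m n) := by
        rw [← Finset.sum_range_sub fun i => ∫ x, h (F^[i] x) ∂(m n)]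
        refine Finset.sum_congr rfl fun i _ => ?_
        simp only [hg, Function.iterate_succ_apply']
        rfl
      rw [this, norm_mul, norm_inv, Real.norm_of_nonneg (hN0 n).le, div_eq_inv_mul]
      refine mul_le_mul_of_nonneg_left ?_ (inv_nonneg.2 (hN0 n).le)
      exact (norm_sub_le _ _).trans (by linarith [hb (N n), hb 0])
    have h3 := tendsto_nhds_unique h1 h2
    exact sub_eq_zero.1 h3
  · intro h c hc
    refine ge_of_tendsto (hIntegr h) ((hc.filter_mono hUle).mono fun n hn => ?_)
    rw [hPint, ← div_eq_inv_mul, le_div_iff₀ (hN0 n)]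
    exact hn
  · intro C hC c hc
    have h1 := ProbabilityMeasure.limsup_measure_closed_le_of_tendsto hlim hC
    have h2 : ENNReal.ofReal c ≤ (ν : Measure ℝ) C := by
      refine le_trans ?_ h1
      refine le_limsup_of_frequently_le ?_
      refine Eventually.frequently ((hc.filter_mono hUle).mono fun n hn => ?_)
      refine ENNReal.ofReal_le_of_le_toReal ?_
      change c ≤ (orbitAverage F (m n) (N n)).real C
      rw [orbitAverage_real hFm _ _ hC.measurableSet, ← div_eq_inv_mul, le_div_iff₀ (hN0 n)]
      exact hn
    exact (ENNReal.ofReal_le_iff_le_toReal (measure_ne_top _ _)).1 h2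

end KrylovBogoliubov

end HypPot

namespace HypPot

/-! ### Horseshoes carry measures of large entropy -/

section Horseshoe

variable {a b : ℝ} {F : ℝ → ℝ} {ι : Type*} [Fintype ι] [Nonempty ι]

lemma exists_mem_cylinder {g : ℝ → ℝ} {I : Set ℝ} (hI : I.Nonempty) {W : ι → Set ℝ}
    (hWI : ∀ i, W i ⊆ I) (hg : ∀ i, I ⊆ g '' W i) (n : ℕ) (w : Fin n → ι) :
    ∃ x ∈ I, ∀ i, g^[(i : ℕ)] x ∈ W (w i) := by
  induction n with
  | zero => exact ⟨hI.some, hI.some_mem, fun i => i.elim0⟩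
  | succ n ih =>
    obtain ⟨y, hy, hyw⟩ := ih (fun i => w i.succ)
    obtain ⟨x, hx, rfl⟩ := hg (w 0) hy
    refine ⟨x, hWI _ hx, fun i => ?_⟩
    refine Fin.cases ?_ (fun i => ?_) i
    · exact hx
    · rw [Fin.val_succ, Function.iterate_succ_apply]
      exact hyw i

lemma card_words_le [DecidableEq ι] {n k i : ℕ} (hik : i + k ≤ n) (v : Fin k → ι) :
    Fintype.card ι ^ n ≤ Fintype.card ι ^ k *
      (Finset.univ.filter fun w : Fin n → ι =>
        ∀ l : Fin k, w ⟨i + l, by omega⟩ = v l).card := by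
  classical
  set A : Fin n → Finset ι := fun j =>
    if h : i ≤ j ∧ (j : ℕ) < i + k then {v ⟨j - i, by omega⟩} else Finset.univ with hA
  have h1 : Fintype.piFinset A ⊆ Finset.univ.filter fun w : Fin n → ι =>
      ∀ l : Fin k, w ⟨i + l, by omega⟩ = v l := by
    intro w hw
    simp only [Finset.mem_filter, Finset.mem_univ, true_and]
    intro l
    have h := (Fintype.mem_piFinset.1 hw) ⟨i + l, by omega⟩
    have h' : i ≤ i + (l : ℕ) ∧ i + (l : ℕ) < i + k := ⟨by omega, by omega⟩
    simp only [hA] at h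
    rw [dif_pos h', Finset.mem_singleton] at h
    rw [h]
    congr 1
    ext
    simp
  refine le_trans ?_ (Nat.mul_le_mul_left _ (Finset.card_le_card h1))
  rw [Fintype.card_piFinset]
  set Z : Finset (Fin n) := Finset.univ.filter fun j => i ≤ j ∧ (j : ℕ) < i + k with hZ
  have hZc : Z.card ≤ k := by
    have : Z.card ≤ (Finset.Ico i (i + k)).card := by
      refine Finset.card_le_card_of_injOn (fun j => (j : ℕ)) (fun j hj => ?_)
        (fun j _ j' _ h => Fin.ext h)
      simp only [hZ, Finset.coe_filter, Finset.mem_univ, true_and, mem_ofPred_eq] at hj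
      simp [hj]
    simpa using this
  have h2 : Fintype.card ι ^ Z.card * ∏ j, (A j).card = Fintype.card ι ^ n := by
    have e : ∀ j, (if j ∈ Z then Fintype.card ι else 1) * (A j).card = Fintype.card ι := by
      intro j
      simp only [hZ, hA, Finset.mem_filter, Finset.mem_univ, true_and]
      split_ifs <;> simp
    have e2 : Fintype.card ι ^ Z.card = ∏ j, (if j ∈ Z then Fintype.card ι else 1) := by
      rw [Finset.prod_ite_mem, Finset.univ_inter, Finset.prod_const]
    rw [e2, ← Finset.prod_mul_distrib, Finset.prod_congr rfl fun j _ => e j]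
    simp
  rw [← h2]
  exact Nat.mul_le_mul_right _ (Nat.pow_le_pow_right Fintype.card_pos hZc)

lemma exists_bernoulli {g : ℝ → ℝ} (hg : Continuous g) (hab : a < b)
    (hgI : MapsTo g (Icc a b) (Icc a b)) {W : ι → Set ℝ}
    (hWc : ∀ i, IsClosed (W i)) (hWI : ∀ i, W i ⊆ Icc a b)
    (hWd : Pairwise fun i j => Disjoint (W i) (W j)) (hW : ∀ i, Icc a b ⊆ g '' W i) :
    ∃ ν, IsInv a b g ν ∧ ν (⋃ i, W i)ᶜ = 0 ∧ ∀ (k : ℕ) (v : Fin k → ι),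
      ν.real {x | ∀ i, g^[(i : ℕ)] x ∈ W (v i)} ≤ ((Fintype.card ι : ℝ) ^ k)⁻¹ := by
  classical
  let _ : MeasurableSpace ι := ⊤
  have hq : (0 : ℝ) < Fintype.card ι := by exact_mod_cast Fintype.card_pos
  choose X hXI hXW using fun (n : ℕ) (w : Fin n → ι) =>
    exists_mem_cylinder (nonempty_Icc.2 hab.le) hWI hW n w
  set m : ℕ → Measure ℝ := fun n =>
    (PMF.uniformOfFintype (Fin n → ι)).toMeasure.map (X n) with hm
  have hXm : ∀ n, Measurable (X n) := fun n => measurable_of_finite _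
  have hmp : ∀ n, IsProbabilityMeasure (m n) := fun n =>
    Measure.isProbabilityMeasure_map (hXm n).aemeasurable
  have hmI : ∀ n, m n (Icc a b)ᶜ = 0 := by
    intro n
    rw [hm, Measure.map_apply (hXm n) measurableSet_Icc.compl]
    have : X n ⁻¹' (Icc a b)ᶜ = ∅ := by
      ext w
      simp only [mem_preimage, mem_compl_iff, mem_empty_iff_false, iff_false, not_not]
      exact hXI n w
    rw [this, measure_empty]
  set Cyl : (k : ℕ) → (Fin k → ι) → Set ℝ := fun k v => {x | ∀ i, g^[(i : ℕ)] x ∈ W (v i)}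
    with hCyl
  have hCylc : ∀ k v, IsClosed (Cyl k v) := by
    intro k v
    have : Cyl k v = ⋂ i : Fin k, g^[(i : ℕ)] ⁻¹' W (v i) := by ext x; simp [hCyl]
    rw [this]
    exact isClosed_iInter fun i => (hWc _).preimage (hg.iterate _)
  have hmass : ∀ k v n i, i + k ≤ n → ((Fintype.card ι : ℝ) ^ k)⁻¹ ≤
      (m n).real (g^[i] ⁻¹' Cyl k v) := by
    intro k v n i hik
    have hme : MeasurableSet (g^[i] ⁻¹' Cyl k v) :=
      ((hCylc k v).preimage (hg.iterate i)).measurableSet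
    have hsub : {w : Fin n → ι | ∀ l : Fin k, w ⟨i + l, by omega⟩ = v l} ⊆
        X n ⁻¹' (g^[i] ⁻¹' Cyl k v) := by
      intro w hw l
      have h := hXW n w ⟨i + l, by omega⟩
      rw [hw l] at h
      rw [← Function.iterate_add_apply, add_comm]
      exact h
    have h0 : (PMF.uniformOfFintype (Fin n → ι)).toMeasure
        {w : Fin n → ι | ∀ l : Fin k, w ⟨i + l, by omega⟩ = v l} ≤
        m n (g^[i] ⁻¹' Cyl k v) := by
      rw [hm, Measure.map_apply (hXm n) hme]
      exact measure_mono hsub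
    have h1 := ENNReal.toReal_mono (measure_ne_top _ _) h0
    refine le_trans ?_ h1
    rw [PMF.toMeasure_uniformOfFintype_apply _ (toFinite _).measurableSet, ENNReal.toReal_div]
    simp only [ENNReal.toReal_natCast, ENNReal.toReal_pow, Fintype.card_pi, Finset.prod_const,
      Finset.card_univ, Fintype.card_fin, Nat.cast_pow]
    have h2 := card_words_le hik v
    have h3 : ((Fintype.card ι : ℝ)) ^ n ≤ (Fintype.card ι : ℝ) ^ k *
      ((Finset.univ.filter fun w : Fin n → ι =>
        ∀ l : Fin k, w ⟨i + l, by omega⟩ = v l).card : ℝ) := by exact_mod_cast h2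
    rw [Fintype.card_subtype, le_div_iff₀ (pow_pos hq _), inv_mul_le_iff₀ (pow_pos hq _)]
    simpa only [mem_ofPred_eq] using h3
  obtain ⟨ν, hν, -, hνC⟩ := exists_isInv_limit hg hgI (m := fun n => m (n + 1))
    (N := fun n => n + 1) (fun n => hmp _) (fun n => hmI _) (fun n => by omega)
    (tendsto_add_atTop_nat 1)
  have := hν.1
  have hge : ∀ k v, ((Fintype.card ι : ℝ) ^ k)⁻¹ ≤ ν.real (Cyl k v) := by
    intro k v
    set c := ((Fintype.card ι : ℝ) ^ k)⁻¹ with hc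
    have hc0 : 0 < c := by positivity
    refine le_of_forall_pos_le_add fun ε hε => ?_
    have : c - ε ≤ ν.real (Cyl k v) := by
      refine hνC _ (hCylc k v) _ ?_
      have hl : ∀ᶠ n : ℕ in atTop, k * c / ε ≤ n := tendsto_natCast_atTop_atTop.eventually_ge_atTop _
      filter_upwards [hl, eventually_ge_atTop k] with n hn hkn
      have h1 : ∑ i ∈ Finset.range (n + 1 - k), c ≤
          ∑ i ∈ Finset.range (n + 1 - k), (m (n + 1)).real (g^[i] ⁻¹' Cyl k v) :=
        Finset.sum_le_sum fun i hi => hmass k v (n + 1) i (by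
          have := Finset.mem_range.1 hi
          omega)
      have h2 : ∑ i ∈ Finset.range (n + 1 - k), (m (n + 1)).real (g^[i] ⁻¹' Cyl k v) ≤
          ∑ i ∈ Finset.range (n + 1), (m (n + 1)).real (g^[i] ⁻¹' Cyl k v) :=
        Finset.sum_le_sum_of_subset_of_nonneg (Finset.range_subset_range.2 (by omega))
          fun _ _ _ => measureReal_nonneg
      refine le_trans ?_ (h1.trans h2)
      rw [Finset.sum_const, Finset.card_range, nsmul_eq_mul, Nat.cast_sub (by omega)]
      push_cast
      rw [div_le_iff₀ hε] at hn
      nlinarith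
    linarith
  have hdisj : ∀ k, Pairwise fun v v' => Disjoint (Cyl k v) (Cyl k v') := by
    intro k v v' hvv
    obtain ⟨i, hi⟩ := Function.ne_iff.1 hvv
    rw [Set.disjoint_left]
    intro x hx hx'
    exact Set.disjoint_left.1 (hWd hi) (hx i) (hx' i)
  have hsum : ∀ k, ν.real (⋃ v, Cyl k v) = ∑ v, ν.real (Cyl k v) := fun k =>
    measureReal_iUnion_fintype (hdisj k) fun v => (hCylc k v).measurableSet
  have htot : ∀ k, ∑ _v : Fin k → ι, ((Fintype.card ι : ℝ) ^ k)⁻¹ = 1 := by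
    intro k
    have : (Fintype.card ι : ℝ) ^ k ≠ 0 := by positivity
    simp [this]
  have heq : ∀ k v, ν.real (Cyl k v) = ((Fintype.card ι : ℝ) ^ k)⁻¹ := by
    intro k v
    have h1 : ∑ v, (ν.real (Cyl k v) - ((Fintype.card ι : ℝ) ^ k)⁻¹) ≤ 0 := by
      rw [Finset.sum_sub_distrib, htot, ← hsum]
      linarith [measureReal_le_one (μ := ν) (s := ⋃ v, Cyl k v)]
    have h2 : ν.real (Cyl k v) - ((Fintype.card ι : ℝ) ^ k)⁻¹ ≤
        ∑ v, (ν.real (Cyl k v) - ((Fintype.card ι : ℝ) ^ k)⁻¹) :=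
      Finset.single_le_sum (f := fun v => ν.real (Cyl k v) - ((Fintype.card ι : ℝ) ^ k)⁻¹)
        (fun v _ => sub_nonneg.2 (hge k v)) (Finset.mem_univ v)
    linarith [hge k v]
  refine ⟨ν, hν, ?_, fun k v => (heq k v).le⟩
  have h1 : ν.real (⋃ v, Cyl 1 v) = 1 := by
    rw [hsum, Finset.sum_congr rfl fun v _ => heq 1 v, htot]
  have h2 : ⋃ v, Cyl 1 v ⊆ ⋃ i, W i := by
    refine iUnion_subset fun v x hx => mem_iUnion.2 ⟨v 0, ?_⟩
    exact hx 0
  have h3 : ν.real (⋃ i, W i) = 1 :=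
    le_antisymm measureReal_le_one (h1.symm.le.trans (measureReal_mono h2))
  have hme : MeasurableSet (⋃ i, W i) := MeasurableSet.iUnion fun i => (hWc i).measurableSet
  rw [prob_compl_eq_zero_iff hme]
  rw [measureReal_def] at h3
  rw [← ENNReal.ofReal_toReal (measure_ne_top ν (⋃ i, W i)), h3, ENNReal.ofReal_one]

lemma isInv_orbitAverage (hF : Measurable F) (hFI : MapsTo F (Icc a b) (Icc a b)) {T : ℕ}
    (hT : 1 ≤ T) {ν : Measure ℝ} (hν : IsInv a b F^[T] ν) : IsInv a b F (orbitAverage F ν T) := by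
  have := hν.1
  refine ⟨isProbabilityMeasure_orbitAverage hF ν hT, ?_, hF, ?_⟩
  · rw [orbitAverage_apply hF _ _ measurableSet_Icc.compl]
    refine Finset.sum_eq_zero fun i _ => ?_
    rw [measure_mono_null (fun x hx => ?_) hν.2.1, mul_zero]
    exact fun h => hx (hFI.iterate i h)
  · ext A hA
    rw [Measure.map_apply hF hA, orbitAverage_apply hF _ _ (hF hA), orbitAverage_apply hF _ _ hA,
      ← Finset.mul_sum, ← Finset.mul_sum]
    congr 1
    have e : ∀ i, ν (F^[i] ⁻¹' (F ⁻¹' A)) = ν (F^[i + 1] ⁻¹' A) := by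
      intro i
      rw [← preimage_comp, ← Function.iterate_succ']
    simp_rw [e]
    obtain ⟨n, rfl⟩ : ∃ n, T = n + 1 := ⟨T - 1, by omega⟩
    rw [Finset.sum_range_succ, Finset.sum_range_succ']
    congr 1
    exact hν.2.2.measure_preimage hA.nullMeasurableSet

lemma exists_horseshoe_measure (hF : Continuous F) (hab : a < b)
    (hFI : MapsTo F (Icc a b) (Icc a b)) {B : ℝ} (hB : 0 ≤ B)
    (hent : ∀ μ, IsInv a b F μ → ∀ (k : ℕ) (p : ℝ → Fin k), Measurable p → entropyRate μ F p ≤ B)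
    {T : ℕ} (hT : 1 ≤ T) {W : ι → Set ℝ} (hWc : ∀ i, IsClosed (W i)) (hWI : ∀ i, W i ⊆ Icc a b)
    (hWd : Pairwise fun i j => Disjoint (W i) (W j)) (hW : ∀ i, Icc a b ⊆ F^[T] '' W i)
    (ψ : BoundedContinuousFunction ℝ ℝ) {c : ℝ}
    (hc : ∀ i, ∀ x ∈ W i, c ≤ ∑ j ∈ Finset.range T, ψ (F^[j] x)) :
    ∃ ν, IsInv a b F ν ∧ Real.log (Fintype.card ι) ≤ T * ksEntropy ν F ∧ c ≤ T * ∫ x, ψ x ∂ν := by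
  classical
  have hq : (0 : ℝ) < Fintype.card ι := by exact_mod_cast Fintype.card_pos
  have hT0 : (0 : ℝ) < T := by exact_mod_cast hT
  obtain ⟨ν₀, hν₀, hν₀W, hν₀c⟩ := exists_bernoulli (hF.iterate T) hab (hFI.iterate T) hWc hWI hWd hW
  have := hν₀.1
  have hinv := isInv_orbitAverage hF.measurable hFI hT hν₀
  set ν := orbitAverage F ν₀ T with hν
  have := hinv.1
  refine ⟨ν, hinv, ?_, ?_⟩
  · set e := Fintype.equivFin (Option ι)
    have hpp : ∀ x, ∃ o : Option ι, (∀ i, o = some i ↔ x ∈ W i) := by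
      intro x
      by_cases h : ∃ i, x ∈ W i
      · obtain ⟨i, hi⟩ := h
        refine ⟨some i, fun j => ?_⟩
        constructor
        · intro h
          rw [← Option.some_injective _ h]
          exact hi
        · intro hj
          by_contra hne
          have hij : i ≠ j := fun h => hne (by rw [h])
          exact Set.disjoint_left.1 (hWd hij) hi hj
      · refine ⟨none, fun j => ?_⟩
        simp only [reduceCtorEq, false_iff]
        exact fun hj => h ⟨j, hj⟩
    choose p hp using hpp
    have hpm : Measurable fun x => e (p x) := by
      refine measurable_to_countable' fun r => ?_
      have h1 : (fun x => e (p x)) ⁻¹' {r} = p ⁻¹' {e.symm r} := by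
        ext x
        simp [Equiv.eq_symm_apply]
      rw [h1]
      rcases e.symm r with _ | i
      · have : p ⁻¹' {none} = (⋃ i, W i)ᶜ := by
          ext x
          simp only [mem_preimage, mem_singleton_iff, mem_compl_iff, mem_iUnion, not_exists]
          constructor
          · intro h i hi
            rw [← hp x i, h] at hi
            simp at hi
          · intro h
            by_contra hne
            obtain ⟨i, hi⟩ := Option.ne_none_iff_exists'.1 hne
            exact h i ((hp x i).1 hi)
        rw [this]
        exact (MeasurableSet.iUnion fun i => (hWc i).measurableSet).compl
      · have : p ⁻¹' {some i} = W i := by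
          ext x
          simp [hp]
        rw [this]
        exact (hWc i).measurableSet
    refine le_trans ?_ (mul_le_mul_of_nonneg_left (le_ksEntropy hB (hent ν hinv) hpm) hT0.le)
    refine le_entropyRate_of_le_itin hinv.2.2 hpm hT (D := -Real.log (Fintype.card ι))
      fun q hq1 => ?_
    obtain ⟨k, rfl⟩ : ∃ k, q = k + 1 := ⟨q - 1, by omega⟩
    have key : ∀ u, ν.real (itin F (fun x => e (p x)) (T * (k + 1)) ⁻¹' {u}) ≤
        ((Fintype.card ι : ℝ) ^ k)⁻¹ := by
      intro u
      have hum := measurable_itin hF.measurable hpm (T * (k + 1)) (measurableSet_singleton u)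
      rw [hν, orbitAverage_real hF.measurable _ _ hum]
      have hone : ∀ j ∈ Finset.range T,
          ν₀.real (F^[j] ⁻¹' (itin F (fun x => e (p x)) (T * (k + 1)) ⁻¹' {u})) ≤
          ((Fintype.card ι : ℝ) ^ k)⁻¹ := by
        intro j hj
        have hjT := Finset.mem_range.1 hj
        have hidx : ∀ i : Fin k, T * (i + 1) - j < T * (k + 1) := by
          intro i
          have : T * ((i : ℕ) + 1) ≤ T * k := Nat.mul_le_mul_left _ (by omega)
          have : T * k < T * (k + 1) := Nat.mul_lt_mul_of_pos_left (by omega) (by omega)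
          omega
        have hsymb : ∀ x ∈ F^[j] ⁻¹' (itin F (fun x => e (p x)) (T * (k + 1)) ⁻¹' {u}),
            ∀ i : Fin k, p ((F^[T])^[i] (F^[T] x)) = e.symm (u ⟨T * (i + 1) - j, hidx i⟩) := by
          intro x hx i
          have h1 : itin F (fun x => e (p x)) (T * (k + 1)) (F^[j] x) = u := hx
          rw [← h1, itin, Equiv.symm_apply_apply, ← Function.iterate_add_apply,
            ← Function.iterate_mul, ← Function.iterate_add_apply]
          congr 2
          have : j ≤ T * ((i : ℕ) + 1) := by nlinarith
          have : T * ((i : ℕ) + 1) = T * i + T := by ring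
          simp only
          omega
        by_cases hnone : ∃ i : Fin k, e.symm (u ⟨T * (i + 1) - j, hidx i⟩) = none
        · obtain ⟨i, hi⟩ := hnone
          have h0 : ν₀ (F^[j] ⁻¹' (itin F (fun x => e (p x)) (T * (k + 1)) ⁻¹' {u})) = 0 := by
            have hz : ν₀ ((F^[T])^[(i : ℕ) + 1] ⁻¹' (⋃ i, W i)ᶜ) = 0 := by
              rw [(hν₀.2.2.iterate _).measure_preimage
                (MeasurableSet.iUnion fun i => (hWc i).measurableSet).compl.nullMeasurableSet]
              exact hν₀W
            refine measure_mono_null (fun x hx => ?_) hz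
            simp only [mem_preimage, mem_compl_iff, mem_iUnion, not_exists]
            intro i' hi'
            rw [Function.iterate_succ_apply, ← hp, hsymb x hx i, hi] at hi'
            simp at hi'
          rw [measureReal_def, h0]
          simp only [ENNReal.toReal_zero]
          positivity
        · push Not at hnone
          choose v hv using fun i => Option.ne_none_iff_exists'.1 (hnone i)
          refine le_trans ?_ (hν₀c k v)
          have hcm : MeasurableSet {x | ∀ i, (F^[T])^[((i : Fin k) : ℕ)] x ∈ W (v i)} := by
            have : {x | ∀ i, (F^[T])^[((i : Fin k) : ℕ)] x ∈ W (v i)} =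
                ⋂ i : Fin k, (F^[T])^[(i : ℕ)] ⁻¹' W (v i) := by ext x; simp
            rw [this]
            exact MeasurableSet.iInter fun i =>
              ((hWc _).preimage ((hF.iterate T).iterate _)).measurableSet
          rw [← hν₀.2.2.measureReal_preimage hcm.nullMeasurableSet]
          refine measureReal_mono fun x hx i => ?_
          rw [← hp, hsymb x hx i, hv i]
      have := Finset.sum_le_sum hone
      rw [Finset.sum_const, Finset.card_range, nsmul_eq_mul] at this
      rw [inv_mul_le_iff₀ hT0]
      exact this
    have h := neg_log_le_partitionEntropy
      (measurable_itin hF.measurable hpm (T * (k + 1))) key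
    rw [Real.log_inv, Real.log_pow, neg_neg] at h
    push_cast
    linarith
  · rw [hν, integral_orbitAverage hF.measurable _ hT, mul_inv_cancel_left₀ hT0.ne',
      ← integral_finsetSum]
    · have hae : ∀ᵐ x ∂ν₀, c ≤ ∑ j ∈ Finset.range T, ψ (F^[j] x) := by
        have : ∀ᵐ x ∂ν₀, x ∈ ⋃ i, W i := hν₀W
        filter_upwards [this] with x hx
        obtain ⟨i, hi⟩ := mem_iUnion.1 hx
        exact hc i x hi
      have := integral_mono_ae (integrable_const c) (integrable_finsetSum _ fun j _ =>
        (ψ.compContinuous ⟨F^[j], hF.iterate j⟩).integrable ν₀) hae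
      simpa using this
    · exact fun j _ => (ψ.compContinuous ⟨F^[j], hF.iterate j⟩).integrable ν₀

end Horseshoe

end HypPot

namespace HypPot

/-! ### Differentiable models of interval maps -/

/-- `F` is a continuous map of the line into `[a, b]`, factoring through the projection onto
`[a, b]`, and differentiable on `[a, b]` with derivative `d` of continuous absolute value. -/
structure IsModel (a b : ℝ) (F d : ℝ → ℝ) : Prop where
  lt : a < b
  cont : Continuous F
  mem : ∀ x, F x ∈ Icc a b
  proj : ∀ x, F (projIcc a b lt.le x) = F x
  deriv : ∀ x ∈ Icc a b, HasDerivWithinAt F (d x) (Icc a b) x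
  cont_abs : Continuous fun x => |d x|

/-- The absolute value of the derivative of the `k`-th iterate. -/
def jac (F d : ℝ → ℝ) (k : ℕ) (x : ℝ) : ℝ := ∏ i ∈ Finset.range k, |d (F^[i] x)|

lemma jac_nonneg {F d : ℝ → ℝ} (k : ℕ) (x : ℝ) : 0 ≤ jac F d k x :=
  Finset.prod_nonneg fun _ _ => abs_nonneg _

lemma jac_add {F d : ℝ → ℝ} (k l : ℕ) (x : ℝ) :
    jac F d (k + l) x = jac F d k x * jac F d l (F^[k] x) := by
  simp only [jac, Finset.prod_range_add, ← Function.iterate_add_apply, add_comm]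

namespace IsModel

variable {a b : ℝ} {F d : ℝ → ℝ}

lemma mapsTo (h : IsModel a b F d) : MapsTo F (Icc a b) (Icc a b) := fun x _ => h.mem x

lemma iterate_mem (h : IsModel a b F d) {x : ℝ} (hx : x ∈ Icc a b) (n : ℕ) :
    F^[n] x ∈ Icc a b := h.mapsTo.iterate n hx

lemma continuous_jac (h : IsModel a b F d) (k : ℕ) : Continuous (jac F d k) :=
  continuous_finsetProd _ fun i _ => h.cont_abs.comp (h.cont.iterate i)

lemma hasDerivWithinAt_iterate (h : IsModel a b F d) (k : ℕ) {x : ℝ} (hx : x ∈ Icc a b) :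
    HasDerivWithinAt F^[k] (∏ i ∈ Finset.range k, d (F^[i] x)) (Icc a b) x := by
  induction k with
  | zero => simpa using hasDerivWithinAt_id x _
  | succ k ih =>
    rw [Function.iterate_succ', Finset.prod_range_succ, mul_comm]
    exact (h.deriv _ (h.iterate_mem hx k)).comp x ih (h.mapsTo.iterate k)

lemma exists_iterate_sub_eq (h : IsModel a b F d) (k : ℕ) {x y : ℝ} (hx : x ∈ Icc a b)
    (hy : y ∈ Icc a b) :
    ∃ z ∈ uIcc x y, |F^[k] x - F^[k] y| = jac F d k z * |x - y| := by
  wlog hxy : x ≤ y generalizing x y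
  · obtain ⟨z, hz, hz'⟩ := this hy hx (le_of_not_ge hxy)
    exact ⟨z, by rwa [uIcc_comm], by rw [abs_sub_comm, hz', abs_sub_comm x y]⟩
  rcases hxy.eq_or_lt with rfl | hxy
  · exact ⟨x, left_mem_uIcc, by simp⟩
  have hsub : Icc x y ⊆ Icc a b := Icc_subset_Icc hx.1 hy.2
  obtain ⟨z, hz, hz'⟩ := exists_hasDerivAt_eq_slope (F^[k])
    (fun z => ∏ i ∈ Finset.range k, d (F^[i] z)) hxy
    ((h.cont.iterate k).continuousOn) fun z hz =>
      (h.hasDerivWithinAt_iterate k (hsub (Ioo_subset_Icc_self hz))).hasDerivAt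
        (Icc_mem_nhds (hx.1.trans_lt hz.1) (hz.2.trans_le hy.2))
  refine ⟨z, by rw [uIcc_of_le hxy.le]; exact Ioo_subset_Icc_self hz, ?_⟩
  rw [jac, ← Finset.abs_prod, hz', abs_sub_comm, abs_sub_comm x y, abs_div, div_mul_cancel₀]
  exact abs_ne_zero.2 (sub_pos.2 hxy).ne'

lemma mul_entropyRate_le (h : IsModel a b F d) {μ : Measure ℝ} (hμ : IsInv a b F μ) {k : ℕ}
    (hk : 1 ≤ k) {q : ℕ} {p : ℝ → Fin q} (hp : Measurable p) :
    k * entropyRate μ F p ≤ ∫ x, Real.log (jac F d k x + 3) ∂μ + Real.log 2 := by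
  have := hμ.1
  refine mul_entropyRate_le_integral_log h.lt hμ.2.1 hμ.2.2 h.mapsTo h.proj hk
    (h.continuous_jac k) (jac_nonneg k) (fun x hx y hy => ?_) hp
  obtain ⟨z, hz, he⟩ := h.exists_iterate_sub_eq k hx hy
  exact ⟨z, hz, he.le⟩

lemma exists_entropyRate_le (h : IsModel a b F d) : ∃ B, 0 ≤ B ∧ ∀ μ, IsInv a b F μ →
    ∀ (k : ℕ) (p : ℝ → Fin k), Measurable p → entropyRate μ F p ≤ B := by
  obtain ⟨M, hM⟩ := (isCompact_Icc (a := a) (b := b)).exists_bound_of_continuousOn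
    (h.continuous_jac 1).continuousOn
  have hM0 : 0 ≤ M := (norm_nonneg _).trans (hM a ⟨le_rfl, h.lt.le⟩)
  have h3 : 0 ≤ Real.log (M + 3) := Real.log_nonneg (by linarith)
  refine ⟨Real.log (M + 3) + Real.log 2, add_nonneg h3 (Real.log_nonneg (by norm_num)),
    fun μ hμ k p hp => ?_⟩
  have := hμ.1
  have h1 := h.mul_entropyRate_le hμ le_rfl hp
  have h2 : ∫ x, Real.log (jac F d 1 x + 3) ∂μ ≤ ∫ _, Real.log (M + 3) ∂μ := by
    refine integral_mono_of_nonneg (.of_forall fun x => Real.log_nonneg ?_)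
      (integrable_const _) ?_
    · linarith [jac_nonneg (F := F) (d := d) 1 x]
    · have : ∀ᵐ x ∂μ, x ∈ Icc a b := hμ.2.1
      filter_upwards [this] with x hx
      have := (le_abs_self _).trans (hM x hx)
      exact Real.log_le_log (by linarith [jac_nonneg (F := F) (d := d) 1 x]) (by linarith)
  simp at h1 h2
  linarith

lemma mul_ksEntropy_le (h : IsModel a b F d) {μ : Measure ℝ} (hμ : IsInv a b F μ) {k : ℕ}
    (hk : 1 ≤ k) :
    k * ksEntropy μ F ≤ ∫ x, Real.log (jac F d k x + 3) ∂μ + Real.log 2 := by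
  have hk0 : (0 : ℝ) < k := by exact_mod_cast hk
  rw [← le_div_iff₀' hk0]
  refine ksEntropy_le ?_ fun q p hp => ?_
  · refine div_nonneg (add_nonneg (integral_nonneg fun x => Real.log_nonneg ?_)
      (Real.log_nonneg (by norm_num))) hk0.le
    linarith [jac_nonneg (F := F) (d := d) k x]
  · rw [le_div_iff₀' hk0]
    exact h.mul_entropyRate_le hμ hk hp

lemma exists_ksEntropy_le (h : IsModel a b F d) :
    ∃ B, 0 ≤ B ∧ ∀ μ, IsInv a b F μ → ksEntropy μ F ≤ B := by
  obtain ⟨B, hB, hB'⟩ := h.exists_entropyRate_le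
  exact ⟨B, hB, fun μ hμ => ksEntropy_le hB (hB' μ hμ)⟩

/-! ### Pressure and orbit sums -/

lemma exists_isInv_integral_ge (h : IsModel a b F d) (ψ : BoundedContinuousFunction ℝ ℝ)
    {P : ℝ} {N : ℕ → ℕ} (hN : ∀ n, 1 ≤ N n) (hNt : Tendsto N atTop atTop)
    {c : ℕ → ℝ} (hc : Tendsto c atTop (nhds P))
    (hx : ∀ n, ∃ x ∈ Icc a b, c n * N n ≤ ∑ i ∈ Finset.range (N n), ψ (F^[i] x)) :
    ∃ ν, IsInv a b F ν ∧ P ≤ ∫ x, ψ x ∂ν := by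
  choose x hxI hx using hx
  obtain ⟨ν, hν, hν', -⟩ := exists_isInv_limit h.cont h.mapsTo (m := fun n => Measure.dirac (x n))
    (fun n => inferInstance) (fun n => by
      rw [Measure.dirac_apply' _ measurableSet_Icc.compl]; simp [hxI n]) hN hNt
  refine ⟨ν, hν, le_of_forall_lt fun c' hc' => ?_⟩
  obtain ⟨c'', h1, h2⟩ := exists_between hc'
  refine h1.trans_le (hν' ψ c'' ?_)
  filter_upwards [hc.eventually (lt_mem_nhds h2)] with n hn
  simp only [integral_dirac]
  exact (mul_le_mul_of_nonneg_right hn.le (Nat.cast_nonneg _)).trans (hx n)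

lemma eventually_sum_le (h : IsModel a b F d) (ψ : BoundedContinuousFunction ℝ ℝ)
    (hψ : ∀ ν, IsInv a b F ν → ∫ x, ψ x ∂ν ≤ 0) {ε : ℝ} (hε : 0 < ε) :
    ∀ᶠ n : ℕ in atTop, ∀ x ∈ Icc a b, ∑ i ∈ Finset.range n, ψ (F^[i] x) ≤ ε * n := by
  by_contra hcon
  obtain ⟨N, hNm, hN⟩ := extraction_of_frequently_atTop (not_eventually.1 hcon)
  have hN' : ∀ n, ∃ x ∈ Icc a b, ε * N (n + 1) ≤ ∑ i ∈ Finset.range (N (n + 1)), ψ (F^[i] x) := by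
    intro n
    have := hN (n + 1)
    push Not at this
    obtain ⟨x, hx, hx'⟩ := this
    exact ⟨x, hx, hx'.le⟩
  obtain ⟨ν, hν, hν'⟩ := h.exists_isInv_integral_ge ψ (N := fun n => N (n + 1))
    (fun n => (Nat.le_add_left 1 n).trans (hNm.id_le (n + 1)))
    (hNm.tendsto_atTop.comp (tendsto_add_atTop_nat 1)) (c := fun _ => ε) tendsto_const_nhds hN'
  linarith [hψ ν hν]

end IsModel

lemma IsInv.integral_comp_iterate {a b : ℝ} {F : ℝ → ℝ} {μ : Measure ℝ} (hμ : IsInv a b F μ)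
    (i : ℕ) {g : ℝ → ℝ} (hg : AEStronglyMeasurable g μ) :
    ∫ x, g (F^[i] x) ∂μ = ∫ x, g x ∂μ := by
  have h1 := hμ.2.2.iterate i
  conv_rhs => rw [← h1.map_eq]
  rw [integral_map h1.measurable.aemeasurable (by rwa [h1.map_eq])]

lemma IsInv.integral_sum {a b : ℝ} {F : ℝ → ℝ} {μ : Measure ℝ} (hμ : IsInv a b F μ)
    (n : ℕ) {g : ℝ → ℝ} (hg : Integrable g μ) :
    ∫ x, ∑ i ∈ Finset.range n, g (F^[i] x) ∂μ = n * ∫ x, g x ∂μ := by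
  rw [integral_finsetSum]
  · simp [hμ.integral_comp_iterate _ hg.aestronglyMeasurable]
  · exact fun i _ => (hμ.2.2.iterate i).integrable_comp_of_integrable hg

end HypPot

namespace HypPot

/-- The pressure, as a supremum over the invariant measures carried by `[a, b]`. -/
def pres (a b : ℝ) (F : ℝ → ℝ) (Φ : ℝ → ℝ) : ℝ :=
  sSup {r : ℝ | ∃ μ, IsInv a b F μ ∧ r = ksEntropy μ F + ∫ x, Φ x ∂μ}

lemma integral_add_const_add {X : Type*} [MeasurableSpace X] {μ : Measure X}
    [IsProbabilityMeasure μ] {g : X → ℝ} (hg : Integrable g μ) (c c' : ℝ) :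
    ∫ x, (c + g x + c') ∂μ = c + ∫ x, g x ∂μ + c' := by
  rw [integral_add (f := fun x => c + g x) ((integrable_const c).add hg) (integrable_const c'),
    integral_add (integrable_const c) hg]
  simp

namespace IsModel

variable {a b : ℝ} {F d : ℝ → ℝ}

lemma le_pres (h : IsModel a b F d) (Φ : BoundedContinuousFunction ℝ ℝ) {μ : Measure ℝ}
    (hμ : IsInv a b F μ) : ksEntropy μ F + ∫ x, Φ x ∂μ ≤ pres a b F Φ := by
  obtain ⟨B, -, hB'⟩ := h.exists_ksEntropy_le
  refine le_csSup ⟨B + ‖Φ‖, ?_⟩ ⟨μ, hμ, rfl⟩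
  rintro _ ⟨ν, hν, rfl⟩
  have := hν.1
  refine add_le_add (hB' ν hν) ((le_abs_self _).trans ?_)
  exact Φ.norm_integral_le_norm ν

lemma integral_le_of_sum_le {Φ : BoundedContinuousFunction ℝ ℝ} {μ : Measure ℝ}
    (hμ : IsInv a b F μ) {n : ℕ} (hn : 1 ≤ n) {c : ℝ}
    (hc : ∀ x ∈ Icc a b, ∑ i ∈ Finset.range n, Φ (F^[i] x) ≤ c * n) : ∫ x, Φ x ∂μ ≤ c := by
  have := hμ.1
  have hn0 : (0 : ℝ) < n := by exact_mod_cast hn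
  have h1 := hμ.integral_sum n (Φ.integrable μ)
  have h2 : ∫ x, ∑ i ∈ Finset.range n, Φ (F^[i] x) ∂μ ≤ ∫ _, c * n ∂μ := by
    refine integral_mono_ae ?_ (integrable_const _) ?_
    · exact integrable_finsetSum _ fun i _ =>
        (hμ.2.2.iterate i).integrable_comp_of_integrable (Φ.integrable μ)
    · have : ∀ᵐ x ∂μ, x ∈ Icc a b := hμ.2.1
      filter_upwards [this] with x hx using hc x hx
  simp only [integral_const, probReal_univ, one_smul] at h2
  rw [h1, mul_comm] at h2
  exact le_of_mul_le_mul_right h2 hn0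

lemma exists_integral_ge_pres (h : IsModel a b F d) (Φ : BoundedContinuousFunction ℝ ℝ) {P : ℝ}
    (hyp : ¬ ∃ n : ℕ, 1 ≤ n ∧ ∃ c < P, ∀ x ∈ Icc a b,
      ∑ i ∈ Finset.range n, Φ (F^[i] x) ≤ c * n) :
    ∃ ν, IsInv a b F ν ∧ P ≤ ∫ x, Φ x ∂ν := by
  push Not at hyp
  refine h.exists_isInv_integral_ge Φ (N := fun n => n + 1) (by simp)
    (tendsto_add_atTop_nat 1) (c := fun n => P - 1 / ((n : ℝ) + 1)) ?_ fun n => ?_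
  · simpa using tendsto_one_div_add_atTop_nhds_zero_nat.const_sub P
  · have hp : (0 : ℝ) < 1 / ((n : ℝ) + 1) := by positivity
    obtain ⟨x, hx, hx'⟩ := hyp (n + 1) (by omega) (P - 1 / ((n : ℝ) + 1)) (by linarith)
    exact ⟨x, hx, hx'.le⟩

/-! ### Measures without expansion have zero entropy -/

lemma log_jac_add_le (k l : ℕ) (x : ℝ) :
    Real.log (jac F d (k + l) x + 3) ≤
      Real.log (jac F d k x + 3) + Real.log (jac F d l (F^[k] x) + 3) := by
  have h1 := jac_nonneg (F := F) (d := d) k x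
  have h2 := jac_nonneg (F := F) (d := d) l (F^[k] x)
  rw [← Real.log_mul (by positivity) (by positivity), jac_add]
  exact Real.log_le_log (by positivity) (by nlinarith)

lemma exists_abs_le (h : IsModel a b F d) : ∃ M, 0 ≤ M ∧ ∀ x ∈ Icc a b, |d x| ≤ M := by
  obtain ⟨M, hM⟩ := (isCompact_Icc (a := a) (b := b)).exists_bound_of_continuousOn
    h.cont_abs.continuousOn
  refine ⟨M, (norm_nonneg _).trans (hM a ⟨le_rfl, h.lt.le⟩), fun x hx => ?_⟩
  simpa using hM x hx

lemma log_jac_le_sum (h : IsModel a b F d) {M ε : ℝ} (hM : 0 ≤ M) (hε : 0 ≤ ε)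
    (hM1 : ∀ x ∈ Icc a b, Real.log (jac F d 1 x + 3) ≤ M) {N : ℕ} {B : Set ℝ}
    (hB : ∀ x ∈ Icc a b, x ∉ B → ∃ n, 1 ≤ n ∧ n ≤ N ∧ Real.log (jac F d n x + 3) ≤ ε * n) (k : ℕ) :
    ∀ x ∈ Icc a b, Real.log (jac F d k x + 3) ≤
      ε * k + ∑ i ∈ Finset.range k, M * B.indicator 1 (F^[i] x) + (M * N + Real.log 4) := by
  have hpos : ∀ l x, 0 ≤ ∑ i ∈ Finset.range l, M * B.indicator (1 : ℝ → ℝ) (F^[i] x) :=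
    fun l x => Finset.sum_nonneg fun i _ =>
      mul_nonneg hM (indicator_nonneg (fun _ _ => zero_le_one) _)
  have hsmall : ∀ (l : ℕ), ∀ x ∈ Icc a b, Real.log (jac F d l x + 3) ≤ M * l + Real.log 4 := by
    intro l
    induction l with
    | zero => intro x _; simp only [jac, Finset.range_zero, Finset.prod_empty]; norm_num
    | succ l ih =>
      intro x hx
      have h1 := log_jac_add_le (F := F) (d := d) l 1 x
      have h2 := hM1 _ (h.iterate_mem hx l)
      have h3 := ih x hx
      push_cast
      linarith
  induction k using Nat.strong_induction_on with
  | _ k ih =>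
    intro x hx
    rcases le_or_gt k N with hk | hk
    · have h1 := hsmall k x hx
      have h2 : M * k ≤ M * N := mul_le_mul_of_nonneg_left (by exact_mod_cast hk) hM
      have h3 := hpos k x
      have h4 : 0 ≤ ε * k := by positivity
      linarith
    · by_cases hxB : x ∈ B
      · obtain ⟨l, rfl⟩ : ∃ l, k = 1 + l := ⟨k - 1, by omega⟩
        have h1 := log_jac_add_le (F := F) (d := d) 1 l x
        have h2 := hM1 x hx
        have h3 := ih l (by omega) _ (h.iterate_mem hx 1)
        rw [Finset.sum_range_add]
        simp only [Finset.range_one, Finset.sum_singleton, Function.iterate_zero, id,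
          indicator_of_mem hxB, Pi.one_apply, mul_one, add_comm 1, Function.iterate_succ_apply]
        simp only [Function.iterate_one, add_comm 1] at h1 h3
        push_cast
        linarith
      · obtain ⟨n, hn1, hnN, hn⟩ := hB x hx hxB
        obtain ⟨l, rfl⟩ : ∃ l, k = n + l := ⟨k - n, by omega⟩
        have h1 := log_jac_add_le (F := F) (d := d) n l x
        have h3 := ih l (by omega) _ (h.iterate_mem hx n)
        rw [Finset.sum_range_add]
        have h4 := hpos n x
        simp only [← Function.iterate_add_apply, add_comm _ n] at h3
        push_cast
        linarith

lemma ksEntropy_le_zero (h : IsModel a b F d) {ν : Measure ℝ} (hν : IsInv a b F ν)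
    (hE : ∀ᵐ x ∂ν, ∀ ε > (0 : ℝ), ∃ n : ℕ, 1 ≤ n ∧ Real.log (jac F d n x + 3) ≤ ε * n) :
    ksEntropy ν F ≤ 0 := by
  have := hν.1
  obtain ⟨M₀, hM₀, hM₀'⟩ := h.exists_abs_le
  set M := Real.log (M₀ + 3)
  have hM : 0 < M := Real.log_pos (by linarith)
  have hM1 : ∀ x ∈ Icc a b, Real.log (jac F d 1 x + 3) ≤ M := fun x hx =>
    Real.log_le_log (by linarith [jac_nonneg (F := F) (d := d) 1 x])
      (by simpa [jac] using hM₀' x hx)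
  refine le_of_forall_pos_le_add fun ε hε => ?_
  rw [zero_add]
  set B : ℕ → Set ℝ := fun N => {x | ∀ n, 1 ≤ n → n ≤ N → ε / 2 * n < Real.log (jac F d n x + 3)}
    with hBdef
  have hBm : ∀ N, MeasurableSet (B N) := by
    intro N
    have : B N = ⋂ n : ℕ, ⋂ _ : 1 ≤ n, ⋂ _ : n ≤ N, {x | ε / 2 * n < Real.log (jac F d n x + 3)} := by
      ext x; simp [hBdef]
    rw [this]
    exact .iInter fun n => .iInter fun _ => .iInter fun _ => measurableSet_lt measurable_const
      (Real.measurable_log.comp ((h.continuous_jac n).measurable.add_const 3))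
  have hBa : Antitone B := fun N N' hNN x hx n h1 h2 => hx n h1 (h2.trans hNN)
  have hB0 : ν (⋂ N, B N) = 0 := by
    have : ∀ᵐ x ∂ν, x ∉ ⋂ N, B N := by
      filter_upwards [hE] with x hx hx'
      obtain ⟨n, h1, h2⟩ := hx (ε / 2) (by positivity)
      exact absurd (mem_iInter.1 hx' n n h1 le_rfl) (not_lt.2 h2)
    exact measure_eq_zero_iff_ae_notMem.2 this
  have hBt : Tendsto (fun N => ν.real (B N)) atTop (nhds 0) := by
    have h1 := tendsto_measure_iInter_atTop (μ := ν) (fun N => (hBm N).nullMeasurableSet) hBa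
      ⟨0, measure_ne_top _ _⟩
    rw [hB0] at h1
    simpa [Function.comp_def, measureReal_def] using
      (ENNReal.tendsto_toReal ENNReal.zero_ne_top).comp h1
  obtain ⟨N, hN⟩ := (hBt.eventually (gt_mem_nhds (show 0 < ε / 2 / M by positivity))).exists
  have key : ∀ k : ℕ, 1 ≤ k →
      ksEntropy ν F ≤ ε / 2 + M * ν.real (B N) + (M * N + Real.log 4 + Real.log 2) / k := by
    intro k hk
    have hk0 : (0 : ℝ) < k := by exact_mod_cast hk
    have h1 := h.mul_ksEntropy_le hν hk
    have hIntegr : Integrable ((B N).indicator (1 : ℝ → ℝ)) ν :=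
      (integrable_const (1 : ℝ)).indicator (hBm N)
    have hIntegr' : ∀ i, Integrable (fun x => M * (B N).indicator (1 : ℝ → ℝ) (F^[i] x)) ν := fun i =>
      ((hν.2.2.iterate i).integrable_comp_of_integrable hIntegr).const_mul M
    have h2 : ∫ x, Real.log (jac F d k x + 3) ∂ν ≤
        ∫ x, (ε / 2 * k + ∑ i ∈ Finset.range k, M * (B N).indicator 1 (F^[i] x) +
          (M * N + Real.log 4)) ∂ν := by
      refine integral_mono_of_nonneg (.of_forall fun x => Real.log_nonneg ?_) ?_ ?_
      · linarith [jac_nonneg (F := F) (d := d) k x]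
      · exact ((integrable_const _).add (integrable_finsetSum _ fun i _ => hIntegr' i)).add
          (integrable_const _)
      · have : ∀ᵐ x ∂ν, x ∈ Icc a b := hν.2.1
        filter_upwards [this] with x hx
        refine h.log_jac_le_sum hM.le (by positivity) hM1 (fun y _ hyB => ?_) k x hx
        simp only [hBdef, mem_ofPred_eq] at hyB
        push Not at hyB
        exact hyB
    rw [integral_add_const_add (integrable_finsetSum _ fun i _ => hIntegr' i), hν.integral_sum k (hIntegr.const_mul M),
      integral_const_mul, integral_indicator_one (hBm N)] at h2
    have h3 : ksEntropy ν F ≤ (ε / 2 * k + k * (M * ν.real (B N)) + (M * N + Real.log 4) +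
      Real.log 2) / k := by
      rw [le_div_iff₀' hk0]
      linarith
    refine h3.trans (le_of_eq ?_)
    field_simp
    ring
  have hl : Tendsto (fun k : ℕ => ε / 2 + M * ν.real (B N) +
      (M * N + Real.log 4 + Real.log 2) / k) atTop (nhds (ε / 2 + M * ν.real (B N) + 0)) :=
    (tendsto_const_div_atTop_nhds_zero_nat _).const_add _
  have h4 := ge_of_tendsto hl (eventually_atTop.2 ⟨1, fun k hk => key k hk⟩)
  rw [lt_div_iff₀' hM] at hN
  linarith

end IsModel

end HypPot

namespace HypPot

lemma integrable_of_truncation {X : Type*} [MeasurableSpace X] {μ : Measure X}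
    [IsProbabilityMeasure μ] {g : X → ℝ} (hg : Measurable g) {M c : ℝ} (hM0 : 0 ≤ M)
    (hM : ∀ᵐ x ∂μ, g x ≤ M) (hc : ∀ k : ℕ, c ≤ ∫ x, max (g x) (-k) ∂μ) :
    Integrable g μ ∧ c ≤ ∫ x, g x ∂μ := by
  have hgk : ∀ k : ℕ, Integrable (fun x => max (g x) (-k)) μ := fun k => by
    refine Integrable.of_bound (hg.max measurable_const).aestronglyMeasurable (max M k) ?_
    filter_upwards [hM] with x hx
    rw [Real.norm_eq_abs, abs_le]
    constructor
    · have h1 := le_max_right M (k : ℝ)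
      have h2 := le_max_right (g x) (-(k : ℝ))
      linarith
    · refine max_le (hx.trans (le_max_left _ _)) ?_
      have : (0 : ℝ) ≤ k := Nat.cast_nonneg k
      linarith [le_max_left M (k : ℝ)]
  have h1 : ∫⁻ x, ENNReal.ofReal (M - g x) ∂μ ≤ ENNReal.ofReal (M - c) := by
    have h2 : ∀ x, liminf (fun k : ℕ => ENNReal.ofReal (M - max (g x) (-k))) atTop =
        ENNReal.ofReal (M - g x) := by
      intro x
      refine Tendsto.liminf_eq (tendsto_const_nhds.congr' ?_)
      obtain ⟨K, hK⟩ := exists_nat_ge (-g x)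
      filter_upwards [eventually_ge_atTop K] with k hk
      have : (K : ℝ) ≤ k := by exact_mod_cast hk
      rw [max_eq_left (by linarith)]
    calc ∫⁻ x, ENNReal.ofReal (M - g x) ∂μ
        = ∫⁻ x, liminf (fun k : ℕ => ENNReal.ofReal (M - max (g x) (-k))) atTop ∂μ := by
          simp_rw [h2]
      _ ≤ liminf (fun k : ℕ => ∫⁻ x, ENNReal.ofReal (M - max (g x) (-k)) ∂μ) atTop :=
          lintegral_liminf_le fun k =>
            (measurable_const.sub (hg.max measurable_const)).ennreal_ofReal
      _ ≤ ENNReal.ofReal (M - c) := by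
          refine liminf_le_of_frequently_le' (Eventually.of_forall fun k => ?_).frequently
          rw [← ofReal_integral_eq_lintegral_ofReal (f := fun x => M - max (g x) (-(k : ℝ)))
            ((integrable_const M).sub (hgk k))]
          · refine ENNReal.ofReal_le_ofReal ?_
            rw [integral_sub (integrable_const M) (hgk k)]
            have := hc k
            simp only [integral_const, probReal_univ, one_smul]
            linarith
          · filter_upwards [hM] with x hx
            have : (0 : ℝ) ≤ k := Nat.cast_nonneg k
            simp only [Pi.zero_apply, sub_nonneg]
            exact max_le hx (by linarith)
  have hnn : 0 ≤ᵐ[μ] fun x => M - g x := by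
    filter_upwards [hM] with x hx using sub_nonneg.2 hx
  have hIntegr : Integrable (fun x => M - g x) μ := by
    refine ⟨(measurable_const.sub hg).aestronglyMeasurable, ?_⟩
    rw [hasFiniteIntegral_iff_ofReal hnn]
    exact h1.trans_lt ENNReal.ofReal_lt_top
  have hgi : Integrable g μ := by
    have := (integrable_const M (μ := μ)).sub hIntegr
    simpa [Pi.sub_def] using this
  refine ⟨hgi, ?_⟩
  have hMc : 0 ≤ M - c := by
    have h3 : ∫ x, max (g x) (-(0 : ℕ)) ∂μ ≤ ∫ _, M ∂μ := by
      refine integral_mono_ae (hgk 0) (integrable_const _) ?_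
      filter_upwards [hM] with x hx
      simpa using ⟨hx, hM0⟩
    have := (hc 0).trans h3
    simpa using this
  rw [← ofReal_integral_eq_lintegral_ofReal hIntegr hnn, ENNReal.ofReal_le_ofReal_iff hMc,
    integral_sub (integrable_const M) hgi] at h1
  simp only [integral_const, probReal_univ, one_smul] at h1
  linarith

namespace IsModel

variable {a b : ℝ} {F d : ℝ → ℝ}

lemma integral_log_pos (h : IsModel a b F d) {μ : Measure ℝ} (hμ : IsInv a b F μ)
    (hE : ∀ᵐ x ∂μ, ∃ m : ℕ, ∀ᶠ n : ℕ in atTop, Real.exp (n / (m + 1 : ℝ)) < jac F d n x) :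
    Integrable (fun x => Real.log |d x|) μ ∧ 0 < ∫ x, Real.log |d x| ∂μ := by
  have := hμ.1
  have hIae : ∀ᵐ x ∂μ, x ∈ Icc a b := hμ.2.1
  obtain ⟨M₀, hM₀, hM₀'⟩ := h.exists_abs_le
  set S : ℕ → Set ℝ := fun m =>
    {x | ∀ n, m ≤ n → Real.exp (n / (m + 1 : ℝ)) < jac F d n x} with hS
  have hSm : ∀ m, MeasurableSet (S m) := by
    intro m
    have : S m = ⋂ n : ℕ, ⋂ _ : m ≤ n, {x | Real.exp (n / (m + 1 : ℝ)) < jac F d n x} := by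
      ext x; simp [hS]
    rw [this]
    exact .iInter fun n => .iInter fun _ =>
      measurableSet_lt measurable_const (h.continuous_jac n).measurable
  have hSmono : Monotone S := by
    intro m m' hmm x hx n hn
    refine lt_of_le_of_lt (Real.exp_le_exp.2 ?_) (hx n (hmm.trans hn))
    have : (m : ℝ) ≤ m' := by exact_mod_cast hmm
    gcongr
  have hSU : μ (⋃ m, S m) = 1 := by
    rw [← measure_univ (μ := μ)]
    refine measure_congr (eventuallyEq_univ.2 ?_)
    filter_upwards [hE] with x ⟨m, hm⟩
    obtain ⟨N, hN⟩ := eventually_atTop.1 hm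
    refine mem_iUnion.2 ⟨max m N, fun n hn => ?_⟩
    refine lt_of_le_of_lt (Real.exp_le_exp.2 ?_) (hN n ((le_max_right _ _).trans hn))
    have : (m : ℝ) ≤ (max m N : ℕ) := by exact_mod_cast le_max_left m N
    gcongr
  have hSt : Tendsto (fun m => μ.real (S m)) atTop (nhds 1) := by
    have h1 := tendsto_measure_iUnion_atTop (μ := μ) hSmono
    rw [hSU] at h1
    simpa [Function.comp_def, measureReal_def] using
      (ENNReal.tendsto_toReal ENNReal.one_ne_top).comp h1
  obtain ⟨m, hm⟩ := (hSt.eventually (lt_mem_nhds (show (0 : ℝ) < 1 by norm_num))).exists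
  set c : ℝ := 1 / (m + 1 : ℝ) with hc
  have hc0 : 0 < c := by positivity
  have hlog : Measurable fun x => Real.log |d x| :=
    Real.measurable_log.comp h.cont_abs.measurable
  have hgM : ∀ x ∈ Icc a b, Real.log |d x| ≤ Real.log (M₀ + 1) := by
    intro x hx
    rcases (abs_nonneg (d x)).eq_or_lt with h0 | h0
    · rw [← h0, Real.log_zero]
      exact Real.log_nonneg (by linarith)
    · exact Real.log_le_log h0 (by linarith [hM₀' x hx])
  have hM1 : 0 ≤ Real.log (M₀ + 1) := Real.log_nonneg (by linarith)
  have hpt : ∀ (k n : ℕ), m ≤ n → ∀ x, c * n * (S m).indicator 1 x -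
      k * n * (S n)ᶜ.indicator 1 x ≤
        ∑ i ∈ Finset.range n, max (Real.log |d (F^[i] x)|) (-k) := by
    intro k n hmn x
    have h3 : (n : ℝ) * (-k) ≤ ∑ i ∈ Finset.range n, max (Real.log |d (F^[i] x)|) (-k) := by
      rw [← nsmul_eq_mul]
      refine (Finset.card_nsmul_le_sum (Finset.range n) _ _ fun i _ => le_max_right _ _).trans' ?_
      simp
    by_cases hxn : x ∈ S n
    · have h1 := hxn n le_rfl
      have h1' : 0 < jac F d n x := (Real.exp_pos _).trans h1
      have h2 : Real.log (jac F d n x) ≤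
          ∑ i ∈ Finset.range n, max (Real.log |d (F^[i] x)|) (-k) := by
        rw [jac, Real.log_prod fun i hi => (Finset.prod_ne_zero_iff.1 h1'.ne') i hi]
        exact Finset.sum_le_sum fun i _ => le_max_left _ _
      have hxn' : x ∉ (S n)ᶜ := fun hh => hh hxn
      rw [indicator_of_notMem hxn', mul_zero, sub_zero]
      refine le_trans ?_ h2
      rw [Real.le_log_iff_exp_le h1']
      by_cases hxm : x ∈ S m
      · rw [indicator_of_mem hxm, Pi.one_apply, mul_one]
        refine le_trans (le_of_eq ?_) (hxm n hmn).le
        rw [hc]; congr 1; ring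
      · rw [indicator_of_notMem hxm, mul_zero]
        exact (Real.exp_le_exp.2 (by positivity)).trans h1.le
    · have hxm : x ∉ S m := fun hh => hxn (hSmono hmn hh)
      have hxn' : x ∈ (S n)ᶜ := hxn
      rw [indicator_of_notMem hxm, indicator_of_mem hxn', Pi.one_apply]
      linarith
  have hind : ∀ (A : Set ℝ), MeasurableSet A → Integrable (A.indicator (1 : ℝ → ℝ)) μ :=
    fun A hA => (integrable_const (1 : ℝ)).indicator hA
  have key : ∀ k : ℕ, c * μ.real (S m) ≤ ∫ x, max (Real.log |d x|) (-k) ∂μ := by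
    intro k
    have hIntegr : Integrable (fun x => max (Real.log |d x|) (-(k : ℝ))) μ := by
      refine Integrable.of_bound (hlog.max measurable_const).aestronglyMeasurable
        (max (Real.log (M₀ + 1)) k) ?_
      filter_upwards [hIae] with x hx
      rw [Real.norm_eq_abs, abs_le]
      constructor
      · have h1 := le_max_right (Real.log (M₀ + 1)) (k : ℝ)
        have h2 := le_max_right (Real.log |d x|) (-(k : ℝ))
        linarith
      · refine max_le ((hgM x hx).trans (le_max_left _ _)) ?_
        have : (0 : ℝ) ≤ k := Nat.cast_nonneg k
        exact le_trans (by linarith) (le_max_right (Real.log (M₀ + 1)) (k : ℝ))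
    have hn : ∀ n, m ≤ n → 1 ≤ n → c * μ.real (S m) - k * (1 - μ.real (S n)) ≤
        ∫ x, max (Real.log |d x|) (-k) ∂μ := by
      intro n hmn hn1
      have hn0 : (0 : ℝ) < n := by exact_mod_cast hn1
      have h1 : ∫ x, (c * n * (S m).indicator 1 x - k * n * (S n)ᶜ.indicator 1 x) ∂μ ≤
          ∫ x, ∑ i ∈ Finset.range n, max (Real.log |d (F^[i] x)|) (-k) ∂μ :=
        integral_mono (((hind _ (hSm m)).const_mul (c * n)).sub
        ((hind _ (hSm n).compl).const_mul (k * n)))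
        (integrable_finsetSum (Finset.range n) fun i _ =>
          (hμ.2.2.iterate i).integrable_comp_of_integrable hIntegr) (hpt k n hmn)
      rw [hμ.integral_sum n hIntegr, integral_sub ((hind _ (hSm m)).const_mul (c * n))
        ((hind _ (hSm n).compl).const_mul (k * n)), integral_const_mul, integral_const_mul,
        integral_indicator_one (hSm m), integral_indicator_one (hSm n).compl,
        probReal_compl_eq_one_sub (hSm n)] at h1
      refine le_of_mul_le_mul_left ?_ hn0
      linarith
    have hl : Tendsto (fun n => c * μ.real (S m) - k * (1 - μ.real (S n))) atTop
        (nhds (c * μ.real (S m) - k * (1 - 1))) :=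
      ((hSt.const_sub 1).const_mul (k : ℝ)).const_sub _
    have h2 := le_of_tendsto hl (eventually_atTop.2 ⟨max m 1, fun n hn' =>
      hn n ((le_max_left _ _).trans hn') ((le_max_right _ _).trans hn')⟩)
    simpa using h2
  have h5 := integrable_of_truncation hlog hM1 (hIae.mono fun x hx => hgM x hx) key
  exact ⟨h5.1, (mul_pos hc0 hm).trans_le h5.2⟩

end IsModel

end HypPot

namespace HypPot

lemma IsInv.cond {a b : ℝ} {F : ℝ → ℝ} {μ : Measure ℝ} (hμ : IsInv a b F μ) {A : Set ℝ}
    (hA : MeasurableSet A) (hAF : F ⁻¹' A =ᵐ[μ] A) (hA0 : μ A ≠ 0) :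
    IsInv a b F (ProbabilityTheory.cond μ A) := by
  have := hμ.1
  refine ⟨ProbabilityTheory.cond_isProbabilityMeasure hA0, ?_, hμ.2.2.measurable, ?_⟩
  · exact ProbabilityTheory.cond_absolutelyContinuous hμ.2.1
  · ext t ht
    rw [Measure.map_apply hμ.2.2.measurable ht, ProbabilityTheory.cond_apply hA,
      ProbabilityTheory.cond_apply hA]
    congr 1
    calc μ (A ∩ F ⁻¹' t) = μ (F ⁻¹' A ∩ F ⁻¹' t) :=
          measure_congr (hAF.symm.inter (ae_eq_refl _))
      _ = μ (A ∩ t) := by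
        rw [← preimage_inter]
        exact hμ.2.2.measure_preimage (hA.inter ht).nullMeasurableSet

lemma integral_cond {μ : Measure ℝ} [IsProbabilityMeasure μ] {A : Set ℝ} (hA0 : μ A ≠ 0)
    (g : ℝ → ℝ) : μ.real A * ∫ x, g x ∂(ProbabilityTheory.cond μ A) = ∫ x in A, g x ∂μ := by
  rw [ProbabilityTheory.cond, integral_smul_measure, smul_eq_mul, ← mul_assoc,
    ENNReal.toReal_inv, ← measureReal_def, mul_inv_cancel₀, one_mul]
  exact (measureReal_ne_zero_iff).2 hA0

lemma real_cond {μ : Measure ℝ} [IsProbabilityMeasure μ] {A t : Set ℝ} (hA : MeasurableSet A)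
    (hA0 : μ A ≠ 0) : μ.real A * (ProbabilityTheory.cond μ A).real t = μ.real (A ∩ t) := by
  rw [measureReal_def (ProbabilityTheory.cond μ A), ProbabilityTheory.cond_apply hA,
    ENNReal.toReal_mul, ← mul_assoc, ENNReal.toReal_inv, ← measureReal_def, mul_inv_cancel₀,
    one_mul, ← measureReal_def]
  exact (measureReal_ne_zero_iff).2 hA0

namespace IsModel

variable {a b : ℝ} {F d : ℝ → ℝ}

lemma ksEntropy_convex_le (h : IsModel a b F d) {μ ν ν' : Measure ℝ} (hμ : IsInv a b F μ)
    (hν : IsInv a b F ν) (hν' : IsInv a b F ν') {θ : ℝ} (h0 : 0 ≤ θ) (h1 : θ ≤ 1)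
    (he : ∀ A, MeasurableSet A → μ.real A = θ * ν.real A + (1 - θ) * ν'.real A) :
    ksEntropy μ F ≤ θ * ksEntropy ν F + (1 - θ) * ksEntropy ν' F := by
  have := hμ.1
  have := hν.1
  have := hν'.1
  obtain ⟨B, hB, hB'⟩ := h.exists_entropyRate_le
  have h2 : 0 ≤ 1 - θ := by linarith
  refine ksEntropy_le (add_nonneg (mul_nonneg h0 ksEntropy_nonneg)
    (mul_nonneg h2 ksEntropy_nonneg)) fun k p hp => ?_
  refine (entropyRate_convex_le hμ.2.2 hν.2.2 hν'.2.2 hp h0 h1 he).trans ?_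
  exact add_le_add (mul_le_mul_of_nonneg_left (le_ksEntropy hB (hB' ν hν) hp) h0)
    (mul_le_mul_of_nonneg_left (le_ksEntropy hB (hB' ν' hν') hp) h2)

lemma integral_log_pos_of_hyperbolic (h : IsModel a b F d)
    (Φ : BoundedContinuousFunction ℝ ℝ) {c : ℝ} (hcP : c < pres a b F Φ)
    (hc : ∀ ν, IsInv a b F ν → ∫ x, Φ x ∂ν ≤ c) {μ : Measure ℝ} (hμ : IsInv a b F μ)
    (hP : ksEntropy μ F + ∫ x, Φ x ∂μ = pres a b F Φ) :
    Integrable (fun x => Real.log |d x|) μ ∧ 0 < ∫ x, Real.log |d x| ∂μ := by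
  have := hμ.1
  have hIae : ∀ᵐ x ∂μ, x ∈ Icc a b := hμ.2.1
  obtain ⟨M₀, hM₀, hM₀'⟩ := h.exists_abs_le
  set G : Set ℝ := {x | ∃ m : ℕ, ∀ᶠ n : ℕ in atTop, Real.exp (n / (m + 1 : ℝ)) < jac F d n x}
    with hG
  have hGm : MeasurableSet G := by
    have : G = ⋃ m : ℕ, {x | ∀ᶠ n : ℕ in atTop, Real.exp (n / (m + 1 : ℝ)) < jac F d n x} := by
      ext x; simp [hG]
    rw [this]
    simp only [eventually_atTop, Set.ofPred_exists, Set.ofPred_forall]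
    exact .iUnion fun m => .iUnion fun _ => .iInter fun n => .iInter fun _ =>
      measurableSet_lt measurable_const (h.continuous_jac n).measurable
  have hGF : ∀ x ∈ Icc a b, x ∈ G → F x ∈ G := by
    rintro x hx ⟨m, hm⟩
    refine ⟨m + 1, ?_⟩
    have hlim : Tendsto (fun n : ℕ => (n : ℝ) * (1 / (m + 1) - 1 / (m + 2))) atTop atTop := by
      refine tendsto_natCast_atTop_atTop.atTop_mul_const (sub_pos.2 ?_)
      exact one_div_lt_one_div_of_lt (by positivity) (by linarith)
    filter_upwards [(tendsto_add_atTop_nat 1).eventually hm,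
      hlim.eventually_ge_atTop (Real.log (M₀ + 1))] with n hn hn'
    have h1 : jac F d (n + 1) x ≤ (M₀ + 1) * jac F d n (F x) := by
      rw [add_comm n 1, jac_add]
      refine mul_le_mul ?_ le_rfl (jac_nonneg _ _) (by linarith)
      simpa [jac] using (hM₀' x hx).trans (by linarith)
    have h2 : (0 : ℝ) < M₀ + 1 := by linarith
    rw [← mul_lt_mul_iff_right₀ h2]
    refine lt_of_le_of_lt ?_ (hn.trans_le h1)
    rw [← Real.exp_log h2, ← Real.exp_add]
    refine Real.exp_le_exp.2 ?_
    push_cast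
    have h3 : (0 : ℝ) ≤ 1 / (m + 1) := by positivity
    have e1 : (n : ℝ) / (m + 1 + 1) = n * (1 / (m + 2)) := by rw [add_assoc]; norm_num; ring
    have e2 : ((n : ℝ) + 1) / (m + 1) = n * (1 / (m + 1)) + 1 / (m + 1) := by ring
    rw [e1, e2]
    linarith
  have hGae : F ⁻¹' G =ᵐ[μ] G := by
    refine (ae_eq_of_ae_subset_of_measure_ge ?_ ?_ hGm.nullMeasurableSet ?_).symm
    · filter_upwards [hIae] with x hx hxG using hGF x hx hxG
    · exact (hμ.2.2.measure_preimage hGm.nullMeasurableSet).le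
    · exact measure_ne_top _ _
  have hE : ∀ x, x ∉ G → ∀ ε > (0 : ℝ), ∃ n : ℕ, 1 ≤ n ∧ Real.log (jac F d n x + 3) ≤ ε * n := by
    intro x hx ε hε
    simp only [hG, mem_ofPred_eq] at hx
    push Not at hx
    obtain ⟨m, hm⟩ := exists_nat_one_div_lt (show 0 < ε / 2 by positivity)
    have hlim : Tendsto (fun n : ℕ => (n : ℝ) * (ε / 2)) atTop atTop :=
      tendsto_natCast_atTop_atTop.atTop_mul_const (by positivity)
    obtain ⟨n, hn, hn1, hn2⟩ := ((hx m).and_eventually ((eventually_ge_atTop 1).and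
      (hlim.eventually_ge_atTop (Real.log 4)))).exists
    refine ⟨n, hn1, ?_⟩
    have h1 : 1 ≤ Real.exp (n / (m + 1 : ℝ)) := Real.one_le_exp (by positivity)
    have h2 : Real.log (jac F d n x + 3) ≤ Real.log (4 * Real.exp (n / (m + 1 : ℝ))) :=
      Real.log_le_log (by linarith [jac_nonneg (F := F) (d := d) n x]) (by linarith)
    rw [Real.log_mul (by norm_num) (Real.exp_pos _).ne', Real.log_exp] at h2
    have h3 : (n : ℝ) / (m + 1) ≤ ε / 2 * n := by
      rw [div_eq_mul_one_div, mul_comm]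
      exact mul_le_mul_of_nonneg_right hm.le (Nat.cast_nonneg n)
    linarith
  refine h.integral_log_pos hμ ?_
  by_contra hcon
  have hE0 : μ Gᶜ ≠ 0 := fun h0 => hcon (by
    filter_upwards [measure_eq_zero_iff_ae_notMem.1 h0] with x hx
    exact not_not.1 hx)
  have hGc : F ⁻¹' Gᶜ =ᵐ[μ] Gᶜ := hGae.compl
  set ν := ProbabilityTheory.cond μ Gᶜ with hν
  have hνi : IsInv a b F ν := hμ.cond hGm.compl hGc hE0
  have hν0 : ksEntropy ν F ≤ 0 := by
    refine h.ksEntropy_le_zero hνi ?_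
    have : ∀ᵐ x ∂ν, x ∈ Gᶜ := ProbabilityTheory.ae_cond_mem hGm.compl
    filter_upwards [this] with x hx using hE x hx
  have hθ : 0 < μ.real Gᶜ := measureReal_nonneg.lt_of_ne' ((measureReal_ne_zero_iff).2 hE0)
  by_cases hG0 : μ G = 0
  · have h1 : ksEntropy μ F ≤ 0 := by
      refine h.ksEntropy_le_zero hμ ?_
      filter_upwards [measure_eq_zero_iff_ae_notMem.1 hG0] with x hx using hE x hx
    linarith [hc μ hμ]
  · set ν' := ProbabilityTheory.cond μ G with hν'
    have hνi' : IsInv a b F ν' := hμ.cond hGm hGae hG0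
    have hG1 : μ.real G = 1 - μ.real Gᶜ := by
      rw [probReal_compl_eq_one_sub hGm]; ring
    have hθ1 : 0 ≤ 1 - μ.real Gᶜ := by rw [← hG1]; exact measureReal_nonneg
    have h1 := h.ksEntropy_convex_le hμ hνi hνi' hθ.le (by linarith) fun A hA => by
      rw [← hG1, hν, hν', real_cond hGm.compl hE0, real_cond hGm hG0, inter_comm, inter_comm G,
        ← Set.sdiff_eq, add_comm, measureReal_inter_add_sdiff hGm]
    have h2 : ∫ x, Φ x ∂μ = μ.real Gᶜ * ∫ x, Φ x ∂ν + (1 - μ.real Gᶜ) * ∫ x, Φ x ∂ν' := by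
      rw [← hG1, hν, hν', integral_cond hE0, integral_cond hG0, add_comm,
        integral_add_compl hGm (Φ.integrable μ)]
    have h3 := h.le_pres Φ hνi'
    have h4 := hc ν hνi
    have h5 := mul_le_mul_of_nonneg_left h3 hθ1
    have h6 := mul_le_mul_of_nonneg_left h4 hθ.le
    have h7 := mul_le_mul_of_nonneg_left hν0 hθ.le
    nlinarith

end IsModel

end HypPot

namespace HypPot

/-- A model of a topologically exact interval map with non-flat critical set `C`. -/
structure IsNonflatModel (a b : ℝ) (F d : ℝ → ℝ) (C : Finset ℝ) (β u : ℝ → ℝ) : Prop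
    extends IsModel a b F d where
  crit_mem : ∀ c ∈ C, c ∈ Icc a b
  order_pos : ∀ c ∈ C, 0 < β c
  cont_u : Continuous u
  abs_eq : ∀ x ∈ Icc a b, |d x| = Real.exp (u x) * ∏ c ∈ C, |x - c| ^ β c
  lower : ∀ z ∈ Icc a b, ∃ κ > (0 : ℝ), ∃ A > (0 : ℝ),
    ∀ᶠ x in nhdsWithin z (Icc a b), κ * |x - z| ^ A ≤ |F x - F z|
  exact : ∀ U : Set ℝ, IsOpen U → (U ∩ Icc a b).Nonempty →
    ∃ n : ℕ, 1 ≤ n ∧ F^[n] '' (U ∩ Icc a b) = Icc a b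

/-- `s` is not an atom of `μ` and `log |x - s|` is `μ`-integrable. -/
def LogIntegrableAt (μ : Measure ℝ) (s : ℝ) : Prop :=
  μ {s} = 0 ∧ Integrable (fun x => Real.log |x - s|) μ

namespace IsNonflatModel

variable {a b : ℝ} {F d : ℝ → ℝ} {C : Finset ℝ} {β u : ℝ → ℝ}

lemma eq_zero_iff (h : IsNonflatModel a b F d C β u) {x : ℝ} (hx : x ∈ Icc a b) :
    d x = 0 ↔ x ∈ C := by
  rw [← abs_eq_zero, h.abs_eq x hx, mul_eq_zero, Finset.prod_eq_zero_iff]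
  constructor
  · rintro (h1 | ⟨c, hc, h1⟩)
    · exact absurd h1 (Real.exp_pos _).ne'
    · rw [Real.rpow_eq_zero (abs_nonneg _) (h.order_pos c hc).ne', abs_eq_zero, sub_eq_zero] at h1
      rwa [h1]
  · exact fun hx => Or.inr ⟨x, hx, by simp [(h.order_pos x hx).ne']⟩

lemma log_abs_eq (h : IsNonflatModel a b F d C β u) {x : ℝ} (hx : x ∈ Icc a b) (hxC : x ∉ C) :
    Real.log |d x| = u x + ∑ c ∈ C, β c * Real.log |x - c| := by
  have hne : ∀ c ∈ C, 0 < |x - c| := fun c hc =>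
    abs_pos.2 (sub_ne_zero.2 fun hh => hxC (hh ▸ hc))
  have hne' : ∀ c ∈ C, |x - c| ^ β c ≠ 0 := fun c hc => (Real.rpow_pos_of_pos (hne c hc) _).ne'
  rw [h.abs_eq x hx, Real.log_mul (Real.exp_pos _).ne' (Finset.prod_ne_zero_iff.2 hne'),
    Real.log_exp, Real.log_prod hne']
  congr 1
  exact Finset.sum_congr rfl fun c hc => Real.log_rpow (hne c hc) _

lemma image_eq (h : IsNonflatModel a b F d C β u) : F '' Icc a b = Icc a b := by
  refine Subset.antisymm h.mapsTo.image_subset fun y hy => ?_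
  obtain ⟨n, hn, he⟩ := h.exact univ isOpen_univ (by simpa using h.lt.le)
  rw [univ_inter] at he
  rw [← he] at hy
  obtain ⟨x, hx, rfl⟩ := hy
  obtain ⟨m, rfl⟩ : ∃ m, n = m + 1 := ⟨n - 1, by omega⟩
  exact ⟨F^[m] x, h.iterate_mem hx m, (Function.iterate_succ_apply' F m x).symm⟩

lemma image_iterate_eq (h : IsNonflatModel a b F d C β u) (n : ℕ) :
    F^[n] '' Icc a b = Icc a b := by
  induction n with
  | zero => simp
  | succ n ih => rw [Function.iterate_succ', image_comp, ih, h.image_eq]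

lemma exists_forall_image_eq (h : IsNonflatModel a b F d C β u) {U : Set ℝ} (hU : IsOpen U)
    (hne : (U ∩ Icc a b).Nonempty) :
    ∃ N : ℕ, ∀ n, N ≤ n → F^[n] '' (U ∩ Icc a b) = Icc a b := by
  obtain ⟨N, -, hN⟩ := h.exact U hU hne
  refine ⟨N, fun n hn => ?_⟩
  obtain ⟨k, rfl⟩ : ∃ k, n = k + N := ⟨n - N, by omega⟩
  rw [Function.iterate_add, image_comp, hN, h.image_iterate_eq]

lemma iterate_ne_of_mem_crit (h : IsNonflatModel a b F d C β u) {c : ℝ} (hc : c ∈ C) {p : ℕ}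
    (hp : p ≠ 0) : F^[p] c ≠ c := by
  intro hpc
  have hcI := h.crit_mem c hc
  have hj0 : jac F d p c = 0 := by
    refine Finset.prod_eq_zero (Finset.mem_range.2 (Nat.pos_of_ne_zero hp)) ?_
    simp [(h.eq_zero_iff hcI).2 hc]
  obtain ⟨δ, hδ, hδ'⟩ := Metric.eventually_nhds_iff_ball.1
    ((h.continuous_jac p).continuousAt.eventually
      (gt_mem_nhds (show jac F d p c < 1 by rw [hj0]; norm_num)))
  set r := min δ ((b - a) / 4) with hr
  have hlt := h.lt
  have hr0 : 0 < r := lt_min hδ (by linarith)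
  have hmaps : MapsTo F^[p] (ball c r ∩ Icc a b) (ball c r ∩ Icc a b) := by
    rintro x ⟨hx, hxI⟩
    refine ⟨?_, h.iterate_mem hxI p⟩
    obtain ⟨z, hz, he⟩ := h.exists_iterate_sub_eq p hxI hcI
    rw [hpc] at he
    rw [mem_ball, Real.dist_eq] at hx ⊢
    have hzb : z ∈ ball c r := by
      have := convex_ball c r
      exact this.ordConnected.uIcc_subset (by rwa [mem_ball, Real.dist_eq])
        (mem_ball_self hr0) hz
    have h1 := hδ' z (ball_subset_ball (min_le_left _ _) hzb)
    rw [he]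
    nlinarith [abs_nonneg (x - c), jac_nonneg (F := F) (d := d) p z]
  obtain ⟨N, hN⟩ := h.exists_forall_image_eq (isOpen_ball (x := c) (ε := r))
    ⟨c, mem_ball_self hr0, hcI⟩
  have h1 := hN (p * N) (Nat.le_mul_of_pos_left N (Nat.pos_of_ne_zero hp))
  have h2 : Icc a b ⊆ ball c r := by
    rw [← h1, Function.iterate_mul]
    exact (hmaps.iterate N).image_subset.trans inter_subset_left
  have ha := h2 ⟨le_rfl, hlt.le⟩
  have hb := h2 ⟨hlt.le, le_rfl⟩
  rw [mem_ball, Real.dist_eq, abs_lt] at ha hb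
  have := min_le_right δ ((b - a) / 4)
  linarith [ha.1, hb.2]

lemma measure_crit (h : IsNonflatModel a b F d C β u) {μ : Measure ℝ} (hμ : IsInv a b F μ)
    {c : ℝ} (hc : c ∈ C) : μ {c} = 0 := by
  by_contra h0
  have := hμ.1
  obtain ⟨x, hx, m, hm, hxm⟩ := hμ.2.2.conservative.exists_mem_iterate_mem
    (measurableSet_singleton c).nullMeasurableSet h0
  rw [mem_singleton_iff] at hx hxm
  subst hx
  exact h.iterate_ne_of_mem_crit hc hm hxm

lemma ae_notMem_crit (h : IsNonflatModel a b F d C β u) {μ : Measure ℝ} (hμ : IsInv a b F μ) :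
    ∀ᵐ x ∂μ, x ∉ C := by
  have h1 : ∀ᵐ x ∂μ, ∀ c ∈ (C : Set ℝ), x ≠ c := (ae_ball_iff C.countable_toSet).2 fun c hc =>
    measure_eq_zero_iff_ae_notMem.1 (h.measure_crit hμ (Finset.mem_coe.1 hc))
  filter_upwards [h1] with x hx hxC using hx x (Finset.mem_coe.2 hxC) rfl

lemma measurable_log_abs_sub (s : ℝ) : Measurable fun x => Real.log |x - s| :=
  Real.measurable_log.comp (continuous_abs.measurable.comp (measurable_id.sub_const s))

lemma log_abs_sub_le (h : IsNonflatModel a b F d C β u) {x s : ℝ} (hx : x ∈ Icc a b)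
    (hs : s ∈ Icc a b) : Real.log |x - s| ≤ Real.log (b - a + 1) := by
  have hlt := h.lt
  rcases (abs_nonneg (x - s)).eq_or_lt with h0 | h0
  · rw [← h0, Real.log_zero]
    exact Real.log_nonneg (by linarith)
  · refine Real.log_le_log h0 ((abs_le.2 ⟨?_, ?_⟩))
    · linarith [hx.1, hs.2]
    · linarith [hx.2, hs.1]

lemma logIntegrableAt_crit (h : IsNonflatModel a b F d C β u) {μ : Measure ℝ}
    (hμ : IsInv a b F μ) (hIntegr : Integrable (fun x => Real.log |d x|) μ) {c : ℝ} (hc : c ∈ C) :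
    LogIntegrableAt μ c := by
  have := hμ.1
  have hIae : ∀ᵐ x ∂μ, x ∈ Icc a b := hμ.2.1
  refine ⟨h.measure_crit hμ hc, ?_⟩
  set R := Real.log (b - a + 1) with hR
  have hR0 : 0 ≤ R := Real.log_nonneg (by linarith [h.lt])
  obtain ⟨U, hU⟩ := (isCompact_Icc (a := a) (b := b)).exists_bound_of_continuousOn
    h.cont_u.continuousOn
  have hβ := h.order_pos c hc
  have hbig : Integrable (fun x => |R| + (U + ∑ c ∈ C, β c * R + |(Real.log |d x|)|) / β c) μ :=
    (integrable_const _).add (((integrable_const _).add hIntegr.abs).div_const _)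
  refine hbig.mono' (measurable_log_abs_sub c).aestronglyMeasurable ?_
  filter_upwards [hIae, h.ae_notMem_crit hμ] with x hx hxC
  have h1 := h.log_abs_eq hx hxC
  have h2 := (neg_abs_le _).trans_eq h1
  have h3 : ∑ c ∈ C, β c * Real.log |x - c| ≤
      β c * Real.log |x - c| + ∑ c ∈ C, β c * R - β c * R := by
    rw [← Finset.add_sum_erase C _ hc, ← Finset.add_sum_erase C (fun c => β c * R) hc]
    have : ∑ c ∈ C.erase c, β c * Real.log |x - c| ≤ ∑ c ∈ C.erase c, β c * R :=
      Finset.sum_le_sum fun c' hc' => mul_le_mul_of_nonneg_left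
        (h.log_abs_sub_le hx (h.crit_mem c' (Finset.mem_of_mem_erase hc')))
        (h.order_pos c' (Finset.mem_of_mem_erase hc')).le
    linarith
  have h4 := (le_abs_self _).trans (hU x hx)
  rw [Real.norm_eq_abs, abs_le]
  have h5 : 0 ≤ ∑ c ∈ C, β c * R :=
    Finset.sum_nonneg fun c' hc' => mul_nonneg (h.order_pos c' hc').le hR0
  have h6 := h.log_abs_sub_le hx (h.crit_mem c hc)
  have h7 : 0 ≤ (U + ∑ c ∈ C, β c * R + |(Real.log |d x|)|) / β c := by
    have : 0 ≤ U := (norm_nonneg _).trans (hU x hx)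
    positivity
  constructor
  · have h8 : -(U + ∑ c ∈ C, β c * R + |(Real.log |d x|)|) / β c ≤ Real.log |x - c| := by
      rw [div_le_iff₀ hβ]
      have : 0 ≤ β c * R := by positivity
      linarith
    rw [neg_div] at h8
    linarith [abs_nonneg R]
  · linarith [le_abs_self R]

end IsNonflatModel

end HypPot

namespace HypPot
namespace IsNonflatModel

variable {a b : ℝ} {F d : ℝ → ℝ} {C : Finset ℝ} {β u : ℝ → ℝ}

lemma exists_log_image_bound (h : IsNonflatModel a b F d C β u) {s : ℝ} (hs : s ∈ Icc a b) :
    ∃ (t : Finset ℝ) (K : ℝ) (A : ℝ → ℝ), (∀ z ∈ t, z ∈ Icc a b ∧ F z = s) ∧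
      ∀ x ∈ Icc a b, (F x = s → x ∈ t) ∧
        |(Real.log |F x - s|)| ≤ K + ∑ z ∈ t, A z * |(Real.log |x - z|)| := by
  have hloc : ∀ z ∈ Icc a b, ∃ κ > (0 : ℝ), ∃ A > (0 : ℝ), ∀ᶠ x in nhdsWithin z (Icc a b),
      (F z ≠ s → κ ≤ |F x - s|) ∧ (F z = s → κ * |x - z| ^ A ≤ |F x - s|) := by
    intro z hz
    by_cases hzs : F z = s
    · obtain ⟨κ, hκ, A, hA, hl⟩ := h.lower z hz
      refine ⟨κ, hκ, A, hA, hl.mono fun x hx => ⟨fun h => absurd hzs h, fun _ => by rwa [← hzs]⟩⟩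
    · have hpos : 0 < |F z - s| := abs_pos.2 (sub_ne_zero.2 hzs)
      have hcont : ContinuousAt (fun x => |F x - s|) z :=
        (h.cont.sub continuous_const).abs.continuousAt
      refine ⟨|F z - s| / 2, by positivity, 1, one_pos, ?_⟩
      filter_upwards [nhdsWithin_le_nhds
        (hcont.eventually (lt_mem_nhds (show |F z - s| / 2 < |F z - s| by linarith)))] with x hx
      exact ⟨fun _ => hx.le, fun h => absurd h hzs⟩
  choose! κ hκ A hA hev using hloc
  obtain ⟨t, htI, htc⟩ := (isCompact_Icc (a := a) (b := b)).elim_nhdsWithin_subcover _ hev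
  set t' := t.filter fun z => F z = s with ht'
  have hlt := h.lt
  have hKnn : 0 ≤ ∑ z ∈ t, |Real.log (κ z)| := Finset.sum_nonneg fun _ _ => abs_nonneg _
  refine ⟨t', |Real.log (b - a + 1)| + ∑ z ∈ t, |Real.log (κ z)|, A,
    fun z hz => ⟨htI z (Finset.mem_filter.1 hz).1, (Finset.mem_filter.1 hz).2⟩, fun x hx => ?_⟩
  obtain ⟨z, hz, hxz⟩ := mem_iUnion₂.1 (htc hx)
  have hzI := htI z hz
  have hκz := hκ z hzI
  have hxt : F x = s → x ∈ t' := by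
    intro hxs
    have h0 : |F x - s| = 0 := by simp [hxs]
    by_cases hzs : F z = s
    · have h1 := hxz.2 hzs
      rw [h0] at h1
      have h2 : |x - z| ^ A z ≤ 0 := by
        by_contra hcon
        push Not at hcon
        linarith [mul_pos hκz hcon]
      have h3 : |x - z| ^ A z = 0 := le_antisymm h2 (Real.rpow_nonneg (abs_nonneg _) _)
      rw [Real.rpow_eq_zero (abs_nonneg _) (hA z hzI).ne', abs_eq_zero, sub_eq_zero] at h3
      rw [h3]
      exact Finset.mem_filter.2 ⟨hz, hzs⟩
    · have h1 := hxz.1 hzs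
      linarith
  refine ⟨hxt, ?_⟩
  have hsum : 0 ≤ ∑ z ∈ t', A z * |(Real.log |x - z|)| := Finset.sum_nonneg fun z hz =>
    mul_nonneg (hA z (htI z (Finset.mem_filter.1 hz).1)).le (abs_nonneg _)
  by_cases hxs : F x = s
  · rw [hxs, sub_self, abs_zero, Real.log_zero, abs_zero]
    positivity
  have hpos : 0 < |F x - s| := abs_pos.2 (sub_ne_zero.2 hxs)
  have hup : Real.log |F x - s| ≤ |Real.log (b - a + 1)| :=
    (h.log_abs_sub_le (h.mem x) hs).trans (le_abs_self _)
  have hκ1 : |Real.log (κ z)| ≤ ∑ z ∈ t, |Real.log (κ z)| :=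
    Finset.single_le_sum (f := fun z => |Real.log (κ z)|) (fun _ _ => abs_nonneg _) hz
  rw [abs_le]
  refine ⟨?_, by linarith⟩
  by_cases hzs : F z = s
  · have hzt : z ∈ t' := Finset.mem_filter.2 ⟨hz, hzs⟩
    have h1 : A z * |(Real.log |x - z|)| ≤ ∑ z ∈ t', A z * |(Real.log |x - z|)| :=
      Finset.single_le_sum (f := fun z => A z * |(Real.log |x - z|)|) (fun z hz =>
        mul_nonneg (hA z (htI z (Finset.mem_filter.1 hz).1)).le (abs_nonneg _)) hzt
    have hxz' : 0 < |x - z| := abs_pos.2 (sub_ne_zero.2 fun hh => hxs (hh ▸ hzs))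
    have h2 := Real.log_le_log (mul_pos hκz (Real.rpow_pos_of_pos hxz' _)) (hxz.2 hzs)
    rw [Real.log_mul hκz.ne' (Real.rpow_pos_of_pos hxz' _).ne', Real.log_rpow hxz'] at h2
    have h3 := mul_le_mul_of_nonneg_left (neg_abs_le (Real.log |x - z|)) (hA z hzI).le
    linarith [neg_abs_le (Real.log (κ z)), abs_nonneg (Real.log (b - a + 1))]
  · have h2 := Real.log_le_log hκz (hxz.1 hzs)
    linarith [neg_abs_le (Real.log (κ z)), abs_nonneg (Real.log (b - a + 1))]

lemma logIntegrableAt_of_preimages (h : IsNonflatModel a b F d C β u) {μ : Measure ℝ}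
    (hμ : IsInv a b F μ) {s : ℝ} (hs : s ∈ Icc a b)
    (hpre : ∀ z ∈ Icc a b, F z = s → LogIntegrableAt μ z) : LogIntegrableAt μ s := by
  have := hμ.1
  have hIae : ∀ᵐ x ∂μ, x ∈ Icc a b := hμ.2.1
  obtain ⟨t, K, A, ht, hb⟩ := h.exists_log_image_bound hs
  constructor
  · rw [← hμ.2.2.measure_preimage (measurableSet_singleton s).nullMeasurableSet]
    have h1 : ∀ᵐ x ∂μ, ∀ z ∈ (t : Set ℝ), x ≠ z := (ae_ball_iff t.countable_toSet).2 fun z hz =>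
      measure_eq_zero_iff_ae_notMem.1 (hpre z (ht z hz).1 (ht z hz).2).1
    refine measure_eq_zero_iff_ae_notMem.2 ?_
    filter_upwards [hIae, h1] with x hx hxt hxs
    exact hxt x ((hb x hx).1 hxs) rfl
  · have hm := measurable_log_abs_sub s
    rw [← hμ.2.2.integrable_comp hm.aestronglyMeasurable]
    have hbig : Integrable (fun x => K + ∑ z ∈ t, A z * |(Real.log |x - z|)|) μ :=
      (integrable_const _).add (integrable_finsetSum _ fun z hz =>
        (hpre z (ht z hz).1 (ht z hz).2).2.abs.const_mul _)
    refine hbig.mono' (hm.comp h.cont.measurable).aestronglyMeasurable ?_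
    filter_upwards [hIae] with x hx using (hb x hx).2

lemma mem_crit_of_image_endpoint (h : IsNonflatModel a b F d C β u) {z : ℝ} (hz : z ∈ Ioo a b)
    (hFz : F z = a ∨ F z = b) : z ∈ C := by
  have hzI := Ioo_subset_Icc_self hz
  rw [← h.eq_zero_iff hzI]
  have hd : HasDerivAt F (d z) z := (h.deriv z hzI).hasDerivAt (Icc_mem_nhds hz.1 hz.2)
  rcases hFz with hFz | hFz
  · exact IsLocalMin.hasDerivAt_eq_zero (.of_forall fun x => by rw [hFz]; exact (h.mem x).1) hd
  · exact IsLocalMax.hasDerivAt_eq_zero (.of_forall fun x => by rw [hFz]; exact (h.mem x).2) hd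

lemma exists_singular_set (h : IsNonflatModel a b F d C β u) {μ : Measure ℝ}
    (hμ : IsInv a b F μ) (hIntegr : Integrable (fun x => Real.log |d x|) μ) :
    ∃ S : Finset ℝ, C ⊆ S ∧ (∀ s ∈ S, s ∈ Icc a b) ∧ (∀ s ∈ S, LogIntegrableAt μ s) ∧
      (a ∉ S → F a = a ∨ F a = b) ∧ (b ∉ S → F b = a ∨ F b = b) := by
  classical
  have hlt := h.lt
  have hcrit : ∀ c ∈ C, LogIntegrableAt μ c := fun c hc => h.logIntegrableAt_crit hμ hIntegr hc
  have haI : a ∈ Icc a b := ⟨le_rfl, hlt.le⟩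
  have hbI : b ∈ Icc a b := ⟨hlt.le, le_rfl⟩
  have hcase : ∀ z ∈ Icc a b, z = a ∨ z = b ∨ z ∈ Ioo a b := by
    intro z hz
    rcases hz.1.eq_or_lt with h1 | h1
    · exact Or.inl h1.symm
    rcases hz.2.eq_or_lt with h2 | h2
    · exact Or.inr (Or.inl h2)
    · exact Or.inr (Or.inr ⟨h1, h2⟩)
  have hgood : ∀ e e', (e = a ∧ e' = b ∨ e = b ∧ e' = a) → F e ≠ a → F e ≠ b →
      LogIntegrableAt μ e := by
    intro e e' hee hea heb
    have heI : e ∈ Icc a b := by rcases hee with h | h <;> simp [h.1, hlt.le]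
    have heI' : e' ∈ Icc a b := by rcases hee with h | h <;> simp [h.2, hlt.le]
    have hend : ∀ z ∈ Icc a b, z = e ∨ z = e' ∨ z ∈ Ioo a b := by
      intro z hz
      rcases hee with ⟨rfl, rfl⟩ | ⟨rfl, rfl⟩
      · exact hcase z hz
      · rcases hcase z hz with h | h | h <;> simp [h]
    have hne : F e ≠ e ∧ F e ≠ e' := by rcases hee with ⟨rfl, rfl⟩ | ⟨rfl, rfl⟩ <;> simp [*]
    have hend' : ∀ z, z = e ∨ z = e' → z = a ∨ z = b := by
      rcases hee with ⟨rfl, rfl⟩ | ⟨rfl, rfl⟩ <;> simp +contextual [or_imp]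
    have hee' : e ≠ e' := by
      rcases hee with ⟨rfl, rfl⟩ | ⟨rfl, rfl⟩
      · exact hlt.ne
      · exact hlt.ne'
    refine h.logIntegrableAt_of_preimages hμ heI fun z hz hzs => ?_
    rcases hend z hz with rfl | rfl | hz'
    · exact absurd hzs hne.1
    · refine h.logIntegrableAt_of_preimages hμ heI' fun y hy hys => ?_
      rcases hend y hy with rfl | rfl | hy'
      · exact absurd hys hne.2
      · exact absurd (hzs.symm.trans hys) hee'
      · exact hcrit y (h.mem_crit_of_image_endpoint hy' (hys ▸ hend' _ (Or.inr rfl)))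
    · exact hcrit z (h.mem_crit_of_image_endpoint hz' (hzs ▸ hend' _ (Or.inl rfl)))
  refine ⟨C ∪ ({a, b} : Finset ℝ).filter fun e => F e ≠ a ∧ F e ≠ b, Finset.subset_union_left,
    fun s hs => ?_, fun s hs => ?_, fun ha => ?_, fun hb => ?_⟩
  · rcases Finset.mem_union.1 hs with hs | hs
    · exact h.crit_mem s hs
    · simp only [Finset.mem_filter, Finset.mem_insert, Finset.mem_singleton] at hs
      rcases hs.1 with rfl | rfl <;> assumption
  · rcases Finset.mem_union.1 hs with hs | hs
    · exact hcrit s hs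
    · simp only [Finset.mem_filter, Finset.mem_insert, Finset.mem_singleton] at hs
      rcases hs.1 with rfl | rfl
      · exact hgood _ b (Or.inl ⟨rfl, rfl⟩) hs.2.1 hs.2.2
      · exact hgood _ a (Or.inr ⟨rfl, rfl⟩) hs.2.1 hs.2.2
  · simp only [Finset.mem_union, Finset.mem_filter, Finset.mem_insert, true_or, true_and,
      not_or, not_and_or, not_not] at ha
    exact ha.2
  · simp only [Finset.mem_union, Finset.mem_filter, Finset.mem_insert, Finset.mem_singleton,
      or_true, true_and, not_or, not_and_or, not_not] at hb
    exact hb.2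

end IsNonflatModel

end HypPot

namespace HypPot

/-! ### Hyperbolic times -/

/-- Pliss' lemma: the number of record times of the partial sums of a sequence bounded above. -/
lemma le_mul_card_records {s : ℕ → ℝ} {M : ℝ} (hM : 0 ≤ M) (h0 : s 0 ≤ 0)
    (hs : ∀ i, s (i + 1) ≤ s i + M) (n : ℕ) : ∀ j ≤ n, s j ≤
      M * ((Finset.Icc 1 n).filter fun b => ∀ j ≤ b, s j ≤ s b).card := by
  induction n with
  | zero =>
    intro j hj
    rw [Nat.le_zero.1 hj]
    simpa using h0
  | succ n ih =>
    intro j hj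
    have hsub : (Finset.Icc 1 n).filter (fun b => ∀ j ≤ b, s j ≤ s b) ⊆
        (Finset.Icc 1 (n + 1)).filter fun b => ∀ j ≤ b, s j ≤ s b :=
      Finset.filter_subset_filter _ (Finset.Icc_subset_Icc_right n.le_succ)
    have hcard : (((Finset.Icc 1 n).filter fun b => ∀ j ≤ b, s j ≤ s b).card : ℝ) ≤
        ((Finset.Icc 1 (n + 1)).filter fun b => ∀ j ≤ b, s j ≤ s b).card := by
      exact_mod_cast Finset.card_le_card hsub
    have hmul := mul_le_mul_of_nonneg_left hcard hM
    rcases Nat.lt_or_ge j (n + 1) with hj' | hj'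
    · exact (ih j (by omega)).trans hmul
    obtain rfl : j = n + 1 := by omega
    by_cases hrec : ∀ j ≤ n + 1, s j ≤ s (n + 1)
    · have hins : (Finset.Icc 1 (n + 1)).filter (fun b => ∀ j ≤ b, s j ≤ s b) =
          insert (n + 1) ((Finset.Icc 1 n).filter fun b => ∀ j ≤ b, s j ≤ s b) := by
        ext b
        simp only [Finset.mem_filter, Finset.mem_Icc, Finset.mem_insert]
        constructor
        · rintro ⟨⟨h1, h2⟩, h3⟩
          rcases Nat.lt_or_ge b (n + 1) with hb | hb
          · exact Or.inr ⟨⟨h1, by omega⟩, h3⟩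
          · exact Or.inl (by omega)
        · rintro (rfl | ⟨⟨h1, h2⟩, h3⟩)
          · exact ⟨⟨by omega, le_rfl⟩, hrec⟩
          · exact ⟨⟨h1, by omega⟩, h3⟩
      rw [hins, Finset.card_insert_of_notMem (by simp)]
      have := ih n le_rfl
      push_cast
      linarith [hs n]
    · push Not at hrec
      obtain ⟨i, hi, hi'⟩ := hrec
      have hin : i ≤ n := by
        rcases Nat.lt_or_ge i (n + 1) with h | h
        · omega
        · obtain rfl : i = n + 1 := by omega
          exact absurd hi' (lt_irrefl _)
      exact hi'.le.trans ((ih i hin).trans hmul)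

/-- Every point `δ`-close to `F^[τ] x` has, for each `j ≤ τ`, a preimage under `F^[τ - j]` whose
orbit approximates the orbit of `F^[j] x` exponentially well backwards in time. -/
def IsGoodTime (a b : ℝ) (F : ℝ → ℝ) (δ r : ℝ) (x : ℝ) (τ : ℕ) : Prop :=
  ∀ j m, j + m = τ → ∀ w ∈ Icc a b, |w - F^[τ] x| ≤ δ → ∃ y ∈ Icc a b,
    (∀ i ≤ m, |F^[i] y - F^[j + i] x| ≤ δ * r ^ (m - i)) ∧ F^[m] y = w

namespace IsModel

variable {a b : ℝ} {F d : ℝ → ℝ}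

lemma exists_preimage_near (h : IsModel a b F d) {x t m : ℝ} (hx : x ∈ Icc a b) (ht : 0 < t)
    (hm : 0 < m) (hd : ∀ y ∈ Icc a b, |y - x| ≤ t → m ≤ |d y|)
    (ha : |a - x| ≤ t → F a = a ∨ F a = b) (hb : |b - x| ≤ t → F b = a ∨ F b = b)
    {w : ℝ} (hw : w ∈ Icc a b) (hwx : |w - F x| ≤ m * t) :
    ∃ y ∈ Icc a b, |y - x| ≤ t ∧ F y = w := by
  have hlt := h.lt
  set p := max (x - t) a with hp
  set q := min (x + t) b with hq
  have hpa : a ≤ p := le_max_right _ _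
  have hqb : q ≤ b := min_le_right _ _
  have hpx : p ≤ x := max_le (by linarith) hx.1
  have hxq : x ≤ q := le_min (by linarith) hx.2
  have hpt : x - t ≤ p := le_max_left _ _
  have hqt : q ≤ x + t := min_le_left _ _
  have hpq : p < q := by
    rcases hx.1.eq_or_lt with h1 | h1
    · exact hpx.trans_lt (lt_min (by linarith) (by linarith))
    · exact lt_of_lt_of_le (max_lt (by linarith) h1) hxq
  have hball : ∀ y ∈ Icc p q, y ∈ Icc a b ∧ |y - x| ≤ t := fun y hy =>
    ⟨⟨hpa.trans hy.1, hy.2.trans hqb⟩, abs_le.2 ⟨by linarith [hy.1], by linarith [hy.2]⟩⟩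
  have hexp : ∀ y ∈ Icc p q, ∀ z ∈ Icc p q, m * |y - z| ≤ |F y - F z| := by
    intro y hy z hz
    obtain ⟨v, hv, he⟩ := h.exists_iterate_sub_eq 1 (hball y hy).1 (hball z hz).1
    have hv' := hball v (ordConnected_Icc.uIcc_subset hy hz hv)
    simp only [Function.iterate_one, jac, Finset.range_one, Finset.prod_singleton,
      Function.iterate_zero, id] at he
    rw [he]
    exact mul_le_mul_of_nonneg_right (hd v hv'.1 hv'.2) (abs_nonneg _)
  have hinj : InjOn F (Icc p q) := by
    intro y hy z hz hyz
    have := hexp y hy z hz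
    rw [hyz, sub_self, abs_zero] at this
    have h1 : |y - z| ≤ 0 := by
      by_contra hcon
      push Not at hcon
      linarith [mul_pos hm hcon]
    exact sub_eq_zero.1 (abs_nonpos_iff.1 h1)
  have hpI : p ∈ Icc p q := ⟨le_rfl, hpq.le⟩
  have hqI : q ∈ Icc p q := ⟨hpq.le, le_rfl⟩
  have hxI : x ∈ Icc p q := ⟨hpx, hxq⟩
  have hq' : q = x + t ∨ q = b ∧ (F q = a ∨ F q = b) := by
    rcases min_choice (x + t) b with h1 | h1
    · exact Or.inl (hq.trans h1)
    · have : q = b := hq.trans h1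
      exact Or.inr ⟨this, by rw [this]; exact hb (this ▸ (hball q hqI).2)⟩
  have hp' : p = x - t ∨ p = a ∧ (F p = a ∨ F p = b) := by
    rcases max_choice (x - t) a with h1 | h1
    · exact Or.inl (hp.trans h1)
    · have : p = a := hp.trans h1
      exact Or.inr ⟨this, by rw [this]; exact ha (this ▸ (hball p hpI).2)⟩
  have hqF := hexp q hqI x hxI
  have hpF := hexp p hpI x hxI
  rw [abs_le] at hwx
  have hFp := h.mem p
  have hFq := h.mem q
  have hcov : w ∈ uIcc (F p) (F q) := by
    rcases h.cont.continuousOn.strictMonoOn_of_injOn_Icc' hpq.le hinj with hmono | hmono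
    · have hlt' := hmono hpI hqI hpq
      have h1 := hmono.monotoneOn hpI hxI hpx
      have h2 := hmono.monotoneOn hxI hqI hxq
      rw [uIcc_of_le hlt'.le]
      constructor
      · rcases hp' with hp' | ⟨-, hp' | hp'⟩
        · rw [abs_of_nonpos (sub_nonpos.2 h1), hp', sub_sub_cancel_left, abs_neg,
            abs_of_pos ht] at hpF
          rw [hp']
          linarith
        · rw [hp']; exact hw.1
        · linarith [hFq.2]
      · rcases hq' with hq' | ⟨-, hq' | hq'⟩
        · rw [abs_of_nonneg (sub_nonneg.2 h2), hq', add_sub_cancel_left, abs_of_pos ht] at hqF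
          rw [hq']
          linarith
        · linarith [hFp.1]
        · rw [hq']; exact hw.2
    · have hlt' := hmono hpI hqI hpq
      have h1 := hmono.antitoneOn hpI hxI hpx
      have h2 := hmono.antitoneOn hxI hqI hxq
      rw [uIcc_of_ge hlt'.le]
      constructor
      · rcases hq' with hq' | ⟨-, hq' | hq'⟩
        · rw [abs_of_nonpos (sub_nonpos.2 h2), hq', add_sub_cancel_left, abs_of_pos ht] at hqF
          rw [hq']
          linarith
        · rw [hq']; exact hw.1
        · linarith [hFp.2]
      · rcases hp' with hp' | ⟨-, hp' | hp'⟩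
        · rw [abs_of_nonneg (sub_nonneg.2 h1), hp', sub_sub_cancel_left, abs_neg,
            abs_of_pos ht] at hpF
          rw [hp']
          linarith
        · linarith [hFq.1]
        · rw [hp']; exact hw.2
  obtain ⟨y, hy, hyw⟩ := intermediate_value_uIcc h.cont.continuousOn hcov
  rw [uIcc_of_le hpq.le] at hy
  exact ⟨y, (hball y hy).1, (hball y hy).2, hyw⟩

end IsModel

namespace IsNonflatModel

variable {a b : ℝ} {F d : ℝ → ℝ} {C : Finset ℝ} {β u : ℝ → ℝ}

lemma exists_distortion (h : IsNonflatModel a b F d C β u) {κ : ℝ} (hκ : 0 < κ) :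
    ∃ c₀, 0 < c₀ ∧ c₀ < 1 ∧ ∃ δ₀ > 0, ∀ x ∈ Icc a b, ∀ y ∈ Icc a b,
      (∀ c ∈ C, |y - x| ≤ c₀ * |x - c|) → |y - x| ≤ δ₀ → |d x| * Real.exp (-κ) ≤ |d y| := by
  set B := ∑ c ∈ C, β c with hB
  have hB0 : 0 ≤ B := Finset.sum_nonneg fun c hc => (h.order_pos c hc).le
  have huc := isCompact_Icc.uniformContinuousOn_of_continuous (h.cont_u.continuousOn (s := Icc a b))
  obtain ⟨δ, hδ, hδ'⟩ := Metric.uniformContinuousOn_iff.1 huc (κ / 2) (by positivity)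
  have hη : 0 < κ / (2 * (B + 1)) := by positivity
  refine ⟨1 - Real.exp (-(κ / (2 * (B + 1)))), ?_, ?_, δ / 2, by positivity,
    fun x hx y hy hc hxy => ?_⟩
  · have : Real.exp (-(κ / (2 * (B + 1)))) < 1 := Real.exp_lt_one_iff.2 (by linarith)
    linarith
  · linarith [Real.exp_pos (-(κ / (2 * (B + 1))))]
  set e := Real.exp (-(κ / (2 * (B + 1)))) with he
  have he0 : 0 < e := Real.exp_pos _
  have h1 := hδ' y hy x hx (by rw [Real.dist_eq]; linarith)
  rw [Real.dist_eq, abs_lt] at h1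
  have h2 : e ^ B * ∏ c ∈ C, |x - c| ^ β c ≤ ∏ c ∈ C, |y - c| ^ β c := by
    have h4 : e ^ B = ∏ c ∈ C, e ^ β c := by
      rw [hB, Real.rpow_sum_of_pos he0]
    rw [h4, ← Finset.prod_mul_distrib]
    refine Finset.prod_le_prod (fun c _ => by positivity) fun c hcC => ?_
    rw [← Real.mul_rpow he0.le (abs_nonneg _)]
    refine Real.rpow_le_rpow (by positivity) ?_ (h.order_pos c hcC).le
    have h5 := hc c hcC
    have h6 : |x - c| ≤ |y - c| + |y - x| := by
      have := abs_sub_le x y c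
      rw [abs_sub_comm x y] at this
      linarith
    linarith
  have h3 : Real.exp (-(κ / 2)) ≤ e ^ B := by
    rw [he, ← Real.exp_mul]
    refine Real.exp_le_exp.2 ?_
    have : κ / (2 * (B + 1)) * B ≤ κ / 2 := by
      rw [div_mul_eq_mul_div, div_le_div_iff₀ (by positivity) (by norm_num)]
      nlinarith
    linarith
  rw [h.abs_eq x hx, h.abs_eq y hy]
  have hP : 0 ≤ ∏ c ∈ C, |x - c| ^ β c :=
    Finset.prod_nonneg fun c _ => Real.rpow_nonneg (abs_nonneg _) _
  have hκ2 : Real.exp (-κ) = Real.exp (-(κ / 2)) * Real.exp (-(κ / 2)) := by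
    rw [← Real.exp_add]; congr 1; ring
  have h7 : Real.exp (u x) * Real.exp (-(κ / 2)) ≤ Real.exp (u y) := by
    rw [← Real.exp_add]
    exact Real.exp_le_exp.2 (by linarith)
  calc Real.exp (u x) * (∏ c ∈ C, |x - c| ^ β c) * Real.exp (-κ)
      = (Real.exp (u x) * Real.exp (-(κ / 2))) *
          (Real.exp (-(κ / 2)) * ∏ c ∈ C, |x - c| ^ β c) := by rw [hκ2]; ring
    _ ≤ Real.exp (u y) * ∏ c ∈ C, |y - c| ^ β c :=
        mul_le_mul h7 ((mul_le_mul_of_nonneg_right h3 hP).trans h2)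
          (mul_nonneg (Real.exp_pos _).le hP) (Real.exp_pos _).le

end IsNonflatModel

end HypPot

namespace HypPot

namespace IsNonflatModel

variable {a b : ℝ} {F d : ℝ → ℝ} {C : Finset ℝ} {β u : ℝ → ℝ}

lemma isGoodTime_of_sum (h : IsNonflatModel a b F d C β u) {κ c₀ δ₀ ρ δ : ℝ} (hκ : 0 < κ)
    (hc₀ : 0 < c₀) (hc₁ : c₀ < 1)
    (hdist : ∀ x ∈ Icc a b, ∀ y ∈ Icc a b, (∀ c ∈ C, |y - x| ≤ c₀ * |x - c|) → |y - x| ≤ δ₀ →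
      |d x| * Real.exp (-κ) ≤ |d y|)
    {S : Finset ℝ} (hCS : C ⊆ S) (ha : a ∉ S → F a = a ∨ F a = b) (hb : b ∉ S → F b = a ∨ F b = b)
    (hδ : 0 < δ) (hδ₀ : δ ≤ δ₀) (hδρ : δ ≤ c₀ * ρ) {x : ℝ} (hx : x ∈ Icc a b)
    (hxS : ∀ i, F^[i] x ∉ S) {D : ℝ → ℝ} (hD0 : ∀ y, 0 ≤ D y)
    (hD : ∀ y, ∀ s ∈ S, y ≠ s → ρ * Real.exp (-D y) ≤ |y - s|) {τ : ℕ}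
    (hsum : ∀ j ≤ τ, 2 * κ * ((τ : ℝ) - j) ≤
      ∑ i ∈ Finset.Ico j τ, (Real.log |d (F^[i] x)| - D (F^[i] x))) :
    IsGoodTime a b F δ (Real.exp (-κ)) x τ := by
  set t : ℕ → ℝ := fun j =>
    δ * Real.exp (-∑ i ∈ Finset.Ico j τ, (Real.log |d (F^[i] x)| - κ)) with ht
  have htpos : ∀ j, 0 < t j := fun j => mul_pos hδ (Real.exp_pos _)
  have hsplit : ∀ j ≤ τ, ∑ i ∈ Finset.Ico j τ, (Real.log |d (F^[i] x)| - κ) =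
      ∑ i ∈ Finset.Ico j τ, (Real.log |d (F^[i] x)| - D (F^[i] x)) +
        ∑ i ∈ Finset.Ico j τ, D (F^[i] x) - κ * ((τ : ℝ) - j) := by
    intro j hj
    simp only [Finset.sum_sub_distrib, Finset.sum_const, Nat.card_Ico, nsmul_eq_mul]
    rw [Nat.cast_sub hj]
    ring
  have hDsum : ∀ j, 0 ≤ ∑ i ∈ Finset.Ico j τ, D (F^[i] x) := fun j =>
    Finset.sum_nonneg fun i _ => hD0 _
  have hA : ∀ j ≤ τ, t j ≤ δ * Real.exp (-κ) ^ (τ - j) := by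
    intro j hj
    refine mul_le_mul_of_nonneg_left ?_ hδ.le
    rw [← Real.exp_nat_mul, Nat.cast_sub hj]
    refine Real.exp_le_exp.2 ?_
    linarith [hsplit j hj, hsum j hj, hDsum j]
  have hle : ∀ j < τ, t j ≤ δ * Real.exp (-D (F^[j] x)) := by
    intro j hj
    refine mul_le_mul_of_nonneg_left (Real.exp_le_exp.2 ?_) hδ.le
    have h1 : D (F^[j] x) ≤ ∑ i ∈ Finset.Ico j τ, D (F^[i] x) :=
      Finset.single_le_sum (f := fun i => D (F^[i] x)) (fun i _ => hD0 _)
        (Finset.mem_Ico.2 ⟨le_rfl, hj⟩)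
    have h2 : (0 : ℝ) ≤ κ * ((τ : ℝ) - j) :=
      mul_nonneg hκ.le (sub_nonneg.2 (by exact_mod_cast hj.le))
    linarith [hsplit j hj.le, hsum j hj.le]
  have hnear : ∀ j < τ, ∀ s ∈ S, t j ≤ c₀ * |F^[j] x - s| := by
    intro j hj s hs
    have h1 := hD (F^[j] x) s hs (fun h1 => hxS j (h1 ▸ hs))
    calc t j ≤ δ * Real.exp (-D (F^[j] x)) := hle j hj
      _ ≤ c₀ * ρ * Real.exp (-D (F^[j] x)) :=
          mul_le_mul_of_nonneg_right hδρ (Real.exp_pos _).le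
      _ = c₀ * (ρ * Real.exp (-D (F^[j] x))) := by ring
      _ ≤ _ := mul_le_mul_of_nonneg_left h1 hc₀.le
  have hfar : ∀ j < τ, ∀ s, |s - F^[j] x| ≤ t j → s ∉ S := by
    intro j hj s hsx hs
    have h1 := hnear j hj s hs
    rw [abs_sub_comm] at h1
    have h2 : 0 < |s - F^[j] x| := abs_pos.2 (sub_ne_zero.2 fun h2 => hxS j (h2 ▸ hs))
    nlinarith
  have hdx : ∀ j, 0 < |d (F^[j] x)| := fun j =>
    abs_pos.2 fun h0 => hxS j (hCS ((h.eq_zero_iff (h.toIsModel.iterate_mem hx j)).1 h0))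
  have hstep : ∀ j < τ, t (j + 1) = |d (F^[j] x)| * Real.exp (-κ) * t j := by
    intro j hj
    simp only [ht]
    rw [Finset.sum_eq_sum_Ico_succ_bot hj, neg_add, Real.exp_add, neg_sub, sub_eq_add_neg κ,
      Real.exp_add, Real.exp_neg (Real.log _), Real.exp_log (hdx j), Real.exp_neg κ]
    have := (hdx j).ne'
    have := (Real.exp_pos κ).ne'
    field_simp
  have key : ∀ m j, j + m = τ → ∀ w ∈ Icc a b, |w - F^[τ] x| ≤ δ → ∃ y ∈ Icc a b,
      (∀ i ≤ m, |F^[i] y - F^[j + i] x| ≤ t (j + i)) ∧ F^[m] y = w := by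
    intro m
    induction m with
    | zero =>
      intro j hj w hw hwx
      obtain rfl : j = τ := by omega
      refine ⟨w, hw, fun i hi => ?_, rfl⟩
      obtain rfl : i = 0 := by omega
      simpa [ht] using hwx
    | succ m ih =>
      intro j hj w hw hwx
      obtain ⟨y', hy', hclose, hyw⟩ := ih (j + 1) (by omega) w hw hwx
      have hjτ : j < τ := by omega
      have h0 := hclose 0 (Nat.zero_le _)
      rw [Function.iterate_zero, id, add_zero, hstep j hjτ, Function.iterate_succ_apply'] at h0
      have hxj := h.toIsModel.iterate_mem hx j
      obtain ⟨y, hy, hyx, hFy⟩ := h.toIsModel.exists_preimage_near hxj (htpos j)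
        (mul_pos (hdx j) (Real.exp_pos _))
        (fun z hz hzx => hdist _ hxj z hz
          (fun c hc => hzx.trans (hnear j hjτ c (hCS hc)))
          (hzx.trans ((hle j hjτ).trans (le_trans (by
            refine mul_le_of_le_one_right hδ.le (Real.exp_le_one_iff.2 ?_)
            linarith [hD0 (F^[j] x)]) hδ₀))))
        (fun h1 => ha (hfar j hjτ a h1)) (fun h1 => hb (hfar j hjτ b h1)) hy' h0
      refine ⟨y, hy, fun i hi => ?_, by rw [Function.iterate_succ_apply, hFy, hyw]⟩
      cases i with
      | zero => simpa using hyx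
      | succ i =>
        have := hclose i (by omega)
        rw [Function.iterate_succ_apply, hFy]
        rwa [show j + 1 + i = j + (i + 1) by ring] at this
  intro j m hjm w hw hwx
  obtain ⟨y, hy, hc, hyw⟩ := key m j hjm w hw hwx
  refine ⟨y, hy, fun i hi => (hc i hi).trans ((hA (j + i) (by omega)).trans_eq ?_), hyw⟩
  rw [show τ - (j + i) = m - i by omega]

end IsNonflatModel

end HypPot

namespace HypPot

/-- Logarithmic depth inside the `ρ`-neighbourhoods of the points of `S`. -/
def logDepth (S : Finset ℝ) (ρ x : ℝ) : ℝ := ∑ s ∈ S, max 0 (Real.log ρ - Real.log |x - s|)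

lemma logDepth_nonneg (S : Finset ℝ) (ρ x : ℝ) : 0 ≤ logDepth S ρ x :=
  Finset.sum_nonneg fun _ _ => le_max_left _ _

lemma mul_exp_neg_logDepth_le {S : Finset ℝ} {ρ : ℝ} (hρ : 0 < ρ) {x s : ℝ} (hs : s ∈ S)
    (hxs : x ≠ s) : ρ * Real.exp (-logDepth S ρ x) ≤ |x - s| := by
  have h1 : Real.log ρ - Real.log |x - s| ≤ logDepth S ρ x :=
    (le_max_right 0 _).trans (Finset.single_le_sum
      (f := fun s => max 0 (Real.log ρ - Real.log |x - s|)) (fun _ _ => le_max_left _ _) hs)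
  have h2 : 0 < |x - s| := abs_pos.2 (sub_ne_zero.2 hxs)
  rw [← Real.log_le_log_iff (mul_pos hρ (Real.exp_pos _)) h2,
    Real.log_mul hρ.ne' (Real.exp_pos _).ne', Real.log_exp]
  linarith

lemma integrable_logDepth {μ : Measure ℝ} [IsProbabilityMeasure μ] {S : Finset ℝ}
    (hS : ∀ s ∈ S, LogIntegrableAt μ s) (ρ : ℝ) : Integrable (logDepth S ρ) μ :=
  integrable_finsetSum _ fun s hs =>
    (integrable_zero _ _ _).sup ((integrable_const _).sub (hS s hs).2)

lemma exists_integral_logDepth_le {μ : Measure ℝ} [IsProbabilityMeasure μ] {S : Finset ℝ}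
    (hS : ∀ s ∈ S, LogIntegrableAt μ s) {ε : ℝ} (hε : 0 < ε) :
    ∃ ρ, 0 < ρ ∧ ∫ x, logDepth S ρ x ∂μ ≤ ε := by
  have hlim : Tendsto (fun n : ℕ => ∫ x, logDepth S (Real.exp (-(n : ℝ))) x ∂μ) atTop
      (nhds (∫ _, (0 : ℝ) ∂μ)) := by
    refine tendsto_integral_of_dominated_convergence
      (fun x => ∑ s ∈ S, |(Real.log |x - s|)|)
      (fun n => (integrable_logDepth hS _).aestronglyMeasurable)
      (integrable_finsetSum _ fun s hs => (hS s hs).2.abs) (fun n => ?_) ?_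
    · refine Eventually.of_forall fun x => ?_
      rw [Real.norm_of_nonneg (logDepth_nonneg _ _ _)]
      refine Finset.sum_le_sum fun s _ => max_le (abs_nonneg _) ?_
      rw [Real.log_exp]
      linarith [neg_abs_le (Real.log |x - s|), (Nat.cast_nonneg n : (0 : ℝ) ≤ n)]
    · refine Eventually.of_forall fun x => tendsto_const_nhds.congr' ?_
      obtain ⟨N, hN⟩ := exists_nat_ge (∑ s ∈ S, |(Real.log |x - s|)|)
      filter_upwards [eventually_ge_atTop N] with n hn
      refine (Finset.sum_eq_zero fun s hs => max_eq_left ?_).symm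
      have h1 : |(Real.log |x - s|)| ≤ ∑ s ∈ S, |(Real.log |x - s|)| :=
        Finset.single_le_sum (f := fun s => |(Real.log |x - s|)|) (fun _ _ => abs_nonneg _) hs
      have h2 : (N : ℝ) ≤ n := by exact_mod_cast hn
      rw [Real.log_exp]
      linarith [neg_abs_le (Real.log |x - s|)]
  rw [integral_zero] at hlim
  obtain ⟨n, hn⟩ := (hlim.eventually (gt_mem_nhds hε)).exists
  exact ⟨_, Real.exp_pos _, hn.le⟩

namespace IsNonflatModel

variable {a b : ℝ} {F d : ℝ → ℝ} {C : Finset ℝ} {β u : ℝ → ℝ}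

open Classical in
lemma exists_goodTimes (h : IsNonflatModel a b F d C β u) {μ : Measure ℝ} (hμ : IsInv a b F μ)
    (hIntegr : Integrable (fun x => Real.log |d x|) μ) (hpos : 0 < ∫ x, Real.log |d x| ∂μ)
    (ψ : BoundedContinuousFunction ℝ ℝ) (hψ : ∀ ν, IsInv a b F ν → ∫ x, ψ x ∂ν ≤ 0)
    (hψμ : 0 ≤ ∫ x, ψ x ∂μ) :
    ∃ δ > (0 : ℝ), δ ≤ (b - a) / 2 ∧ ∃ r > (0 : ℝ), r < 1 ∧ ∃ θ > (0 : ℝ), ∀ ε > (0 : ℝ),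
      ∀ᶠ n : ℕ in atTop, ∃ x ∈ Icc a b, -(ε * n) ≤ ∑ i ∈ Finset.range n, ψ (F^[i] x) ∧
        θ * n ≤ ((Finset.Icc 1 n).filter fun τ => IsGoodTime a b F δ r x τ).card := by
  have := hμ.1
  obtain ⟨S, hCS, hSI, hSlog, ha, hb⟩ := h.exists_singular_set hμ hIntegr
  set χ := ∫ x, Real.log |d x| ∂μ with hχ
  obtain ⟨ρ, hρ, hρ'⟩ := exists_integral_logDepth_le hSlog (half_pos hpos)
  set D := logDepth S ρ with hD
  have hDint : Integrable D μ := integrable_logDepth hSlog ρ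
  set G : ℝ → ℝ := fun x => Real.log |d x| - D x with hG
  have hGint : Integrable G μ := hIntegr.sub hDint
  have hGχ : χ / 2 ≤ ∫ x, G x ∂μ := by
    have h1 : ∫ x, G x ∂μ = χ - ∫ x, D x ∂μ := integral_sub hIntegr hDint
    linarith
  obtain ⟨M', hM', hdM'⟩ := h.toIsModel.exists_abs_le
  set M := M' + 1 with hM
  have hMpos : 0 < M := by positivity
  have hGM : ∀ x ∈ Icc a b, G x ≤ M := by
    intro x hx
    have h1 := hdM' x hx
    have h2 : Real.log |d x| ≤ |d x| := Real.log_le_self (abs_nonneg _)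
    have h3 := logDepth_nonneg S ρ x
    simp only [hG]
    linarith
  obtain ⟨c₀, hc₀, hc₁, δ₀, hδ₀, hdist⟩ := h.exists_distortion (κ := χ / 16) (by positivity)
  refine ⟨min (min δ₀ (c₀ * ρ)) ((b - a) / 2), ?_, min_le_right _ _, Real.exp (-(χ / 16)),
    Real.exp_pos _, Real.exp_lt_one_iff.2 (by linarith), χ / (8 * M), by positivity,
    fun ε hε => ?_⟩
  · have := sub_pos.2 h.lt
    positivity
  set δ := min (min δ₀ (c₀ * ρ)) ((b - a) / 2) with hδ
  have hδpos : 0 < δ := by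
    have := sub_pos.2 h.lt
    positivity
  set lam := M / ε + 1 with hlam
  have hlampos : 0 < lam := by positivity
  filter_upwards [h.toIsModel.eventually_sum_le ψ hψ (ε := χ / (4 * lam)) (by positivity)]
    with n hn
  set H : ℝ → ℝ := fun x => ∑ i ∈ Finset.range n, (G (F^[i] x) + lam * ψ (F^[i] x)) with hH
  have hψint : Integrable (fun x => ψ x) μ := ψ.integrable μ
  have hgint : Integrable (fun x => G x + lam * ψ x) μ := hGint.add (hψint.const_mul lam)
  have hHint : Integrable H μ := integrable_finsetSum _ fun i _ =>
    (hμ.2.2.iterate i).integrable_comp_of_integrable hgint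
  have hHval : n * (χ / 2) ≤ ∫ x, H x ∂μ := by
    have h1 : ∫ x, H x ∂μ = n * ∫ x, (G x + lam * ψ x) ∂μ := hμ.integral_sum n hgint
    have h2 : ∫ x, (G x + lam * ψ x) ∂μ = ∫ x, G x ∂μ + lam * ∫ x, ψ x ∂μ := by
      rw [integral_add (f := G) (g := fun x => lam * ψ x) hGint (hψint.const_mul lam),
        integral_const_mul]
    rw [h1, h2]
    have := mul_nonneg hlampos.le hψμ
    exact mul_le_mul_of_nonneg_left (by linarith) (Nat.cast_nonneg n)
  have hN : μ ((Icc a b)ᶜ ∪ ⋃ i : ℕ, F^[i] ⁻¹' (S : Set ℝ)) = 0 := by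
    refine measure_union_null hμ.2.1 (measure_iUnion_null fun i => ?_)
    rw [(hμ.2.2.iterate i).measure_preimage S.measurableSet.nullMeasurableSet]
    rw [← biUnion_of_singleton (S : Set ℝ)]
    exact (measure_biUnion_null_iff S.countable_toSet).2 fun s hs => (hSlog s hs).1
  obtain ⟨x, hxN, hxH⟩ := exists_notMem_null_integral_le hHint hN
  simp only [mem_union, mem_compl_iff, mem_iUnion, mem_preimage, not_or, not_not, not_exists,
    Finset.mem_coe] at hxN
  obtain ⟨hx, hxS⟩ := hxN
  have hHx : H x = ∑ i ∈ Finset.range n, G (F^[i] x) +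
      lam * ∑ i ∈ Finset.range n, ψ (F^[i] x) := by
    simp only [hH, Finset.sum_add_distrib, Finset.mul_sum]
  have hnx := hn x hx
  have hGsum : ∑ i ∈ Finset.range n, G (F^[i] x) ≤ M * n := by
    refine (Finset.sum_le_card_nsmul _ _ M fun i _ =>
      hGM _ (h.toIsModel.iterate_mem hx i)).trans_eq ?_
    rw [Finset.card_range, nsmul_eq_mul, mul_comm]
  have hn0 : (0 : ℝ) ≤ n := Nat.cast_nonneg n
  refine ⟨x, hx, ?_, ?_⟩
  · by_contra hcon
    push Not at hcon
    have h1 : lam * ∑ i ∈ Finset.range n, ψ (F^[i] x) < lam * -(ε * n) :=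
      mul_lt_mul_of_pos_left hcon hlampos
    have h2 : lam * -(ε * n) = -(M * n) - ε * n := by
      rw [hlam]
      field_simp
      ring
    nlinarith
  · have hGlow : χ / 4 * n ≤ ∑ i ∈ Finset.range n, G (F^[i] x) := by
      have h1 : lam * ∑ i ∈ Finset.range n, ψ (F^[i] x) ≤ lam * (χ / (4 * lam) * n) :=
        mul_le_mul_of_nonneg_left hnx hlampos.le
      have h2 : lam * (χ / (4 * lam) * n) = χ / 4 * n := by field_simp
      linarith
    set s : ℕ → ℝ := fun k => ∑ i ∈ Finset.range k, G (F^[i] x) - χ / 8 * k with hs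
    have hrec := le_mul_card_records (s := s) hMpos.le (by simp [hs]) (fun i => by
      have := hGM _ (h.toIsModel.iterate_mem hx i)
      simp only [hs, Finset.sum_range_succ]
      push_cast
      linarith) n n le_rfl
    have hsub : (Finset.Icc 1 n).filter (fun b => ∀ j ≤ b, s j ≤ s b) ⊆
        (Finset.Icc 1 n).filter fun τ => IsGoodTime a b F δ (Real.exp (-(χ / 16))) x τ := by
      refine Finset.monotone_filter_right _ fun τ _ hτ => ?_
      refine h.isGoodTime_of_sum (κ := χ / 16) (by positivity) hc₀ hc₁ hdist hCS ha hb hδpos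
        ((min_le_left _ _).trans (min_le_left _ _)) ((min_le_left _ _).trans (min_le_right _ _))
        hx hxS (logDepth_nonneg S ρ) (fun y s hs hys => mul_exp_neg_logDepth_le hρ hs hys)
        fun j hj => ?_
      have h1 := hτ j hj
      rw [Finset.sum_Ico_eq_sub _ hj]
      simp only [hs, hG] at h1
      linarith
    have hcard : (((Finset.Icc 1 n).filter fun b => ∀ j ≤ b, s j ≤ s b).card : ℝ) ≤
        ((Finset.Icc 1 n).filter fun τ =>
          IsGoodTime a b F δ (Real.exp (-(χ / 16))) x τ).card := by
      exact_mod_cast Finset.card_le_card hsub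
    refine le_trans ?_ hcard
    rw [div_mul_eq_mul_div, div_le_iff₀ (by positivity)]
    simp only [hs] at hrec
    nlinarith

end IsNonflatModel

end HypPot

namespace HypPot

/-- A closed interval at distance `δ / 2` from `z` on a side which does not leave `[a, b]`. -/
def sideInterval (b δ z : ℝ) : Set ℝ :=
  if z + δ ≤ b then Icc (z + δ / 2) (z + δ) else Icc (z - δ) (z - δ / 2)

lemma isClosed_sideInterval (b δ z : ℝ) : IsClosed (sideInterval b δ z) := by
  unfold sideInterval
  split_ifs <;> exact isClosed_Icc

lemma sideInterval_subset {a b δ z : ℝ} (hδ : 0 < δ) (hδ' : δ ≤ (b - a) / 2) (hz : z ∈ Icc a b) :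
    sideInterval b δ z ⊆ Icc a b := by
  obtain ⟨h1, h2⟩ := hz
  unfold sideInterval
  split_ifs with h
  · exact Icc_subset_Icc (by linarith) h
  · exact Icc_subset_Icc (by linarith) (by linarith)

lemma abs_sub_mem_of_mem_sideInterval {b δ z y : ℝ} (hy : y ∈ sideInterval b δ z) :
    |y - z| ≤ δ ∧ δ / 2 ≤ |y - z| := by
  unfold sideInterval at hy
  split_ifs at hy
  · have : δ / 2 ≤ y - z := by linarith [hy.1]
    exact ⟨abs_le.2 ⟨by linarith [hy.1, hy.2], by linarith [hy.2]⟩, this.trans (le_abs_self _)⟩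
  · have : δ / 2 ≤ -(y - z) := by linarith [hy.2]
    exact ⟨abs_le.2 ⟨by linarith [hy.1], by linarith [hy.1, hy.2]⟩, this.trans (neg_le_abs _)⟩

lemma exists_ball_subset_sideInterval {a b δ z : ℝ} (hδ : 0 < δ) (hδ' : δ ≤ (b - a) / 2)
    (hz : z ∈ Icc a b) : ∃ y ∈ Icc a b, ball y (δ / 4) ⊆ sideInterval b δ z := by
  have hsub := sideInterval_subset hδ hδ' hz
  unfold sideInterval at hsub ⊢
  split_ifs at hsub ⊢ with h
  · refine ⟨z + δ / 2 + δ / 4, hsub ⟨by linarith, by linarith⟩, ?_⟩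
    rw [Real.ball_eq_Ioo]
    exact Ioo_subset_Icc_self.trans (Icc_subset_Icc (by linarith) (by linarith))
  · refine ⟨z - δ / 2 - δ / 4, hsub ⟨by linarith, by linarith⟩, ?_⟩
    rw [Real.ball_eq_Ioo]
    exact Ioo_subset_Icc_self.trans (Icc_subset_Icc (by linarith) (by linarith))

lemma abs_birkhoffSum_le {F ψ : ℝ → ℝ} {B : ℝ} (hB : ∀ y, |ψ y| ≤ B) (m : ℕ) (y : ℝ) :
    |birkhoffSum F ψ m y| ≤ m * B := by
  refine (Finset.abs_sum_le_sum_abs _ _).trans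
    ((Finset.sum_le_card_nsmul _ _ B fun i _ => hB _).trans_eq ?_)
  rw [Finset.card_range, nsmul_eq_mul]

section Following

variable (a b : ℝ) (F : ℝ → ℝ) (δ r x : ℝ) (N : ℕ)

/-- Points which, starting at time `s`, follow the orbit of `x` except for a detour of length `N`
after each of the times in the list. -/
def followSet : ℕ → List ℕ → Set ℝ
  | _, [] => Icc a b
  | s, τ :: l => {y | y ∈ Icc a b ∧ (∀ i ≤ τ - s, |F^[i] y - F^[s + i] x| ≤ δ * r ^ (τ - s - i)) ∧
      F^[τ - s] y ∈ sideInterval b δ (F^[τ] x) ∧ F^[N + (τ - s)] y ∈ followSet (τ + N) l}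

/-- The total time spent following an orbit along a list of detour times. -/
def followTime : ℕ → List ℕ → ℕ
  | _, [] => 0
  | s, τ :: l => (τ - s) + (N + followTime (τ + N) l)

/-- Detour times from `E`, with the gaps needed to complete each detour. -/
def IsAdmissible (E : Set ℕ) : ℕ → List ℕ → Prop
  | _, [] => True
  | s, τ :: l => s ≤ τ ∧ τ ∈ E ∧ IsAdmissible E (τ + N) l

variable {a b F δ r x N}

lemma followSet_subset (s : ℕ) (l : List ℕ) : followSet a b F δ r x N s l ⊆ Icc a b := by
  cases l with
  | nil => exact subset_rfl
  | cons τ l => exact fun y hy => hy.1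

lemma isClosed_followSet (hF : Continuous F) (l : List ℕ) :
    ∀ s, IsClosed (followSet a b F δ r x N s l) := by
  induction l with
  | nil => exact fun _ => isClosed_Icc
  | cons τ l ih =>
    intro s
    have h1 : IsClosed {y | ∀ i ≤ τ - s, |F^[i] y - F^[s + i] x| ≤ δ * r ^ (τ - s - i)} := by
      simp only [ofPred_forall]
      exact isClosed_iInter fun i => isClosed_iInter fun _ =>
        isClosed_le ((hF.iterate i).sub continuous_const).abs continuous_const
    exact isClosed_Icc.inter (h1.inter
      (((isClosed_sideInterval _ _ _).preimage (hF.iterate _)).inter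
        ((ih _).preimage (hF.iterate _))))

lemma subset_image_followSet {E : Set ℕ} (hE : ∀ τ ∈ E, IsGoodTime a b F δ r x τ)
    (hFI : MapsTo F (Icc a b) (Icc a b)) (hx : x ∈ Icc a b)
    (hδ : 0 < δ) (hδ' : δ ≤ (b - a) / 2)
    (hN : ∀ z ∈ Icc a b, Icc a b ⊆ F^[N] '' sideInterval b δ z) (l : List ℕ) :
    ∀ s, IsAdmissible N E s l →
      Icc a b ⊆ F^[followTime N s l] '' followSet a b F δ r x N s l := by
  induction l with
  | nil => exact fun _ _ => by simp [followTime, followSet]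
  | cons τ l ih =>
    rintro s ⟨hsτ, hτE, hl⟩ w hw
    obtain ⟨v, hv, hvw⟩ := ih (τ + N) hl hw
    have hxτ : F^[τ] x ∈ Icc a b := hFI.iterate τ hx
    obtain ⟨t, ht, htv⟩ := hN _ hxτ (followSet_subset _ _ hv)
    obtain ⟨y, hy, hclose, hyt⟩ := hE τ hτE s (τ - s) (by omega) t
      (sideInterval_subset hδ hδ' hxτ ht) (abs_sub_mem_of_mem_sideInterval ht).1
    have h1 : F^[N + (τ - s)] y = v := by rw [Function.iterate_add_apply, hyt, htv]
    refine ⟨y, ⟨hy, hclose, by rwa [hyt], by rwa [h1]⟩, ?_⟩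
    rw [followTime, show τ - s + (N + followTime N (τ + N) l) =
      followTime N (τ + N) l + (N + (τ - s)) by ring, Function.iterate_add_apply, h1, hvw]

lemma birkhoffSum_sub_le_of_mem_followSet {E : Set ℕ} {ψ : ℝ → ℝ} {B K : ℝ}
    (hB : ∀ y, |ψ y| ≤ B) (hFI : MapsTo F (Icc a b) (Icc a b)) (hx : x ∈ Icc a b)
    (hK : ∀ m, ∀ y ∈ Icc a b, ∀ z ∈ Icc a b, (∀ i ≤ m, |F^[i] y - F^[i] z| ≤ δ * r ^ (m - i)) →
      birkhoffSum F ψ m z ≤ birkhoffSum F ψ m y + K) (l : List ℕ) :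
    ∀ s, IsAdmissible N E s l → ∀ y ∈ followSet a b F δ r x N s l,
      birkhoffSum F ψ (followTime N s l) (F^[s] x) - l.length * (K + 2 * (N * B)) ≤
        birkhoffSum F ψ (followTime N s l) y := by
  induction l with
  | nil => simp [followTime]
  | cons τ l ih =>
    rintro s ⟨hsτ, -, hl⟩ y ⟨hy, hclose, -, hyl⟩
    have h1 := ih _ hl _ hyl
    have h2 := hK (τ - s) y hy (F^[s] x) (hFI.iterate s hx) (fun i hi => by
      rw [← Function.iterate_add_apply, add_comm i s]
      exact hclose i hi)
    simp only [followTime, birkhoffSum_add, ← Function.iterate_add_apply]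
    rw [show τ - s + s = τ by omega, add_comm N τ]
    have h3 := abs_le.1 (abs_birkhoffSum_le (F := F) hB N (F^[τ] x))
    have h4 := abs_le.1 (abs_birkhoffSum_le (F := F) hB N (F^[τ - s] y))
    rw [List.length_cons]
    push_cast
    linarith

lemma eq_of_mem_followSet {E : Set ℕ} (hE : ∀ τ ∈ E, ∀ τ' ∈ E, τ < τ' → τ + N ≤ τ')
    (hδ : 0 < δ) (hr : 0 < r) (hr1 : r < 1) (hrN : r ^ N < 1 / 2) (l : List ℕ) :
    ∀ s l' y, l.length = l'.length → IsAdmissible N E s l → IsAdmissible N E s l' →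
      y ∈ followSet a b F δ r x N s l → y ∈ followSet a b F δ r x N s l' → l = l' := by
  have hne : ∀ s τ τ' l l' y, IsAdmissible N E s (τ :: l) → IsAdmissible N E s (τ' :: l') →
      y ∈ followSet a b F δ r x N s (τ :: l) → y ∈ followSet a b F δ r x N s (τ' :: l') →
      ¬ τ < τ' := by
    rintro s τ τ' l l' y ⟨hs, hτ, -⟩ ⟨hs', hτ', -⟩ ⟨-, -, h1, -⟩ ⟨-, h2, -, -⟩ hlt
    have h3 := h2 (τ - s) (by omega)
    rw [show s + (τ - s) = τ by omega] at h3
    have h4 := (abs_sub_mem_of_mem_sideInterval h1).2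
    have h5 : r ^ (τ' - s - (τ - s)) ≤ r ^ N :=
      pow_le_pow_of_le_one hr.le hr1.le (by have := hE τ hτ τ' hτ' hlt; omega)
    nlinarith
  induction l with
  | nil => exact fun s l' y hlen _ _ _ _ => (List.length_eq_zero_iff.1 hlen.symm).symm
  | cons τ l ih =>
    intro s l' y hlen hl hl' hy hy'
    cases l' with
    | nil => simp at hlen
    | cons τ' l' =>
      obtain rfl : τ = τ' := le_antisymm (not_lt.1 (hne _ _ _ _ _ _ hl' hl hy' hy))
        (not_lt.1 (hne _ _ _ _ _ _ hl hl' hy hy'))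
      rw [ih (τ + N) l' _ (by simpa using hlen) hl.2.2 hl'.2.2 hy.2.2.2 hy'.2.2.2]

end Following

section Words

variable (g : ℕ → ℕ) (A : ℕ)

/-- The list of times `g (A i + w i)` coded by a word `w`, closed by `g (A (i + k))`. -/
def wordTimes (w : ℕ → ℕ) : ℕ → ℕ → List ℕ
  | 0, i => [g (A * i)]
  | k + 1, i => g (A * i + w i) :: wordTimes w k (i + 1)

variable {g A}

lemma length_wordTimes (w : ℕ → ℕ) (k : ℕ) : ∀ i, (wordTimes g A w k i).length = k + 1 := by
  induction k with
  | zero => exact fun _ => rfl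
  | succ k ih => exact fun i => by rw [wordTimes, List.length_cons, ih]

lemma eq_of_wordTimes_eq {w w' : ℕ → ℕ} {L : ℕ} (hw : ∀ i, w i < A) (hw' : ∀ i, w' i < A)
    (hg : InjOn g (Iic L)) (k : ℕ) : ∀ i, A * (i + k) ≤ L →
      wordTimes g A w k i = wordTimes g A w' k i → ∀ j, i ≤ j → j < i + k → w j = w' j := by
  induction k with
  | zero => intro i _ _ j; omega
  | succ k ih =>
    intro i hi he j hj hj'
    rw [wordTimes, wordTimes, List.cons.injEq] at he
    have hL : A * i + A ≤ L := by
      refine le_trans ?_ hi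
      rw [← mul_add_one]
      exact Nat.mul_le_mul_left _ (by omega)
    rcases hj.eq_or_lt with rfl | hlt
    · have := hg (by have := hw i; simp only [mem_Iic]; omega)
        (by have := hw' i; simp only [mem_Iic]; omega) he.1
      omega
    · exact ih (i + 1) (by rwa [show i + 1 + k = i + (k + 1) by ring]) he.2 j hlt (by omega)

lemma isAdmissible_wordTimes {N : ℕ} {w : ℕ → ℕ} {L : ℕ} (hw : ∀ i, w i < A)
    (hg : ∀ i j, i < j → j ≤ L → g i + N ≤ g j) (k : ℕ) : ∀ i s, A * (i + k) ≤ L →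
      s ≤ g (A * i) → IsAdmissible N (g '' Iic L) s (wordTimes g A w k i) ∧
        s + followTime N s (wordTimes g A w k i) = g (A * (i + k)) + N := by
  induction k with
  | zero =>
    intro i s hi hs
    simp only [wordTimes, IsAdmissible, followTime]
    exact ⟨⟨hs, mem_image_of_mem _ hi, trivial⟩, by simp only [add_zero]; omega⟩
  | succ k ih =>
    intro i s hi hs
    have hmul : A * (i + 1) ≤ A * (i + (k + 1)) := Nat.mul_le_mul_left _ (by omega)
    have hwi := hw i
    have hlt : A * i + w i < A * (i + 1) := by rw [mul_add_one]; omega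
    have hgw := hg _ _ hlt (hmul.trans hi)
    obtain ⟨h1, h2⟩ := ih (i + 1) (g (A * i + w i) + N)
      (by rwa [show i + 1 + k = i + (k + 1) by ring]) hgw
    have hsw : s ≤ g (A * i + w i) := by
      rcases Nat.eq_zero_or_pos (w i) with h0 | h0
      · rwa [h0, add_zero]
      · exact hs.trans ((Nat.le_add_right _ N).trans (hg _ _ (by omega) (by omega)))
    rw [show i + 1 + k = i + (k + 1) by ring] at h2
    exact ⟨⟨hsw, mem_image_of_mem _ (by simp only [mem_Iic]; omega), h1⟩, by
      simp only [wordTimes, followTime]; omega⟩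

/-- A finite set of natural numbers contains a subset with large gaps and comparable density. -/
lemma exists_spaced (G : Finset ℕ) {N : ℕ} :
    ∃ g : ℕ → ℕ, (∀ i, N * i < G.card → g i ∈ G) ∧
      ∀ i j, i < j → N * j < G.card → g i + N ≤ g j := by
  have hfin : (Set.ofPred (· ∈ G)).Finite := G.finite_toSet
  have hcard : hfin.toFinset.card = G.card := by
    congr 1
    ext
    simp
  have hstep : ∀ k i, i + k < G.card → Nat.nth (· ∈ G) i + k ≤ Nat.nth (· ∈ G) (i + k) := by
    intro k
    induction k with
    | zero => simp
    | succ k ih =>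
      intro i hi
      have h1 := ih i (by omega)
      have h2 : Nat.nth (· ∈ G) (i + k) < Nat.nth (· ∈ G) (i + (k + 1)) :=
        Nat.nth_lt_nth_of_lt_card hfin (by omega) (by rwa [hcard])
      omega
  refine ⟨fun i => Nat.nth (· ∈ G) (N * i), fun i hi =>
    Nat.nth_mem_of_lt_card hfin (by rwa [hcard]), fun i j hij hj => ?_⟩
  have hle : N * i + N ≤ N * j := by
    rw [← mul_add_one]
    exact Nat.mul_le_mul_left _ hij
  have h1 := hstep (N * j - N * i) (N * i) (by omega)
  rw [show N * i + (N * j - N * i) = N * j by omega] at h1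
  simp only
  omega

end Words

end HypPot

namespace HypPot

/-- Bounded distortion of Birkhoff sums of a Hölder function along exponentially close orbits. -/
lemma exists_birkhoffSum_le_add {a b : ℝ} {F ψ : ℝ → ℝ} (hFI : MapsTo F (Icc a b) (Icc a b))
    {H α δ r : ℝ} (hH : 0 ≤ H) (hα : 0 < α) (hδ : 0 < δ) (hr : 0 < r) (hr1 : r < 1)
    (hψ : ∀ x ∈ Icc a b, ∀ y ∈ Icc a b, |ψ x - ψ y| ≤ H * |x - y| ^ α) :
    ∃ K, 0 ≤ K ∧ ∀ m, ∀ y ∈ Icc a b, ∀ z ∈ Icc a b,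
      (∀ i ≤ m, |F^[i] y - F^[i] z| ≤ δ * r ^ (m - i)) →
        birkhoffSum F ψ m z ≤ birkhoffSum F ψ m y + K := by
  set q := r ^ α with hq
  have hq0 : 0 < q := Real.rpow_pos_of_pos hr α
  have hq1 : q < 1 := Real.rpow_lt_one hr.le hr1 hα
  have hgeo : ∀ m : ℕ, (1 - q) * ∑ i ∈ Finset.range m, q ^ (m - i) ≤ q := by
    intro m
    induction m with
    | zero => simpa using hq0.le
    | succ m ih =>
      have h1 : ∑ i ∈ Finset.range m, q ^ (m + 1 - i) =
          q * ∑ i ∈ Finset.range m, q ^ (m - i) := by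
        rw [Finset.mul_sum]
        refine Finset.sum_congr rfl fun i hi => ?_
        rw [← pow_succ', show m + 1 - i = m - i + 1 by have := Finset.mem_range.1 hi; omega]
      rw [Finset.sum_range_succ, h1, show m + 1 - m = 1 by omega, pow_one]
      nlinarith [mul_le_mul_of_nonneg_left ih hq0.le]
  have hq1' : 0 < 1 - q := by linarith
  refine ⟨H * δ ^ α * (q / (1 - q)), by positivity, fun m y hy z hz hyz => ?_⟩
  rw [← sub_le_iff_le_add', birkhoffSum, birkhoffSum, ← Finset.sum_sub_distrib]
  have hterm : ∀ i ∈ Finset.range m,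
      ψ (F^[i] z) - ψ (F^[i] y) ≤ H * δ ^ α * q ^ (m - i) := by
    intro i hi
    have h1 := hyz i (Finset.mem_range.1 hi).le
    rw [abs_sub_comm] at h1
    calc ψ (F^[i] z) - ψ (F^[i] y) ≤ H * |F^[i] z - F^[i] y| ^ α :=
          (le_abs_self _).trans (hψ _ (hFI.iterate i hz) _ (hFI.iterate i hy))
      _ ≤ H * (δ * r ^ (m - i)) ^ α :=
          mul_le_mul_of_nonneg_left (Real.rpow_le_rpow (abs_nonneg _) h1 hα.le) hH
      _ = H * δ ^ α * q ^ (m - i) := by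
          rw [Real.mul_rpow hδ.le (by positivity), hq, ← Real.rpow_natCast, ← Real.rpow_natCast,
            ← Real.rpow_mul hr.le, ← Real.rpow_mul hr.le, mul_comm α, mul_assoc]
  refine (Finset.sum_le_sum hterm).trans ?_
  rw [← Finset.mul_sum]
  refine mul_le_mul_of_nonneg_left ?_ (by positivity)
  rw [le_div_iff₀ hq1', mul_comm]
  exact hgeo m

namespace IsNonflatModel

variable {a b : ℝ} {F d : ℝ → ℝ} {C : Finset ℝ} {β u : ℝ → ℝ}

lemma exists_forall_ball_image (h : IsNonflatModel a b F d C β u) {η : ℝ} (hη : 0 < η) :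
    ∃ N : ℕ, ∀ n, N ≤ n → ∀ y ∈ Icc a b, F^[n] '' (ball y η ∩ Icc a b) = Icc a b := by
  have h1 : ∀ p ∈ Icc a b, ∃ N : ℕ, ∀ n, N ≤ n →
      F^[n] '' (ball p (η / 2) ∩ Icc a b) = Icc a b := fun p hp =>
    h.exists_forall_image_eq isOpen_ball ⟨p, mem_ball_self (by positivity), hp⟩
  choose! N hN using h1
  obtain ⟨t, htI, hcov⟩ := (isCompact_Icc (a := a) (b := b)).elim_nhds_subcover
    (fun p => ball p (η / 2)) fun p _ => ball_mem_nhds p (by positivity)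
  refine ⟨t.sup N, fun n hn y hy => ?_⟩
  obtain ⟨p, hpt, hyp⟩ := mem_iUnion₂.1 (hcov hy)
  refine subset_antisymm ?_ ?_
  · rintro _ ⟨z, hz, rfl⟩
    exact h.toIsModel.iterate_mem hz.2 n
  · refine (hN p (htI p hpt) n ((Finset.le_sup hpt).trans hn)).symm.le.trans
      (image_mono (inter_subset_inter_left _ fun z hz => ?_))
    rw [mem_ball] at hz hyp ⊢
    have := dist_triangle_right z y p
    linarith

open Classical in
/-- Many good times along orbits with almost zero Birkhoff averages produce measures of positive
free energy. -/
lemma exists_free_energy_pos (h : IsNonflatModel a b F d C β u)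
    (ψ : BoundedContinuousFunction ℝ ℝ) (hψ : ∀ ν, IsInv a b F ν → ∫ x, ψ x ∂ν ≤ 0)
    {H α : ℝ} (hH : 0 ≤ H) (hα : 0 < α)
    (hψH : ∀ x ∈ Icc a b, ∀ y ∈ Icc a b, |ψ x - ψ y| ≤ H * |x - y| ^ α)
    {δ r θ : ℝ} (hδ : 0 < δ) (hδ' : δ ≤ (b - a) / 2) (hr : 0 < r) (hr1 : r < 1) (hθ : 0 < θ)
    (hgood : ∀ ε > (0 : ℝ), ∀ᶠ n : ℕ in atTop, ∃ x ∈ Icc a b,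
      -(ε * n) ≤ ∑ i ∈ Finset.range n, ψ (F^[i] x) ∧
        θ * n ≤ ((Finset.Icc 1 n).filter fun τ => IsGoodTime a b F δ r x τ).card) :
    ∃ ν, IsInv a b F ν ∧ 0 < ksEntropy ν F + ∫ x, ψ x ∂ν := by
  have hFI := h.toIsModel.mapsTo
  obtain ⟨N₁, hN₁⟩ := h.exists_forall_ball_image (η := δ / 4) (by positivity)
  obtain ⟨N₂, hN₂⟩ := exists_pow_lt_of_lt_one (show (0 : ℝ) < 1 / 2 by norm_num) hr1
  set N := max (max N₁ N₂) 1 with hNdef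
  have hNpos : 1 ≤ N := le_max_right _ _
  have hN : ∀ z ∈ Icc a b, Icc a b ⊆ F^[N] '' sideInterval b δ z := by
    intro z hz
    obtain ⟨y, hy, hyz⟩ := exists_ball_subset_sideInterval hδ hδ' hz
    exact (hN₁ N ((le_max_left _ _).trans (le_max_left _ _)) y hy).symm.le.trans
      (image_mono (inter_subset_left.trans hyz))
  have hrN : r ^ N < 1 / 2 :=
    (pow_le_pow_of_le_one hr.le hr1.le ((le_max_right _ _).trans (le_max_left _ _))).trans_lt hN₂
  obtain ⟨K, hK0, hK⟩ := exists_birkhoffSum_le_add hFI hH hα hδ hr hr1 hψH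
  set B := ‖ψ‖ with hBdef
  have hB : ∀ y, |ψ y| ≤ B := fun y => ψ.norm_coe_le_norm y
  have hB0 : 0 ≤ B := norm_nonneg _
  set K' := K + 2 * (N * B) with hK'
  set A := ⌈Real.exp (K' + 1)⌉₊ with hA
  have hApos : 0 < A := Nat.ceil_pos.2 (Real.exp_pos _)
  have hAlog : K' + 1 ≤ Real.log A := by
    rw [Real.le_log_iff_exp_le (by exact_mod_cast hApos)]
    exact Nat.le_ceil _
  have hNA : (0 : ℝ) < N * A := by
    have : (0 : ℝ) < N := by exact_mod_cast hNpos
    have : (0 : ℝ) < A := by exact_mod_cast hApos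
    positivity
  set ε := θ / (8 * (N * A)) with hε
  have hεpos : 0 < ε := by positivity
  obtain ⟨N₀, hN₀⟩ := eventually_atTop.1 (h.toIsModel.eventually_sum_le ψ hψ hεpos)
  have hupper : ∀ m : ℕ, ∀ y ∈ Icc a b, birkhoffSum F ψ m y ≤ ε * m + N₀ * B := by
    intro m y hy
    have hNB : 0 ≤ N₀ * B := by positivity
    have hεm : 0 ≤ ε * m := by positivity
    rcases le_total N₀ m with hm | hm
    · have := hN₀ m hm y hy
      rw [birkhoffSum]
      linarith
    · have h1 := (le_abs_self _).trans (abs_birkhoffSum_le (F := F) hB m y)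
      have h2 : (m : ℝ) * B ≤ N₀ * B := mul_le_mul_of_nonneg_right (by exact_mod_cast hm) hB0
      linarith
  obtain ⟨n, ⟨x, hx, hxψ, hxcard⟩, hn⟩ := ((hgood ε hεpos).and (tendsto_natCast_atTop_atTop
    |>.eventually_gt_atTop ((N₀ * B + N * B + K' + 1) * (4 * (N * A) / θ)))).exists
  have hK'0 : 0 ≤ K' := by positivity
  have hnpos : (0 : ℝ) < n := lt_of_le_of_lt (by positivity) hn
  obtain ⟨g, hgmem, hggap⟩ := exists_spaced
    ((Finset.Icc 1 n).filter fun τ => IsGoodTime a b F δ r x τ) (N := N)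
  set k := ⌊θ * n / (2 * (N * A))⌋₊ with hk
  have hk1 : (k : ℝ) ≤ θ * n / (2 * (N * A)) := Nat.floor_le (by positivity)
  have hk2 : θ * n / (2 * (N * A)) < k + 1 := Nat.lt_floor_add_one _
  have hkcard : N * (A * k) <
      ((Finset.Icc 1 n).filter fun τ => IsGoodTime a b F δ r x τ).card := by
    have h1 : ((N * (A * k) : ℕ) : ℝ) ≤ θ * n / 2 := by
      push_cast
      rw [le_div_iff₀ (by positivity)] at hk1
      linarith
    have h2 : 0 < θ * n := by positivity
    have h3 : ((N * (A * k) : ℕ) : ℝ) <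
        ((Finset.Icc 1 n).filter fun τ => IsGoodTime a b F δ r x τ).card := by linarith
    exact_mod_cast h3
  have hgmem' : ∀ i ≤ A * k, g i ∈ (Finset.Icc 1 n).filter fun τ => IsGoodTime a b F δ r x τ :=
    fun i hi => hgmem i ((Nat.mul_le_mul_left N hi).trans_lt hkcard)
  have hggap' : ∀ i j, i < j → j ≤ A * k → g i + N ≤ g j := fun i j hij hj =>
    hggap i j hij ((Nat.mul_le_mul_left N hj).trans_lt hkcard)
  have hginj : InjOn g (Iic (A * k)) := by
    intro i hi j hj hij
    rcases lt_trichotomy i j with hlt | he | hlt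
    · have := hggap' i j hlt hj; omega
    · exact he
    · have := hggap' j i hlt hi; omega
  have hE : ∀ τ ∈ g '' Iic (A * k), IsGoodTime a b F δ r x τ := by
    rintro _ ⟨i, hi, rfl⟩
    exact (Finset.mem_filter.1 (hgmem' i hi)).2
  have hEgap : ∀ τ ∈ g '' Iic (A * k), ∀ τ' ∈ g '' Iic (A * k), τ < τ' → τ + N ≤ τ' := by
    rintro _ ⟨i, hi, rfl⟩ _ ⟨j, hj, rfl⟩ hlt
    rcases lt_trichotomy i j with hij | rfl | hij
    · exact hggap' i j hij hj
    · omega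
    · have := hggap' j i hij hi; omega
  set word : (Fin k → Fin A) → ℕ → ℕ := fun w i => if hi : i < k then (w ⟨i, hi⟩ : ℕ) else 0
    with hword
  have hwordlt : ∀ w i, word w i < A := by
    intro w i
    simp only [hword]
    split_ifs with hi
    · exact (w _).2
    · exact hApos
  set times : (Fin k → Fin A) → List ℕ := fun w => wordTimes g A (word w) k 0 with htimes
  set T := g (A * k) + N with hT
  have hadm : ∀ w, IsAdmissible N (g '' Iic (A * k)) 0 (times w) ∧
      followTime N 0 (times w) = T := by
    intro w
    have := isAdmissible_wordTimes (hwordlt w) hggap' k 0 0 (by rw [zero_add]) (Nat.zero_le _)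
    rw [zero_add, zero_add] at this
    exact this
  have hlen : ∀ w, (times w).length = k + 1 := fun w => length_wordTimes _ _ _
  have hne : Nonempty (Fin A) := ⟨⟨0, hApos⟩⟩
  obtain ⟨B', hB', hent⟩ := h.toIsModel.exists_entropyRate_le
  obtain ⟨ν, hν, hcard, hIntegr⟩ := exists_horseshoe_measure h.cont h.lt hFI hB' hent
    (T := T) (hNpos.trans (Nat.le_add_left _ _))
    (W := fun w => followSet a b F δ r x N 0 (times w))
    (fun w => isClosed_followSet h.cont _ _) (fun w => followSet_subset _ _)
    (fun w w' hww => by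
      refine Set.disjoint_left.2 fun y hy hy' => ?_
      refine hww (funext fun i => Fin.ext ?_)
      have he := eq_of_mem_followSet hEgap hδ hr hr1 hrN (times w) 0 (times w') y
        (by rw [hlen, hlen]) (hadm w).1 (hadm w').1 hy hy'
      have := eq_of_wordTimes_eq (hwordlt w) (hwordlt w') hginj k 0 (by rw [zero_add]) he i
        (Nat.zero_le _) (by rw [zero_add]; exact i.2)
      simpa [hword] using this)
    (fun w => by
      have := subset_image_followSet hE hFI hx hδ hδ' hN _ 0 (hadm w).1
      rwa [(hadm w).2] at this)
    ψ (c := birkhoffSum F ψ T x - (k + 1) * K')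
    (fun w y hy => by
      have := birkhoffSum_sub_le_of_mem_followSet hB hFI hx hK _ 0 (hadm w).1 y hy
      rw [(hadm w).2, hlen] at this
      push_cast at this
      exact this)
  refine ⟨ν, hν, ?_⟩
  have hgn : g (A * k) ≤ n :=
    (Finset.mem_Icc.1 (Finset.mem_filter.1 (hgmem' _ le_rfl)).1).2
  have hTlow : -(2 * (ε * n)) - N₀ * B - N * B ≤ birkhoffSum F ψ T x := by
    have h1 : birkhoffSum F ψ n x = birkhoffSum F ψ (g (A * k)) x +
        birkhoffSum F ψ (n - g (A * k)) (F^[g (A * k)] x) := by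
      rw [← birkhoffSum_add, Nat.add_sub_cancel' hgn]
    have h2 := hupper (n - g (A * k)) _ (hFI.iterate (g (A * k)) hx)
    have h3 : ε * ((n - g (A * k) : ℕ) : ℝ) ≤ ε * n :=
      mul_le_mul_of_nonneg_left (by exact_mod_cast Nat.sub_le _ _) hεpos.le
    have h4 := (abs_le.1 (abs_birkhoffSum_le (F := F) hB N (F^[g (A * k)] x))).1
    have h5 : -(ε * n) ≤ birkhoffSum F ψ n x := hxψ
    rw [hT, birkhoffSum_add]
    linarith
  have hcard' : Real.log (Fintype.card (Fin k → Fin A)) = k * Real.log A := by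
    simp [Real.log_pow]
  rw [hcard'] at hcard
  have hkA : k * (K' + 1) ≤ k * Real.log A := mul_le_mul_of_nonneg_left hAlog (Nat.cast_nonneg k)
  have hkbig : N₀ * B + N * B + K' + 1 < θ * n / (4 * (N * A)) := by
    rw [lt_div_iff₀ (by positivity)]
    rw [← mul_div_assoc, div_lt_iff₀ hθ] at hn
    linarith
  have hεn : 2 * (ε * n) = θ * n / (4 * (N * A)) := by rw [hε]; field_simp; ring
  have hhalf : θ * n / (2 * (N * A)) = 2 * (θ * n / (4 * (N * A))) := by field_simp; ring
  have htot : 0 < (T : ℝ) * (ksEntropy ν F + ∫ x, ψ x ∂ν) := by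
    rw [mul_add]
    linarith
  exact pos_of_mul_pos_right htot (Nat.cast_nonneg T)

/-- If some measure of positive Lyapunov exponent maximizes the integral of a Hölder potential, then
its integral is smaller than the pressure. -/
lemma exists_free_energy_pos_of_integral_log_pos (h : IsNonflatModel a b F d C β u)
    {μ : Measure ℝ} (hμ : IsInv a b F μ)
    (hIntegr : Integrable (fun x => Real.log |d x|) μ) (hpos : 0 < ∫ x, Real.log |d x| ∂μ)
    (ψ : BoundedContinuousFunction ℝ ℝ) {H α : ℝ} (hH : 0 ≤ H) (hα : 0 < α)
    (hψH : ∀ x ∈ Icc a b, ∀ y ∈ Icc a b, |ψ x - ψ y| ≤ H * |x - y| ^ α)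
    (hψ : ∀ ν, IsInv a b F ν → ∫ x, ψ x ∂ν ≤ 0) (hψμ : 0 ≤ ∫ x, ψ x ∂μ) :
    ∃ ν, IsInv a b F ν ∧ 0 < ksEntropy ν F + ∫ x, ψ x ∂ν := by
  obtain ⟨δ, hδ, hδ', r, hr, hr1, θ, hθ, hgood⟩ := h.exists_goodTimes hμ hIntegr hpos ψ hψ hψμ
  exact h.exists_free_energy_pos ψ hψ hH hα hψH hδ hδ' hr hr1 hθ hgood

end IsNonflatModel

end HypPot

namespace HypPot

namespace IsModel

variable {a b : ℝ} {F d : ℝ → ℝ}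

lemma ksEntropy_pos_of_hyperbolic (Φ : BoundedContinuousFunction ℝ ℝ)
    (hyp : ∃ n : ℕ, 1 ≤ n ∧ ∃ c < pres a b F Φ, ∀ x ∈ Icc a b,
      ∑ i ∈ Finset.range n, Φ (F^[i] x) ≤ c * n)
    {μ : Measure ℝ} (hμ : IsInv a b F μ) (hP : ksEntropy μ F + ∫ x, Φ x ∂μ = pres a b F Φ) :
    0 < ksEntropy μ F := by
  obtain ⟨n, hn, c, hcP, hc⟩ := hyp
  have := integral_le_of_sum_le hμ hn hc
  linarith

lemma integral_log_pos_of_hyperbolic' (h : IsModel a b F d) (Φ : BoundedContinuousFunction ℝ ℝ)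
    (hyp : ∃ n : ℕ, 1 ≤ n ∧ ∃ c < pres a b F Φ, ∀ x ∈ Icc a b,
      ∑ i ∈ Finset.range n, Φ (F^[i] x) ≤ c * n)
    {μ : Measure ℝ} (hμ : IsInv a b F μ) (hP : ksEntropy μ F + ∫ x, Φ x ∂μ = pres a b F Φ) :
    0 < ∫ x, Real.log |d x| ∂μ := by
  obtain ⟨n, hn, c, hcP, hc⟩ := hyp
  exact (h.integral_log_pos_of_hyperbolic Φ hcP
    (fun ν hν => integral_le_of_sum_le hν hn hc) hμ hP).2

end IsModel

/-- For a potential which is not hyperbolic, some equilibrium state has zero entropy and does not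
have positive Lyapunov exponent. -/
lemma IsNonflatModel.exists_equilibrium_of_not_hyperbolic {a b : ℝ} {F d : ℝ → ℝ} {C : Finset ℝ}
    {β u : ℝ → ℝ} (h : IsNonflatModel a b F d C β u) (Φ : BoundedContinuousFunction ℝ ℝ)
    {H α : ℝ} (hH : 0 ≤ H) (hα : 0 < α)
    (hΦ : ∀ x ∈ Icc a b, ∀ y ∈ Icc a b, |Φ x - Φ y| ≤ H * |x - y| ^ α)
    (hyp : ¬∃ n : ℕ, 1 ≤ n ∧ ∃ c < pres a b F Φ, ∀ x ∈ Icc a b,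
      ∑ i ∈ Finset.range n, Φ (F^[i] x) ≤ c * n) :
    ∃ ν, IsInv a b F ν ∧ ksEntropy ν F + ∫ x, Φ x ∂ν = pres a b F Φ ∧ ksEntropy ν F = 0 ∧
      ∫ x, Real.log |d x| ∂ν ≤ 0 := by
  obtain ⟨ν, hν, hνP⟩ := h.toIsModel.exists_integral_ge_pres Φ hyp
  have h1 := h.toIsModel.le_pres Φ hν
  have := hν.1
  have h2 := ksEntropy_nonneg (μ := ν) (F := F)
  refine ⟨ν, hν, by linarith, by linarith, ?_⟩
  by_contra hcon
  push Not at hcon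
  have hIntegr : Integrable (fun x => Real.log |d x|) ν := by
    by_contra hni
    rw [integral_undef hni] at hcon
    exact lt_irrefl _ hcon
  have hval : ∀ μ, IsInv a b F μ →
      ∫ x, (Φ - BoundedContinuousFunction.const ℝ (pres a b F Φ)) x ∂μ =
        ∫ x, Φ x ∂μ - pres a b F Φ := by
    intro μ hμ
    have := hμ.1
    simp only [BoundedContinuousFunction.coe_sub, Pi.sub_apply,
      BoundedContinuousFunction.const_apply]
    rw [integral_sub (Φ.integrable μ) (integrable_const _)]
    simp
  obtain ⟨μ, hμ, hpos⟩ := h.exists_free_energy_pos_of_integral_log_pos hν hIntegr hcon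
    (Φ - BoundedContinuousFunction.const ℝ (pres a b F Φ)) hH hα
    (fun x hx y hy => by simpa using hΦ x hx y hy)
    (fun μ hμ => by
      have := hμ.1
      rw [hval μ hμ]
      linarith [h.toIsModel.le_pres Φ hμ, ksEntropy_nonneg (μ := μ) (F := F)])
    (by rw [hval ν hν]; linarith)
  rw [hval μ hμ] at hpos
  linarith [h.toIsModel.le_pres Φ hμ]

end HypPot

namespace HypPot

lemma eventually_mul_abs_sub_le {g : ℝ → ℝ} {g' z : ℝ} (hg : HasDerivAt g g' z) (hg' : g' ≠ 0) :
    ∃ m > (0 : ℝ), ∀ᶠ x in nhds z, m * |x - z| ≤ |g x - g z| := by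
  have h0 : 0 < |g'| := abs_pos.2 hg'
  have h1 := (hasDerivAt_iff_tendsto_slope.1 hg).abs.eventually (lt_mem_nhds (half_lt_self h0))
  refine ⟨|g'| / 2, half_pos h0, ?_⟩
  rw [eventually_nhdsWithin_iff] at h1
  filter_upwards [h1] with x hx
  rcases eq_or_ne x z with rfl | hxz
  · simp
  · have h2 := hx hxz
    rw [slope_def_field, abs_div, lt_div_iff₀ (abs_pos.2 (sub_ne_zero.2 hxz))] at h2
    exact h2.le

section Structure

variable {f : ℝ → ℝ} {a b : ℝ}

lemma log_abs_deriv_of_nonflat (hf : IsC3NonflatIntervalMap f a b) {c ℓ : ℝ} {φ ψ : ℝ → ℝ}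
    (hℓ : 1 < ℓ) (hφ : IsC3Diffeo φ) (hψ : IsC3Diffeo ψ) (hφc : φ c = 0)
    (he : ∀ᶠ x in nhdsWithin c (Icc a b), |ψ (f x)| = |φ x| ^ ℓ) :
    ∀ᶠ x in nhdsWithin c (Icc a b), x ∈ Icc a b → x ≠ c →
      Real.log |deriv f x| = Real.log ℓ + Real.log |deriv φ x| - Real.log |deriv ψ (f x)| +
        (ℓ - 1) * Real.log |φ x| := by
  filter_upwards [eventually_eventually_nhdsWithin.2 he] with x hx hxI hxc
  have hφx : φ x ≠ 0 := fun h0 => hxc (hφ.2.1.1 (h0.trans hφc.symm))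
  have hval : |ψ (f x)| = |φ x| ^ ℓ := hx.self_of_nhdsWithin hxI
  have hφpos : 0 < |φ x| := abs_pos.2 hφx
  have hψx : ψ (f x) ≠ 0 := by
    rw [← abs_pos, hval]
    exact Real.rpow_pos_of_pos hφpos _
  have hdφ : HasDerivAt φ (deriv φ x) x :=
    ((hφ.1.differentiable (by norm_num)) x).hasDerivAt
  have hdψ : HasDerivAt ψ (deriv ψ (f x)) (f x) :=
    ((hψ.1.differentiable (by norm_num)) _).hasDerivAt
  have hdf : HasDerivAt f (deriv f x) x := (hf.diff x hxI).hasDerivAt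
  have h1 : HasDerivWithinAt (fun y => Real.log (ψ (f y))) (deriv ψ (f x) * deriv f x / ψ (f x))
      (Icc a b) x := ((hdψ.comp x hdf).log hψx).hasDerivWithinAt
  have h2 : HasDerivWithinAt (fun y => ℓ * Real.log (φ y)) (ℓ * (deriv φ x / φ x))
      (Icc a b) x := ((hdφ.log hφx).const_mul ℓ).hasDerivWithinAt
  have h3 : (fun y => Real.log (ψ (f y))) =ᶠ[nhdsWithin x (Icc a b)]
      fun y => ℓ * Real.log (φ y) := by
    have hne : ∀ᶠ y in nhdsWithin x (Icc a b), φ y ≠ 0 :=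
      (hdφ.continuousAt.eventually_ne hφx).filter_mono nhdsWithin_le_nhds
    filter_upwards [hx, hne] with y hy hy0
    rw [← Real.log_abs, hy, Real.log_rpow (abs_pos.2 hy0), Real.log_abs]
  have h4 : deriv ψ (f x) * deriv f x / ψ (f x) = ℓ * (deriv φ x / φ x) :=
    (uniqueDiffOn_Icc hf.lt x hxI).eq_deriv _ h1
      (h2.congr_of_eventuallyEq_of_mem h3 hxI)
  have hφ' := hφ.2.2 x
  have hψ' := hψ.2.2 (f x)
  have h5 : |deriv f x| = ℓ * |deriv φ x| * |φ x| ^ (ℓ - 1) / |deriv ψ (f x)| := by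
    have h6 : deriv f x = ℓ * deriv φ x * ψ (f x) / (φ x * deriv ψ (f x)) := by
      field_simp at h4 ⊢
      linarith
    rw [h6, abs_div, abs_mul, abs_mul, abs_mul, hval, abs_of_pos (zero_lt_one.trans hℓ),
      Real.rpow_sub_one hφpos.ne']
    have := abs_ne_zero.2 hψ'
    field_simp
  have hp := Real.rpow_pos_of_pos hφpos (ℓ - 1)
  have hℓ0 : ℓ ≠ 0 := by linarith
  rw [h5, Real.log_div (by positivity) (abs_ne_zero.2 hψ'), Real.log_mul (by positivity) hp.ne',
    Real.log_mul hℓ0 (abs_ne_zero.2 hφ'), Real.log_rpow hφpos]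
  ring

lemma exists_tendsto_log_abs_deriv (hf : IsC3NonflatIntervalMap f a b) {c : ℝ}
    (hc : c ∈ Icc a b) (hc0 : deriv f c = 0) :
    ∃ β > (0 : ℝ), ∃ y, Tendsto (fun x => Real.log |deriv f x| - β * Real.log |x - c|)
      (nhdsWithin c (Icc a b \ {c})) (nhds y) := by
  obtain ⟨ℓ, hℓ, φ, ψ, hφ, hψ, hφc, -, he⟩ := hf.nonflat c hc hc0
  have hdφ : HasDerivAt φ (deriv φ c) c :=
    ((hφ.1.differentiable (by norm_num)) c).hasDerivAt
  have hlog : ∀ {g : ℝ → ℝ}, IsC3Diffeo g → Continuous fun x => Real.log |deriv g x| := by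
    intro g hg
    exact (hg.1.continuous_deriv (by norm_num)).abs.log fun x => abs_ne_zero.2 (hg.2.2 x)
  have h1 : Tendsto (fun x => Real.log |φ x| - Real.log |x - c|) (nhdsWithin c (Icc a b \ {c}))
      (nhds (Real.log |deriv φ c|)) := by
    have h2 := ((hasDerivAt_iff_tendsto_slope.1 hdφ).abs.log (abs_ne_zero.2 (hφ.2.2 c))).mono_left
      (nhdsWithin_mono c (show Icc a b \ {c} ⊆ {c}ᶜ from fun x hx => hx.2))
    refine h2.congr' ?_
    filter_upwards [self_mem_nhdsWithin] with x hx
    have hφx : φ x ≠ 0 := fun h0 => hx.2 (hφ.2.1.1 (h0.trans hφc.symm))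
    rw [slope_def_field, hφc, sub_zero, abs_div,
      Real.log_div (abs_ne_zero.2 hφx) (abs_ne_zero.2 (sub_ne_zero.2 hx.2))]
  have hcont : Tendsto (fun x => Real.log ℓ + Real.log |deriv φ x| - Real.log |deriv ψ (f x)|)
      (nhdsWithin c (Icc a b \ {c}))
      (nhds (Real.log ℓ + Real.log |deriv φ c| - Real.log |deriv ψ (f c)|)) :=
    ((continuousAt_const.add (hlog hφ).continuousAt).sub
      ((hlog hψ).continuousAt.comp (hf.diff c hc).continuousAt)).tendsto.mono_left
      nhdsWithin_le_nhds
  refine ⟨ℓ - 1, by linarith, _, (hcont.add (h1.const_mul (ℓ - 1))).congr' ?_⟩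
  filter_upwards [(log_abs_deriv_of_nonflat hf hℓ hφ hψ hφc he).filter_mono
    (nhdsWithin_mono c sdiff_subset), self_mem_nhdsWithin] with x hx hxI
  rw [hx hxI.1 hxI.2]
  ring

lemma exists_mul_rpow_le_abs_sub (hf : IsC3NonflatIntervalMap f a b) {z : ℝ}
    (hz : z ∈ Icc a b) : ∃ κ > (0 : ℝ), ∃ A > (0 : ℝ), ∀ᶠ x in nhdsWithin z (Icc a b),
      κ * |x - z| ^ A ≤ |f x - f z| := by
  have hdf : HasDerivAt f (deriv f z) z := (hf.diff z hz).hasDerivAt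
  by_cases h0 : deriv f z = 0
  · obtain ⟨ℓ, hℓ, φ, ψ, hφ, hψ, hφz, hψz, he⟩ := hf.nonflat z hz h0
    have hdφ : HasDerivAt φ (deriv φ z) z :=
      ((hφ.1.differentiable (by norm_num)) z).hasDerivAt
    have hdψ : DifferentiableAt ℝ ψ (f z) := (hψ.1.differentiable (by norm_num)) _
    obtain ⟨m, hm, hm'⟩ := eventually_mul_abs_sub_le hdφ (hφ.2.2 z)
    obtain ⟨L, hL, hL'⟩ := hdψ.isBigO_sub.exists_pos
    have hL'' := hdf.continuousAt.eventually hL'.bound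
    refine ⟨m ^ ℓ / L, by positivity, ℓ, by linarith, ?_⟩
    filter_upwards [he, hm'.filter_mono nhdsWithin_le_nhds, hL''.filter_mono nhdsWithin_le_nhds]
      with x h1 h2 h3
    rw [hφz, sub_zero] at h2
    rw [hψz, sub_zero, Real.norm_eq_abs, Real.norm_eq_abs, h1] at h3
    rw [div_mul_eq_mul_div, div_le_iff₀ hL, ← Real.mul_rpow hm.le (abs_nonneg _), mul_comm _ L]
    exact (Real.rpow_le_rpow (by positivity) h2 (by linarith)).trans h3
  · obtain ⟨m, hm, hm'⟩ := eventually_mul_abs_sub_le hdf h0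
    refine ⟨m, hm, 1, one_pos, ?_⟩
    filter_upwards [hm'.filter_mono nhdsWithin_le_nhds] with x hx
    rwa [Real.rpow_one]

lemma continuousOn_deriv_diff (hf : IsC3NonflatIntervalMap f a b) :
    ContinuousOn (deriv f) (Icc a b \ hf.critFinite.toFinset) := by
  have hs : Icc a b \ {x | deriv f x = 0} = Icc a b \ (hf.critFinite.toFinset : Set ℝ) := by
    ext x
    simp only [Set.mem_sdiff, Finite.coe_toFinset, mem_ofPred_eq, not_and]
    tauto
  have hu : UniqueDiffOn ℝ (Icc a b \ (hf.critFinite.toFinset : Set ℝ)) :=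
    (uniqueDiffOn_Icc hf.lt).inter (Finset.isClosed _).isOpen_compl
  have h1 := hf.smooth
  rw [hs] at h1
  refine (h1.continuousOn_derivWithin hu (by norm_num)).congr fun x hx => ?_
  exact ((hf.diff x hx.1).derivWithin (hu x hx)).symm

/-- The derivative factors as a positive continuous function times powers of the distances to the
critical points. -/
lemma exists_abs_deriv_eq (hf : IsC3NonflatIntervalMap f a b) :
    ∃ β u : ℝ → ℝ, (∀ c ∈ hf.critFinite.toFinset, 0 < β c) ∧ ContinuousOn u (Icc a b) ∧
      ∀ x ∈ Icc a b, |deriv f x| =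
        Real.exp (u x) * ∏ c ∈ hf.critFinite.toFinset, |x - c| ^ β c := by
  set C := hf.critFinite.toFinset with hC
  have hCmem : ∀ c, c ∈ C ↔ c ∈ Icc a b ∧ deriv f c = 0 := fun c => by
    simp only [hC, Finite.mem_toFinset, mem_ofPred_eq]
  have hlim : ∀ c ∈ C, ∃ β > (0 : ℝ), ∃ y,
      Tendsto (fun x => Real.log |deriv f x| - β * Real.log |x - c|)
        (nhdsWithin c (Icc a b \ {c})) (nhds y) := fun c hc =>
    exists_tendsto_log_abs_deriv hf ((hCmem c).1 hc).1 ((hCmem c).1 hc).2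
  choose! β hβ y hy using hlim
  set u₀ : ℝ → ℝ := fun x => Real.log |deriv f x| - ∑ c ∈ C, β c * Real.log |x - c| with hu₀
  set s : Set ℝ := Icc a b \ C with hs
  have hterm : ∀ c z : ℝ, z ≠ c → ContinuousAt (fun x => β c * Real.log |x - c|) z := fun c z hz =>
    continuousAt_const.mul ((continuousAt_id.sub continuousAt_const).abs.log
      (abs_ne_zero.2 (sub_ne_zero.2 hz)))
  have hcont : ContinuousOn u₀ s := by
    refine ((continuousOn_deriv_diff hf).abs.log fun x hx => ?_).sub
      (continuousOn_finsetSum _ fun c hc x hx => ?_)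
    · exact abs_ne_zero.2 fun h0 => hx.2 ((hCmem x).2 ⟨hx.1, h0⟩)
    · exact (hterm c x fun h0 => hx.2 (h0 ▸ hc)).continuousWithinAt
  have hclos : Icc a b ⊆ closure s := by
    have h1 : Ioo a b ⊆ closure (Ioo a b ∩ (C : Set ℝ)ᶜ) :=
      (C.countable_toSet.dense_compl ℝ).open_subset_closure_inter isOpen_Ioo
    rw [← closure_Ioo hf.lt.ne]
    exact (closure_minimal h1 isClosed_closure).trans
      (closure_mono (inter_subset_inter_left _ Ioo_subset_Icc_self))
  have htend : ∀ x ∈ Icc a b, ∃ y, Tendsto u₀ (nhdsWithin x s) (nhds y) := by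
    intro x hx
    by_cases hxC : x ∈ C
    · have h1 := (hy x hxC).mono_left (nhdsWithin_mono x (show s ⊆ Icc a b \ {x} from
        fun z hz => ⟨hz.1, fun h0 => hz.2 (by rw [mem_singleton_iff.1 h0]; exact hxC)⟩))
      have h2 : ContinuousAt (fun z => ∑ c ∈ C.erase x, β c * Real.log |z - c|) x :=
        tendsto_finsetSum _ fun c hc => hterm c x (Finset.ne_of_mem_erase hc).symm
      refine ⟨_, (h1.sub (h2.tendsto.mono_left nhdsWithin_le_nhds)).congr fun z => ?_⟩
      simp only [hu₀]
      rw [← Finset.add_sum_erase _ _ hxC]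
      ring
    · exact ⟨_, hcont x ⟨hx, hxC⟩⟩
  refine ⟨β, extendFrom s u₀, hβ, continuousOn_extendFrom hclos htend, fun x hx => ?_⟩
  by_cases hxC : x ∈ C
  · rw [((hCmem x).1 hxC).2, abs_zero, Finset.prod_eq_zero hxC, mul_zero]
    rw [sub_self, abs_zero, Real.zero_rpow (hβ x hxC).ne']
  · have hd : 0 < |deriv f x| := abs_pos.2 fun h0 => hxC ((hCmem x).2 ⟨hx, h0⟩)
    have hpos : ∀ c ∈ C, 0 < |x - c| := fun c hc =>
      abs_pos.2 (sub_ne_zero.2 fun h0 => hxC (h0 ▸ hc))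
    rw [extendFrom_eq (hclos hx) (hcont x ⟨hx, hxC⟩)]
    simp only [hu₀]
    rw [Real.exp_sub, Real.exp_log hd, Real.exp_sum]
    have h1 : ∏ c ∈ C, Real.exp (β c * Real.log |x - c|) = ∏ c ∈ C, |x - c| ^ β c :=
      Finset.prod_congr rfl fun c hc => by
        rw [Real.rpow_def_of_pos (hpos c hc), mul_comm]
    rw [h1, div_mul_cancel₀]
    exact (Finset.prod_pos fun c hc => Real.rpow_pos_of_pos (hpos c hc) _).ne'

end Structure

end HypPot

namespace HypPot

/-- The extension of `g` from `[a, b]` to the line that is constant on each side. -/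
def clampExt {a b : ℝ} (h : a ≤ b) (g : ℝ → ℝ) (x : ℝ) : ℝ := g (projIcc a b h x)

section ClampExt

variable {a b : ℝ} {h : a ≤ b} {f g : ℝ → ℝ}

lemma ext_eqOn : EqOn (clampExt h g) g (Icc a b) := fun x hx => by
  simp only [clampExt, projIcc_of_mem h hx]

lemma continuous_ext (hg : ContinuousOn g (Icc a b)) : Continuous (clampExt h g) :=
  hg.comp_continuous (continuous_subtype_val.comp continuous_projIcc) fun x =>
    (projIcc a b h x).2

lemma mapsTo_ext (hf : MapsTo f (Icc a b) (Icc a b)) :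
    MapsTo (clampExt h f) (Icc a b) (Icc a b) := fun x _ => hf (projIcc a b h x).2

lemma iterate_ext_eqOn (hf : MapsTo f (Icc a b) (Icc a b)) (n : ℕ) :
    EqOn (clampExt h f)^[n] f^[n] (Icc a b) := by
  intro x hx
  induction n with
  | zero => rfl
  | succ n ih =>
    rw [Function.iterate_succ_apply', Function.iterate_succ_apply', ih]
    exact ext_eqOn (hf.iterate n hx)

lemma integral_ext {μ : Measure ℝ} (hμ : μ (Icc a b)ᶜ = 0) {w : ℝ → ℝ} :
    ∫ x, w (clampExt h g x) ∂μ = ∫ x, w (g x) ∂μ := by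
  refine integral_congr_ae ?_
  filter_upwards [measure_eq_zero_iff_ae_notMem.1 hμ] with x hx
  rw [ext_eqOn (not_not.1 hx)]

lemma invariantProb_iff (hc : Continuous (clampExt h f)) {μ : Measure ℝ} :
    InvariantProb f (Icc a b) μ ↔ IsInv a b (clampExt h f) μ := by
  refine and_congr_right fun hp => ?_
  rw [← prob_compl_eq_zero_iff measurableSet_Icc]
  refine and_congr_right fun h0 => ?_
  have key : ∀ A, μ (f ⁻¹' A) = μ (clampExt h f ⁻¹' A) := by
    intro A
    refine measure_congr ?_
    filter_upwards [measure_eq_zero_iff_ae_notMem.1 h0] with x hx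
    refine propext ?_
    change f x ∈ A ↔ clampExt h f x ∈ A
    rw [ext_eqOn (not_not.1 hx)]
  constructor
  · intro hA
    refine ⟨hc.measurable, Measure.ext fun A hAm => ?_⟩
    rw [Measure.map_apply hc.measurable hAm, ← key, hA A hAm]
  · intro hm A hAm
    rw [key, hm.measure_preimage hAm.nullMeasurableSet]

lemma ksEntropy_ext (hf : MapsTo f (Icc a b) (Icc a b)) {μ : Measure ℝ}
    (hμ : μ (Icc a b)ᶜ = 0) : ksEntropy μ (clampExt h f) = ksEntropy μ f :=
  ksEntropy_congr hμ (mapsTo_ext hf) ext_eqOn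

lemma pressure_eq_pres (hf : MapsTo f (Icc a b) (Icc a b)) (hc : Continuous (clampExt h f)) :
    pressure f (Icc a b) g = pres a b (clampExt h f) (clampExt h g) := by
  unfold pressure pres
  congr 1
  ext r
  simp only [mem_ofPred_eq]
  refine exists_congr fun μ => ?_
  rw [invariantProb_iff hc]
  refine and_congr_right fun hμ => ?_
  rw [ksEntropy_ext hf hμ.2.1, integral_ext hμ.2.1 (w := fun y => y)]

lemma isEquilibriumState_iff (hf : MapsTo f (Icc a b) (Icc a b)) (hc : Continuous (clampExt h f))
    {μ : Measure ℝ} :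
    IsEquilibriumState f (Icc a b) g μ ↔ IsInv a b (clampExt h f) μ ∧
      ksEntropy μ (clampExt h f) + ∫ x, clampExt h g x ∂μ = pres a b (clampExt h f) (clampExt h g) := by
  unfold IsEquilibriumState
  rw [invariantProb_iff hc, pressure_eq_pres hf hc]
  refine and_congr_right fun hμ => ?_
  rw [ksEntropy_ext hf hμ.2.1, integral_ext hμ.2.1 (w := fun y => y)]

lemma hyperbolicPotential_iff (hf : MapsTo f (Icc a b) (Icc a b)) (hc : Continuous (clampExt h f))
    (hg : ContinuousOn g (Icc a b)) :
    HyperbolicPotential f (Icc a b) g ↔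
      ∃ n : ℕ, 1 ≤ n ∧ ∃ c < pres a b (clampExt h f) (clampExt h g), ∀ x ∈ Icc a b,
        ∑ i ∈ Finset.range n, clampExt h g ((clampExt h f)^[i] x) ≤ c * n := by
  unfold HyperbolicPotential
  rw [pressure_eq_pres hf hc]
  refine exists_congr fun n => and_congr_right fun hn => ?_
  have hn' : (0 : ℝ) < n := by exact_mod_cast hn
  have hsum : ∀ x ∈ Icc a b,
      birkhoffSum f g n x = ∑ i ∈ Finset.range n, clampExt h g ((clampExt h f)^[i] x) := by
    intro x hx
    refine Finset.sum_congr rfl fun i _ => ?_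
    rw [iterate_ext_eqOn hf i hx, ext_eqOn (hf.iterate i hx)]
  have hcont : Continuous fun x => ∑ i ∈ Finset.range n, clampExt h g ((clampExt h f)^[i] x) :=
    continuous_finsetSum _ fun i _ => (continuous_ext hg).comp (hc.iterate i)
  have himg : (fun x => birkhoffSum f g n x / n) '' Icc a b =
      (fun x => (∑ i ∈ Finset.range n, clampExt h g ((clampExt h f)^[i] x)) / n) '' Icc a b :=
    image_congr fun x hx => by rw [hsum x hx]
  rw [himg]
  constructor
  · refine fun hlt => ⟨_, hlt, fun x hx => ?_⟩
    rw [← div_le_iff₀ hn']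
    exact le_csSup (isCompact_Icc.bddAbove_image (hcont.div_const _).continuousOn)
      (mem_image_of_mem _ hx)
  · rintro ⟨c, hc, hle⟩
    refine lt_of_le_of_lt (csSup_le ((nonempty_Icc.2 h).image _) ?_) hc
    rintro _ ⟨x, hx, rfl⟩
    exact (div_le_iff₀ hn').2 (hle x hx)

/-- The extension of a continuous function on `[a, b]`, as a bounded continuous function. -/
def extBCF (h : a ≤ b) (hg : ContinuousOn g (Icc a b)) : BoundedContinuousFunction ℝ ℝ :=
  BoundedContinuousFunction.compContinuous
    (BoundedContinuousFunction.mkOfCompact ⟨(Icc a b).domRestrict g, hg.domRestrict⟩)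
    ⟨projIcc a b h, continuous_projIcc⟩

@[simp] lemma coe_extBCF (hg : ContinuousOn g (Icc a b)) : ⇑(extBCF h hg) = clampExt h g := rfl

end ClampExt

lemma continuousOn_of_holderOn {φ : ℝ → ℝ} {I : Set ℝ} (hφ : HolderOn φ I) :
    ContinuousOn φ I := by
  obtain ⟨H, α, hα, -, -, hle⟩ := hφ
  intro x hx
  rw [ContinuousWithinAt, tendsto_iff_dist_tendsto_zero]
  have hlim : Tendsto (fun y => H * |y - x| ^ α) (nhdsWithin x I) (nhds 0) := by
    have hct : Continuous fun y => H * |y - x| ^ α :=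
      continuous_const.mul ((continuous_id.sub continuous_const).abs.rpow_const
        fun _ => Or.inr hα.le)
    have := hct.tendsto x
    simp only [sub_self, abs_zero, Real.zero_rpow hα.ne', mul_zero] at this
    exact this.mono_left nhdsWithin_le_nhds
  refine tendsto_of_tendsto_of_tendsto_of_le_of_le' tendsto_const_nhds hlim
    (Eventually.of_forall fun _ => dist_nonneg) ?_
  filter_upwards [self_mem_nhdsWithin] with y hy
  exact hle y hy x hx

variable {a b : ℝ} {f : ℝ → ℝ}

lemma exists_isNonflatModel_ext (hf : IsC3NonflatIntervalMap f a b)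
    (hex : TopExact f (Icc a b)) :
    ∃ β u : ℝ → ℝ, IsNonflatModel a b (clampExt hf.lt.le f) (clampExt hf.lt.le (deriv f))
      hf.critFinite.toFinset β u := by
  obtain ⟨β, u, hβ, hu, habs⟩ := exists_abs_deriv_eq hf
  have hfc : ContinuousOn f (Icc a b) := fun x hx =>
    (hf.diff x hx).continuousAt.continuousWithinAt
  have hE : EqOn (clampExt hf.lt.le f) f (Icc a b) := ext_eqOn
  have hdc : ContinuousOn (fun x => |deriv f x|) (Icc a b) := by
    refine ContinuousOn.congr ?_ habs
    refine (Real.continuous_exp.comp_continuousOn hu).mul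
      (Continuous.continuousOn (continuous_finsetProd _ fun c hc => ?_))
    exact (continuous_id.sub continuous_const).abs.rpow_const fun _ => Or.inr (hβ c hc).le
  refine ⟨β, clampExt hf.lt.le u, ?_⟩
  exact
    { lt := hf.lt
      cont := continuous_ext hfc
      mem := fun x => hf.mapsTo (projIcc a b hf.lt.le x).2
      proj := fun x => by simp only [clampExt, projIcc_val]
      deriv := fun x hx => by
        rw [ext_eqOn hx]
        exact (hf.diff x hx).hasDerivAt.hasDerivWithinAt.congr hE (hE hx)
      cont_abs := continuous_ext (h := hf.lt.le) hdc
      crit_mem := fun c hc => (hf.critFinite.mem_toFinset.1 hc).1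
      order_pos := hβ
      cont_u := continuous_ext hu
      abs_eq := fun x hx => by
        rw [ext_eqOn hx, ext_eqOn hx]
        exact habs x hx
      lower := fun z hz => by
        obtain ⟨κ, hκ, A, hA, he⟩ := exists_mul_rpow_le_abs_sub hf hz
        refine ⟨κ, hκ, A, hA, ?_⟩
        filter_upwards [he, self_mem_nhdsWithin] with x hx hxI
        rwa [hE hxI, hE hz]
      exact := fun U hU hne => by
        obtain ⟨n, hn, he⟩ := hex U hU hne
        refine ⟨n, hn, ?_⟩
        exact (image_congr fun x hx => iterate_ext_eqOn hf.mapsTo n hx.2).trans he }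

end HypPot

/-- **Theorem (Main result).** For a topologically exact `C³` interval map with non-flat
critical points and a Hölder continuous potential `φ`, the following are equivalent:
(1) `φ` is hyperbolic for `f`;
(2) every equilibrium state of `f` for `φ` has strictly positive entropy;
(3) every equilibrium state of `f` for `φ` has strictly positive Lyapunov exponent. -/
theorem hyperbolic_potential_characterization
    (a b : ℝ) (f φ : ℝ → ℝ)
    (hf : IsC3NonflatIntervalMap f a b)
    (hex : TopExact f (Icc a b))
    (hφ : HolderOn φ (Icc a b)) :
    (HyperbolicPotential f (Icc a b) φ ↔
      ∀ μ : Measure ℝ, IsEquilibriumState f (Icc a b) φ μ → 0 < ksEntropy μ f) ∧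
    (HyperbolicPotential f (Icc a b) φ ↔
      ∀ μ : Measure ℝ, IsEquilibriumState f (Icc a b) φ μ →
        0 < ∫ x, Real.log |deriv f x| ∂μ) := by
  obtain ⟨β, u, h⟩ := HypPot.exists_isNonflatModel_ext hf hex
  have hc := h.cont
  have hφc := HypPot.continuousOn_of_holderOn hφ
  obtain ⟨H, α, hα, -, hH, hle⟩ := hφ
  have hle' : ∀ x ∈ Icc a b, ∀ y ∈ Icc a b,
      |HypPot.extBCF hf.lt.le hφc x - HypPot.extBCF hf.lt.le hφc y| ≤ H * |x - y| ^ α := by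
    intro x hx y hy
    rw [HypPot.coe_extBCF, HypPot.ext_eqOn hx, HypPot.ext_eqOn hy]
    exact hle x hx y hy
  rw [HypPot.hyperbolicPotential_iff (h := hf.lt.le) hf.mapsTo hc hφc]
  simp only [HypPot.isEquilibriumState_iff (h := hf.lt.le) hf.mapsTo hc]
  have hlog : ∀ μ : Measure ℝ, HypPot.IsInv a b (HypPot.clampExt hf.lt.le f) μ →
      ∫ x, Real.log |HypPot.clampExt hf.lt.le (deriv f) x| ∂μ = ∫ x, Real.log |deriv f x| ∂μ :=
    fun μ hμ => HypPot.integral_ext hμ.2.1 (w := fun y => Real.log |y|)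
  refine ⟨⟨fun hyp μ hμ => ?_, fun hpos => ?_⟩, ⟨fun hyp μ hμ => ?_, fun hpos => ?_⟩⟩
  · rw [← HypPot.ksEntropy_ext (h := hf.lt.le) hf.mapsTo hμ.1.2.1]
    exact HypPot.IsModel.ksEntropy_pos_of_hyperbolic (HypPot.extBCF hf.lt.le hφc) hyp hμ.1 hμ.2
  · by_contra hyp
    obtain ⟨ν, hν, hνP, h0, -⟩ :=
      h.exists_equilibrium_of_not_hyperbolic (HypPot.extBCF hf.lt.le hφc) hH hα hle' hyp
    have := hpos ν ⟨hν, hνP⟩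
    rw [← HypPot.ksEntropy_ext (h := hf.lt.le) hf.mapsTo hν.2.1, h0] at this
    exact this.false
  · rw [← hlog μ hμ.1]
    exact h.toIsModel.integral_log_pos_of_hyperbolic' (HypPot.extBCF hf.lt.le hφc) hyp hμ.1 hμ.2
  · by_contra hyp
    obtain ⟨ν, hν, hνP, -, h0⟩ :=
      h.exists_equilibrium_of_not_hyperbolic (HypPot.extBCF hf.lt.le hφc) hH hα hle' hyp
    have := hpos ν ⟨hν, hνP⟩
    rw [← hlog ν hν] at this
    linarith

end
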